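/- Let k ≥ l ≥ 1 be integers with k + l ≥ 6. Then: (i) s(G) ≤ OPT(k,l) for every finite oriented graph G on n ≥ 1 vertices; and (ii) for every ε > 0 there exists a finite oriented graph G with s(G) > OPT(k,l) − ε. In other words, the supremum of s(G) over all finite oriented graphs G equals OPT(k,l). -/

import Mathlib

open scoped BigOperators

/-- The arc relation of the oriented star `S_{k,l}` on `Fin (k+l+1)`:
vertex `0` is the center, vertices `1,…,k` are the out-leaves and
vertices `k+1,…,k+l` are the in-leaves. -/
def StarArc (k l : ℕ) (a b : Fin (k + l + 1)) : Prop :=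
  (a.val = 0 ∧ 1 ≤ b.val ∧ b.val ≤ k) ∨ (b.val = 0 ∧ k + 1 ≤ a.val)

/-- `φ` witnesses an induced copy of `S_{k,l}` in the digraph with arc relation `A`:
it is injective and maps arcs to arcs and non-arcs to non-arcs. -/
def IsStarEmb (k l : ℕ) {V : Type*} (A : V → V → Prop) (φ : Fin (k + l + 1) → V) : Prop :=
  Function.Injective φ ∧ ∀ a b, StarArc k l a b ↔ A (φ a) (φ b)

/-- `s(G)`: the probability that a uniformly random map `V(S_{k,l}) → V(G)`
induces a copy of `S_{k,l}`. -/
noncomputable def starProb (k l : ℕ) (V : Type*) [Fintype V] (A : V → V → Prop) : ℝ :=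
  (Nat.card {φ : Fin (k + l + 1) → V // IsStarEmb k l A φ} : ℝ) /
    (Fintype.card V : ℝ) ^ (k + l + 1)

/-- The probability that a uniformly random map induces a copy of `S_{k,l}`
and moreover has property `P`. -/
noncomputable def starProbOn (k l : ℕ) {V : Type*} [Fintype V] (A : V → V → Prop)
    (P : (Fin (k + l + 1) → V) → Prop) : ℝ :=
  (Nat.card {φ : Fin (k + l + 1) → V // IsStarEmb k l A φ ∧ P φ} : ℝ) /
    (Fintype.card V : ℝ) ^ (k + l + 1)

/-- `s(z→v) = Pr[φ ∈ 𝒮 | φ z = v]`. -/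
noncomputable def sCond (k l : ℕ) {V : Type*} [Fintype V] (A : V → V → Prop)
    (z : Fin (k + l + 1)) (v : V) : ℝ :=
  (Nat.card {φ : Fin (k + l + 1) → V // IsStarEmb k l A φ ∧ φ z = v} : ℝ) /
    (Fintype.card V : ℝ) ^ (k + l)

/-- `Pr[φ ∈ 𝒮 ∧ P φ | φ(c) = v]`, where `c = 0` is the center of the star. -/
noncomputable def sCondOn (k l : ℕ) {V : Type*} [Fintype V] (A : V → V → Prop) (v : V)
    (P : (Fin (k + l + 1) → V) → Prop) : ℝ :=
  (Nat.card {φ : Fin (k + l + 1) → V // IsStarEmb k l A φ ∧ φ 0 = v ∧ P φ} : ℝ) /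
    (Fintype.card V : ℝ) ^ (k + l)

open scoped Fin.NatCast in
/-- `s(v) = (s(c→v) + l·s(i→v) + k·s(o→v))/(m+1)`, where the center is `0`,
`k+1` is an in-leaf and `1` is an out-leaf. -/
noncomputable def sVert (k l : ℕ) {V : Type*} [Fintype V] (A : V → V → Prop) (v : V) : ℝ :=
  (sCond k l A 0 v + l * sCond k l A ((k + 1 : ℕ) : Fin (k + l + 1)) v
      + k * sCond k l A 1 v) / ((k : ℝ) + l + 1)

/-- `ρ(v)`: the proportion of vertices adjacent to `v`. -/
noncomputable def rho {V : Type*} [Fintype V] (A : V → V → Prop) (v : V) : ℝ :=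
  (Nat.card {u : V // A v u ∨ A u v} : ℝ) / (Fintype.card V : ℝ)

/-- `ρ⁺_B(v)`: the proportion of vertices that are out-neighbours of `v` lying in `B`. -/
noncomputable def rhoPIn {V : Type*} [Fintype V] (A : V → V → Prop) (B : Set V) (v : V) : ℝ :=
  (Nat.card {u : V // A v u ∧ u ∈ B} : ℝ) / (Fintype.card V : ℝ)

/-- `ρ⁻_B(v)`: the proportion of vertices that are in-neighbours of `v` lying in `B`. -/
noncomputable def rhoMIn {V : Type*} [Fintype V] (A : V → V → Prop) (B : Set V) (v : V) : ℝ :=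
  (Nat.card {u : V // A u v ∧ u ∈ B} : ℝ) / (Fintype.card V : ℝ)

/-- `ρ_B(v)`: the proportion of vertices adjacent to `v` lying in `B`. -/
noncomputable def rhoIn {V : Type*} [Fintype V] (A : V → V → Prop) (B : Set V) (v : V) : ℝ :=
  (Nat.card {u : V // (A v u ∨ A u v) ∧ u ∈ B} : ℝ) / (Fintype.card V : ℝ)

/-- `μ(B) = |B|/n`. -/
noncomputable def muSet {V : Type*} [Fintype V] (B : Set V) : ℝ :=
  (Nat.card B : ℝ) / (Fintype.card V : ℝ)

/-- `X`: the set of vertices of large degree, `ρ(v) ≥ 1/2`. -/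
def bigX {V : Type*} [Fintype V] (A : V → V → Prop) : Set V := {v | 1 / 2 ≤ rho A v}

/-- `Y = V(G) \ X`. -/
def bigY {V : Type*} [Fintype V] (A : V → V → Prop) : Set V := (bigX A)ᶜ

/-- `α = μ(X)`. -/
noncomputable def alphaX {V : Type*} [Fintype V] (A : V → V → Prop) : ℝ := muSet (bigX A)

/-- `D = min_{x ∈ X} ρ(x)`. -/
noncomputable def Dmin {V : Type*} [Fintype V] (A : V → V → Prop) : ℝ :=
  sInf (rho A '' bigX A)

/-- `β = max_{y ∈ Y} ρ_Y(y)`. -/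
noncomputable def betaY {V : Type*} [Fintype V] (A : V → V → Prop) : ℝ :=
  sSup ((fun y => rhoIn A (bigY A) y) '' bigY A)

/-- `γ = min_{x ∈ X} ρ⁻_Y(x)`. -/
noncomputable def gammaX {V : Type*} [Fintype V] (A : V → V → Prop) : ℝ :=
  sInf ((fun x => rhoMIn A (bigY A) x) '' bigX A)

/-- `S = (m+1)·min_{v ∈ V(G)} s(v)`. -/
noncomputable def Smin (k l : ℕ) {V : Type*} [Fintype V] (A : V → V → Prop) : ℝ :=
  ((k : ℝ) + l + 1) * sInf (Set.range (sVert k l A))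

/-- `S₁ = min_{x ∈ X} (ρ⁺_Y(x))^k (ρ⁻_Y(x))^l`. -/
noncomputable def S1min (k l : ℕ) {V : Type*} [Fintype V] (A : V → V → Prop) : ℝ :=
  sInf ((fun x => rhoPIn A (bigY A) x ^ k * rhoMIn A (bigY A) x ^ l) '' bigX A)

/-- `S₂ = S₁ − ((m−1)/((m+1)·C(m,k)))·(α+β)(1−α)(1−D)^{m−2}`. -/
noncomputable def S2min (k l : ℕ) {V : Type*} [Fintype V] (A : V → V → Prop) : ℝ :=
  S1min k l A - (((k : ℝ) + l - 1) / (((k : ℝ) + l + 1) * (Nat.choose (k + l) k : ℝ)))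
    * (alphaX A + betaY A) * (1 - alphaX A) * (1 - Dmin A) ^ (k + l - 2)

/-- `λ₀ = k^k l^l / m^m`. -/
noncomputable def lam0 (k l : ℕ) : ℝ := (k : ℝ) ^ k * (l : ℝ) ^ l / ((k : ℝ) + l) ^ (k + l)

/-- `λ₁ = k^k l (l−1)^{l−1} / (m−1)^{m−1}` (with the convention `0⁰ = 1`). -/
noncomputable def lam1 (k l : ℕ) : ℝ :=
  (k : ℝ) ^ k * (l : ℝ) * ((l : ℝ) - 1) ^ (l - 1) / ((k : ℝ) + l - 1) ^ (k + l - 1)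

/-- The edge density `ρ(Z)` of a set of vertices `Z`: the number of unordered adjacent
pairs in `Z` divided by `C(|Z|,2)`. -/
noncomputable def densSet {V : Type*} [Fintype V] (A : V → V → Prop) (Z : Set V) : ℝ :=
  ((Nat.card {p : V × V // p.1 ∈ Z ∧ p.2 ∈ Z ∧ (A p.1 p.2 ∨ A p.2 p.1)} : ℝ) / 2) /
    (Nat.choose (Nat.card Z) 2 : ℝ)

/-- `d = 1 − (E_{x ∈ X} ρ⁻_Y(x))/(1−α)`. -/
noncomputable def dXY {V : Type*} [Fintype V] (A : V → V → Prop) : ℝ :=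
  1 - ((∑ᶠ x ∈ bigX A, rhoMIn A (bigY A) x) / (Nat.card (bigX A) : ℝ)) / (1 - alphaX A)

/-- `OPT(k,l)`. -/
noncomputable def OPT (k l : ℕ) : ℝ :=
  if k = l then
    (1 / 2 ^ (2 * k)) *
      sSup {y : ℝ | ∃ a ∈ Set.Icc (0 : ℝ) 1, y = a * (1 - a) ^ (2 * k) + (1 - a) * a ^ (2 * k)}
  else
    sSup {y : ℝ | ∃ a ∈ Set.Icc (0 : ℝ) (1 / 2),
      ∃ d ∈ Set.Icc (0 : ℝ) ((k : ℝ) / ((k : ℝ) + (l : ℝ))),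
      y = a * (1 - a) ^ (k + l) * d ^ k * (1 - d) ^ l
        + (((k : ℝ) - 1) ^ (k - 1) * (l : ℝ) ^ l / ((k : ℝ) + (l : ℝ) - 1) ^ (k + l - 1))
          * (1 - a) * a ^ (k + l) * (1 - d)}

namespace OS

/-- Weighted AM-GM in product form. -/
theorem amgm (i j : ℕ) (p q : ℝ) (hp : 0 ≤ p) (hq : 0 ≤ q) :
    p ^ i * q ^ j * ((i : ℝ) + j) ^ (i + j) ≤ (i : ℝ) ^ i * (j : ℝ) ^ j * (p + q) ^ (i + j) := by
  rcases Nat.eq_zero_or_pos i with rfl | hi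
  · simp only [pow_zero, one_mul, Nat.cast_zero, zero_add]
    rw [mul_comm]
    gcongr
    linarith
  rcases Nat.eq_zero_or_pos j with rfl | hj
  · simp only [pow_zero, mul_one, Nat.cast_zero, add_zero]
    rw [mul_comm]
    gcongr
    linarith
  have hi' : (0 : ℝ) < i := by exact_mod_cast hi
  have hj' : (0 : ℝ) < j := by exact_mod_cast hj
  have hn : (0 : ℝ) < (i : ℝ) + j := by linarith
  have h := Real.geom_mean_le_arith_mean2_weighted (w₁ := i / ((i : ℝ) + j)) (w₂ := j / ((i : ℝ) + j))
    (p₁ := p / i) (p₂ := q / j) (by positivity) (by positivity) (by positivity) (by positivity)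
    (by field_simp)
  have h2 : (i : ℝ) / (i + j) * (p / i) + j / (i + j) * (q / j) = (p + q) / (i + j) := by
    field_simp
  rw [h2] at h
  have h3 := pow_le_pow_left₀ (by positivity) h (i + j)
  have h4 : ((p / (i : ℝ)) ^ ((i : ℝ) / (i + j)) * (q / j) ^ ((j : ℝ) / (i + j))) ^ (i + j)
      = (p / i) ^ i * (q / j) ^ j := by
    rw [mul_pow, ← Real.rpow_natCast, ← Real.rpow_natCast, ← Real.rpow_mul (by positivity),
      ← Real.rpow_mul (by positivity)]
    push_cast
    rw [div_mul_cancel₀ _ hn.ne', div_mul_cancel₀ _ hn.ne', Real.rpow_natCast, Real.rpow_natCast]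
  rw [h4, div_pow, div_pow, div_pow, div_mul_div_comm, div_le_div_iff₀ (by positivity) (by positivity)] at h3
  linarith

/-- `J i j = i^i j^j / (i+j)^(i+j)`. -/
noncomputable def J (i j : ℕ) : ℝ := (i : ℝ) ^ i * (j : ℝ) ^ j / ((i : ℝ) + j) ^ (i + j)

theorem npow_pos (i : ℕ) : (0 : ℝ) < (i : ℝ) ^ i := by
  rcases Nat.eq_zero_or_pos i with rfl | hi
  · simp
  · have : (0 : ℝ) < i := by exact_mod_cast hi
    positivity

theorem nnpow_pos (i j : ℕ) : (0 : ℝ) < ((i : ℝ) + j) ^ (i + j) := by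
  have := npow_pos (i + j)
  push_cast at this
  exact this

theorem J_pos (i j : ℕ) : 0 < J i j := by
  unfold J
  have := npow_pos i
  have := npow_pos j
  have := nnpow_pos i j
  positivity

theorem amgmJ (i j : ℕ) (p q r : ℝ) (hp : 0 ≤ p) (hq : 0 ≤ q) (hr : p + q ≤ r) :
    p ^ i * q ^ j ≤ J i j * r ^ (i + j) := by
  have h1 := amgm i j p q hp hq
  have h2 := nnpow_pos i j
  have h3 : p ^ i * q ^ j ≤ J i j * (p + q) ^ (i + j) := by
    unfold J
    rw [div_mul_eq_mul_div, le_div_iff₀ h2]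
    exact h1
  refine h3.trans ?_
  have := J_pos i j
  gcongr

/-- `Lam1 = k^k l^l/(m-1)^(m-1)`. -/
noncomputable def Lam1 (k l : ℕ) : ℝ := (k : ℝ) ^ k * (l : ℝ) ^ l / ((k + l - 1 : ℕ) : ℝ) ^ (k + l - 1)
/-- `Lam2 = k^k l^l/(m-2)^(m-2)`. -/
noncomputable def Lam2 (k l : ℕ) : ℝ := (k : ℝ) ^ k * (l : ℝ) ^ l / ((k + l - 2 : ℕ) : ℝ) ^ (k + l - 2)

theorem Lam1_pos (k l : ℕ) : 0 < Lam1 k l := by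
  unfold Lam1
  have := npow_pos k
  have := npow_pos l
  have := npow_pos (k + l - 1)
  positivity

theorem Lam2_pos (k l : ℕ) : 0 < Lam2 k l := by
  unfold Lam2
  have := npow_pos k
  have := npow_pos l
  have := npow_pos (k + l - 2)
  positivity

theorem npred (k : ℕ) (hk : 1 ≤ k) : (k : ℝ) * ((k - 1 : ℕ) : ℝ) ^ (k - 1) ≤ (k : ℝ) ^ k := by
  obtain ⟨a, rfl⟩ : ∃ a, k = a + 1 := ⟨k - 1, by omega⟩
  simp only [Nat.add_sub_cancel]
  rw [pow_succ, mul_comm]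
  push_cast
  gcongr
  linarith

theorem npred2 (k : ℕ) (hk : 2 ≤ k) :
    (k : ℝ) * ((k : ℝ) - 1) * ((k - 2 : ℕ) : ℝ) ^ (k - 2) ≤ (k : ℝ) ^ k := by
  have h1 := npred k (by omega)
  have h2 := npred (k - 1) (by omega)
  have e : k - 1 - 1 = k - 2 := by omega
  rw [e] at h2
  have e2 : ((k - 1 : ℕ) : ℝ) = (k : ℝ) - 1 := by push_cast [Nat.cast_sub (show 1 ≤ k by omega)]; ring
  calc (k : ℝ) * ((k : ℝ) - 1) * ((k - 2 : ℕ) : ℝ) ^ (k - 2)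
      = (k : ℝ) * (((k - 1 : ℕ) : ℝ) * ((k - 2 : ℕ) : ℝ) ^ (k - 2)) := by rw [e2]; ring
    _ ≤ (k : ℝ) * ((k - 1 : ℕ) : ℝ) ^ (k - 1) := by gcongr
    _ ≤ _ := h1

theorem lam1_out (k l : ℕ) (hk : 1 ≤ k) (p q r : ℝ) (hp : 0 ≤ p) (hq : 0 ≤ q) (hr : p + q ≤ r) :
    (k : ℝ) * (p ^ (k - 1) * q ^ l) ≤ Lam1 k l * r ^ (k + l - 1) := by
  have h := amgmJ (k - 1) l p q r hp hq hr
  have e : k - 1 + l = k + l - 1 := by omega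
  have hr0 : 0 ≤ r := by linarith
  calc (k : ℝ) * (p ^ (k - 1) * q ^ l) ≤ k * (J (k - 1) l * r ^ (k - 1 + l)) := by gcongr
    _ = (k * J (k - 1) l) * r ^ (k + l - 1) := by rw [e]; ring
    _ ≤ _ := by
      gcongr
      unfold J Lam1
      rw [← Nat.cast_add, e, mul_div_assoc', ← mul_assoc]
      have := npred k hk
      have := npow_pos l
      have := npow_pos (k + l - 1)
      gcongr

theorem lam1_in (k l : ℕ) (hl : 1 ≤ l) (p q r : ℝ) (hp : 0 ≤ p) (hq : 0 ≤ q) (hr : p + q ≤ r) :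
    (l : ℝ) * (p ^ k * q ^ (l - 1)) ≤ Lam1 k l * r ^ (k + l - 1) := by
  have h := lam1_out l k hl q p r hq hp (by linarith)
  have e : Lam1 k l = Lam1 l k := by unfold Lam1; rw [add_comm k l, mul_comm]
  rw [e, add_comm k l, mul_comm (p ^ k)]
  exact h

theorem lam2_oo (k l : ℕ) (hk : 2 ≤ k) (p q r : ℝ) (hp : 0 ≤ p) (hq : 0 ≤ q) (hr : p + q ≤ r) :
    (k : ℝ) * ((k : ℝ) - 1) * (p ^ (k - 2) * q ^ l) ≤ Lam2 k l * r ^ (k + l - 2) := by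
  have h := amgmJ (k - 2) l p q r hp hq hr
  have e : k - 2 + l = k + l - 2 := by omega
  have hr0 : 0 ≤ r := by linarith
  have hk' : (2 : ℝ) ≤ k := by exact_mod_cast hk
  have hk1 : (0 : ℝ) ≤ (k : ℝ) - 1 := by linarith
  calc (k : ℝ) * ((k : ℝ) - 1) * (p ^ (k - 2) * q ^ l)
      ≤ k * ((k : ℝ) - 1) * (J (k - 2) l * r ^ (k - 2 + l)) := by gcongr
    _ = (k * ((k : ℝ) - 1) * J (k - 2) l) * r ^ (k + l - 2) := by rw [e]; ring
    _ ≤ _ := by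
      gcongr
      unfold J Lam2
      rw [← Nat.cast_add, e, mul_div_assoc', ← mul_assoc]
      have := npred2 k hk
      have := npow_pos l
      have := npow_pos (k + l - 2)
      gcongr

theorem lam2_ii (k l : ℕ) (hl : 2 ≤ l) (p q r : ℝ) (hp : 0 ≤ p) (hq : 0 ≤ q) (hr : p + q ≤ r) :
    (l : ℝ) * ((l : ℝ) - 1) * (p ^ k * q ^ (l - 2)) ≤ Lam2 k l * r ^ (k + l - 2) := by
  have h := lam2_oo l k hl q p r hq hp (by linarith)
  have e : Lam2 k l = Lam2 l k := by unfold Lam2; rw [add_comm k l, mul_comm]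
  rw [e, add_comm k l, mul_comm (p ^ k)]
  exact h

theorem lam2_oi (k l : ℕ) (hk : 1 ≤ k) (hl : 1 ≤ l) (p q r : ℝ) (hp : 0 ≤ p) (hq : 0 ≤ q)
    (hr : p + q ≤ r) :
    (k : ℝ) * (l : ℝ) * (p ^ (k - 1) * q ^ (l - 1)) ≤ Lam2 k l * r ^ (k + l - 2) := by
  have h := amgmJ (k - 1) (l - 1) p q r hp hq hr
  have e : k - 1 + (l - 1) = k + l - 2 := by omega
  have hr0 : 0 ≤ r := by linarith
  calc (k : ℝ) * (l : ℝ) * (p ^ (k - 1) * q ^ (l - 1))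
      ≤ k * (l : ℝ) * (J (k - 1) (l - 1) * r ^ (k - 1 + (l - 1))) := by gcongr
    _ = (k * (l : ℝ) * J (k - 1) (l - 1)) * r ^ (k + l - 2) := by rw [e]; ring
    _ ≤ _ := by
      gcongr
      unfold J Lam2
      rw [← Nat.cast_add, e, mul_div_assoc']
      have h1 := npred k hk
      have h2 := npred l hl
      have := npow_pos k
      have h4 := npow_pos (k + l - 2)
      rw [div_le_div_iff_of_pos_right h4]
      calc _ = ((k : ℝ) * ((k - 1 : ℕ) : ℝ) ^ (k - 1)) * ((l : ℝ) * ((l - 1 : ℕ) : ℝ) ^ (l - 1)) := by ring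
        _ ≤ _ := by gcongr

end OS

namespace OS
section P2
open Classical

abbrev Lf (k l : ℕ) := Fin k ⊕ Fin l

variable {V : Type} [Fintype V]

def adj (A : V → V → Prop) (u v : V) : Prop := A u v ∨ A v u

def ty {k l : ℕ} (A : V → V → Prop) (c : V) : Lf k l → V → Prop
  | Sum.inl _, v => A c v
  | Sum.inr _, v => A v c

def Gd {k l : ℕ} (A : V → V → Prop) (c : V) (L : Lf k l → V) : Prop :=
  (∀ i, ty A c i (L i)) ∧ ∀ i j, ¬ A (L i) (L j)

noncomputable def Zp {k l : ℕ} (A : V → V → Prop) (c : V) (F : Lf k l → V → ℝ) : ℝ :=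
  ∑ L : Lf k l → V, if Gd A c L then ∏ j, F j (L j) else 0

noncomputable def ms (g : V → ℝ) (P : V → Prop) : ℝ := ∑ v, if P v then g v else 0

noncomputable def F1 {k l : ℕ} (g : V → ℝ) (i : Lf k l) (f : V → ℝ) : Lf k l → V → ℝ :=
  fun j => if j = i then f else g

noncomputable def F2 {k l : ℕ} (g : V → ℝ) (i : Lf k l) (f : V → ℝ) (i' : Lf k l) (h : V → ℝ) :
    Lf k l → V → ℝ :=
  fun j => if j = i then f else if j = i' then h else g

theorem ms_nonneg {g : V → ℝ} (hg : ∀ v, 0 ≤ g v) (P : V → Prop) : 0 ≤ ms g P := by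
  unfold ms
  apply Finset.sum_nonneg
  intro v _
  split_ifs
  · exact hg v
  · exact le_rfl

theorem ms_mono {g h : V → ℝ} (hh : ∀ v, 0 ≤ h v) (hgh : ∀ v, g v ≤ h v) {P Q : V → Prop}
    (hPQ : ∀ v, P v → Q v) : ms g P ≤ ms h Q := by
  unfold ms
  apply Finset.sum_le_sum
  intro v _
  by_cases hp : P v
  · simp [hp, hPQ v hp, hgh v]
  · simp only [hp, if_false]
    split_ifs
    · exact hh v
    · exact le_rfl

theorem ms_add (g h : V → ℝ) (P : V → Prop) : ms (fun v => g v + h v) P = ms g P + ms h P := by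
  unfold ms
  rw [← Finset.sum_add_distrib]
  apply Finset.sum_congr rfl
  intro v _
  split_ifs <;> simp

theorem ms_true (g : V → ℝ) : ms g (fun _ => True) = ∑ v, g v := by simp [ms]

theorem ms_le_sum {g : V → ℝ} (hg : ∀ v, 0 ≤ g v) (P : V → Prop) : ms g P ≤ ∑ v, g v := by
  rw [← ms_true]; exact ms_mono hg (fun _ => le_rfl) (fun _ _ => trivial)

theorem ms_split (g : V → ℝ) (P Q : V → Prop) :
    ms g P = ms g (fun v => P v ∧ Q v) + ms g (fun v => P v ∧ ¬ Q v) := by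
  unfold ms
  rw [← Finset.sum_add_distrib]
  apply Finset.sum_congr rfl
  intro v _
  by_cases h1 : P v <;> by_cases h2 : Q v <;> simp [h1, h2]

theorem ms_not (g : V → ℝ) (Q : V → Prop) : ∑ v, g v = ms g Q + ms g (fun v => ¬ Q v) := by
  have := ms_split g (fun _ => True) Q
  simpa [ms_true] using this

theorem ms_or (g : V → ℝ) (P Q : V → Prop) (h : ∀ v, P v → ¬ Q v) :
    ms g (fun v => P v ∨ Q v) = ms g P + ms g Q := by
  unfold ms
  rw [← Finset.sum_add_distrib]
  apply Finset.sum_congr rfl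
  intro v _
  by_cases h1 : P v
  · simp [h1, h v h1]
  · by_cases h2 : Q v <;> simp [h1, h2]

variable {k l : ℕ}

/-- generic majorisation lemma -/
theorem Zp_le_gen {P : Type*} [Fintype P] (A : V → V → Prop) (c : V) (F : Lf k l → V → ℝ)
    (G : P → Lf k l → V → ℝ) (hG : ∀ p j v, 0 ≤ G p j v) (hF : ∀ j v, 0 ≤ F j v)
    (h : ∀ L : Lf k l → V, Gd A c L → ∃ p, ∀ j, F j (L j) ≤ G p j (L j)) :
    Zp A c F ≤ ∑ p, ∏ j, ∑ v, G p j v := by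
  unfold Zp
  have e : ∀ p, ∏ j, ∑ v, G p j v = ∑ L : Lf k l → V, ∏ j, G p j (L j) := by
    intro p
    rw [Finset.prod_univ_sum]
    simp
  simp_rw [e]
  rw [Finset.sum_comm]
  apply Finset.sum_le_sum
  intro L _
  have hn : ∀ p, 0 ≤ ∏ j, G p j (L j) := fun p => Finset.prod_nonneg (fun j _ => hG p j _)
  split_ifs with hL
  · obtain ⟨p, hp⟩ := h L hL
    calc ∏ j, F j (L j) ≤ ∏ j, G p j (L j) := Finset.prod_le_prod (fun j _ => hF j _) (fun j _ => hp j)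
      _ ≤ _ := Finset.single_le_sum (f := fun p => ∏ j, G p j (L j)) (fun p _ => hn p) (Finset.mem_univ p)
  · exact Finset.sum_nonneg (fun p _ => hn p)

theorem Zp_nonneg (A : V → V → Prop) (c : V) (F : Lf k l → V → ℝ) (hF : ∀ j v, 0 ≤ F j v) :
    0 ≤ Zp A c F := by
  unfold Zp
  apply Finset.sum_nonneg
  intro L _
  split_ifs
  · exact Finset.prod_nonneg (fun j _ => hF j _)
  · exact le_rfl

theorem Zp_mono (A : V → V → Prop) (c : V) (F G : Lf k l → V → ℝ) (hF : ∀ j v, 0 ≤ F j v)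
    (h : ∀ j v, F j v ≤ G j v) : Zp A c F ≤ Zp A c G := by
  unfold Zp
  apply Finset.sum_le_sum
  intro L _
  split_ifs
  · exact Finset.prod_le_prod (fun j _ => hF j _) (fun j _ => h j _)
  · exact le_rfl

theorem Z0gen (A : V → V → Prop) (c : V) (F : Lf k l → V → ℝ) (hF : ∀ j v, 0 ≤ F j v) :
    Zp A c F ≤ ∏ j, ms (F j) (ty A c j) := by
  have h := Zp_le_gen (P := Unit) A c F (fun _ j v => if ty A c j v then F j v else 0)
    (by intro p j v; split_ifs; exacts [hF j v, le_rfl]) hF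
    (by intro L hL; refine ⟨(), fun j => ?_⟩; simp [hL.1 j])
  simpa [ms] using h

theorem Z1gen (A : V → V → Prop) (c : V) (F : Lf k l → V → ℝ) (hF : ∀ j v, 0 ≤ F j v)
    (i : Lf k l) :
    Zp A c F ≤ ∑ u, (if ty A c i u then F i u else 0) *
      ∏ j ∈ Finset.univ.erase i, ms (F j) (fun v => ty A c j v ∧ ¬ adj A u v) := by
  have h := Zp_le_gen (P := V) A c F
    (fun u j v => if j = i then (if v = u then (if ty A c i u then F i u else 0) else 0)
      else if (ty A c j v ∧ ¬ adj A u v) then F j v else 0)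
    (by intro p j v; split_ifs <;> first | exact hF _ _ | exact le_rfl) hF
    (by
      intro L hL
      refine ⟨L i, fun j => ?_⟩
      by_cases hj : j = i
      · subst hj; simp [hL.1 j]
      · have h1 : ¬ adj A (L i) (L j) := by
          rintro (h | h)
          · exact hL.2 _ _ h
          · exact hL.2 _ _ h
        simp [hj, hL.1 j, h1])
  refine h.trans (le_of_eq ?_)
  apply Finset.sum_congr rfl
  intro u _
  rw [← Finset.mul_prod_erase _ _ (Finset.mem_univ i)]
  congr 1
  · simp
  · apply Finset.prod_congr rfl
    intro j hj
    have : j ≠ i := (Finset.mem_erase.mp hj).1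
    simp only [this, if_false, ms]
    refine Finset.sum_congr rfl fun x _ => ?_
    congr

theorem Z2gen (A : V → V → Prop) (c : V) (F : Lf k l → V → ℝ) (hF : ∀ j v, 0 ≤ F j v)
    (i i' : Lf k l) (hi : i' ≠ i) :
    Zp A c F ≤ ∑ u, ∑ v, (if ty A c i u then F i u else 0) * (if ty A c i' v ∧ ¬ adj A u v then F i' v else 0) *
      ∏ j ∈ (Finset.univ.erase i).erase i',
        ms (F j) (fun z => ty A c j z ∧ ¬ adj A u z ∧ ¬ adj A v z) := by
  have h := Zp_le_gen (P := V × V) A c F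
    (fun u j v => if j = i then (if v = u.1 then (if ty A c i u.1 then F i u.1 else 0) else 0)
      else if j = i' then (if v = u.2 then (if ty A c i' u.2 ∧ ¬ adj A u.1 u.2 then F i' u.2 else 0) else 0)
      else if (ty A c j v ∧ ¬ adj A u.1 v ∧ ¬ adj A u.2 v) then F j v else 0)
    (by intro p j v; split_ifs <;> first | exact hF _ _ | exact le_rfl) hF
    (by
      intro L hL
      have h1 : ∀ a b, ¬ adj A (L a) (L b) := by
        rintro a b (h | h)
        · exact hL.2 _ _ h
        · exact hL.2 _ _ h
      refine ⟨(L i, L i'), fun j => ?_⟩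
      by_cases hj : j = i
      · subst hj; simp [hL.1 j]
      · by_cases hj' : j = i'
        · subst hj'; simp [hj, hL.1 j, h1]
        · simp [hj, hj', hL.1 j, h1])
  refine h.trans (le_of_eq ?_)
  rw [Fintype.sum_prod_type]
  apply Finset.sum_congr rfl
  intro u _
  apply Finset.sum_congr rfl
  intro v _
  rw [← Finset.mul_prod_erase _ _ (Finset.mem_univ i),
    ← Finset.mul_prod_erase _ _ (Finset.mem_erase.mpr ⟨hi, Finset.mem_univ i'⟩), ← mul_assoc]
  congr 1
  · simp [hi]
  · apply Finset.prod_congr rfl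
    intro j hj
    have h1 : j ≠ i' := (Finset.mem_erase.mp hj).1
    have h2 : j ≠ i := (Finset.mem_erase.mp (Finset.mem_erase.mp hj).2).1
    simp only [h1, h2, if_false, ms]
    refine Finset.sum_congr rfl fun x _ => ?_
    congr

/-- products of type-dependent values -/
theorem prod_ty (p q : ℝ) (f : Lf k l → ℝ) (h1 : ∀ a, f (Sum.inl a) = p) (h2 : ∀ a, f (Sum.inr a) = q) :
    ∏ j, f j = p ^ k * q ^ l := by
  rw [Fintype.prod_sum_type]
  simp [h1, h2]

theorem card_erase_inl (f : Lf k l → ℝ) (a : Fin k) (p q : ℝ)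
    (h1 : ∀ b, b ≠ a → f (Sum.inl b) = p) (h2 : ∀ b, f (Sum.inr b) = q) :
    ∏ j ∈ Finset.univ.erase (Sum.inl a), f j = p ^ (k - 1) * q ^ l := by
  have e : (Finset.univ.erase (Sum.inl a) : Finset (Lf k l)) =
      (Finset.univ.erase a).disjSum Finset.univ := by
    ext j; cases j <;> simp
  rw [e, Finset.prod_disjSum]
  congr 1
  · rw [Finset.prod_congr rfl (g := fun _ => p)]
    · simp
    · intro b hb; exact h1 b (Finset.mem_erase.mp hb).1
  · simp [h2]

theorem card_erase_inr (f : Lf k l → ℝ) (a : Fin l) (p q : ℝ)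
    (h1 : ∀ b, f (Sum.inl b) = p) (h2 : ∀ b, b ≠ a → f (Sum.inr b) = q) :
    ∏ j ∈ Finset.univ.erase (Sum.inr a), f j = p ^ k * q ^ (l - 1) := by
  have e : (Finset.univ.erase (Sum.inr a) : Finset (Lf k l)) =
      Finset.univ.disjSum (Finset.univ.erase a) := by
    ext j; cases j <;> simp
  rw [e, Finset.prod_disjSum]
  congr 1
  · simp [h1]
  · rw [Finset.prod_congr rfl (g := fun _ => q)]
    · simp
    · intro b hb; exact h2 b (Finset.mem_erase.mp hb).1

theorem erase_oo (f : Lf k l → ℝ) (a b : Fin k) (hab : b ≠ a) (p q : ℝ)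
    (h1 : ∀ d, d ≠ a → d ≠ b → f (Sum.inl d) = p) (h2 : ∀ d, f (Sum.inr d) = q) :
    ∏ j ∈ (Finset.univ.erase (Sum.inl a)).erase (Sum.inl b), f j = p ^ (k - 2) * q ^ l := by
  have e : ((Finset.univ.erase (Sum.inl a)).erase (Sum.inl b) : Finset (Lf k l)) =
      ((Finset.univ.erase a).erase b).disjSum Finset.univ := by
    ext j; cases j <;> simp
  rw [e, Finset.prod_disjSum]
  congr 1
  · rw [Finset.prod_congr rfl (g := fun _ => p)]
    · rw [Finset.prod_const, Finset.card_erase_of_mem (by simp [hab]), Finset.card_erase_of_mem (by simp)]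
      simp [Nat.sub_sub]
    · intro d hd
      simp only [Finset.mem_erase] at hd
      exact h1 d hd.2.1 hd.1
  · simp [h2]

theorem erase_ii (f : Lf k l → ℝ) (a b : Fin l) (hab : b ≠ a) (p q : ℝ)
    (h1 : ∀ d, f (Sum.inl d) = p) (h2 : ∀ d, d ≠ a → d ≠ b → f (Sum.inr d) = q) :
    ∏ j ∈ (Finset.univ.erase (Sum.inr a)).erase (Sum.inr b), f j = p ^ k * q ^ (l - 2) := by
  have e : ((Finset.univ.erase (Sum.inr a)).erase (Sum.inr b) : Finset (Lf k l)) =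
      Finset.univ.disjSum ((Finset.univ.erase a).erase b) := by
    ext j; cases j <;> simp
  rw [e, Finset.prod_disjSum]
  congr 1
  · simp [h1]
  · rw [Finset.prod_congr rfl (g := fun _ => q)]
    · rw [Finset.prod_const, Finset.card_erase_of_mem (by simp [hab]), Finset.card_erase_of_mem (by simp)]
      simp [Nat.sub_sub]
    · intro d hd
      simp only [Finset.mem_erase] at hd
      exact h2 d hd.2.1 hd.1

theorem erase_oi (f : Lf k l → ℝ) (a : Fin k) (b : Fin l) (p q : ℝ)
    (h1 : ∀ d, d ≠ a → f (Sum.inl d) = p) (h2 : ∀ d, d ≠ b → f (Sum.inr d) = q) :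
    ∏ j ∈ (Finset.univ.erase (Sum.inl a)).erase (Sum.inr b), f j = p ^ (k - 1) * q ^ (l - 1) := by
  have e : ((Finset.univ.erase (Sum.inl a)).erase (Sum.inr b) : Finset (Lf k l)) =
      (Finset.univ.erase a).disjSum (Finset.univ.erase b) := by
    ext j; cases j <;> simp
  rw [e, Finset.prod_disjSum]
  congr 1
  · rw [Finset.prod_congr rfl (g := fun _ => p)]
    · simp
    · intro d hd; exact h1 d (Finset.mem_erase.mp hd).1
  · rw [Finset.prod_congr rfl (g := fun _ => q)]
    · simp
    · intro d hd; exact h2 d (Finset.mem_erase.mp hd).1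

theorem Z0 (A : V → V → Prop) (c : V) (g : V → ℝ) (hg : ∀ v, 0 ≤ g v) :
    Zp A c (fun _ : Lf k l => g) ≤ ms g (fun v => A c v) ^ k * ms g (fun v => A v c) ^ l := by
  refine (Z0gen A c _ (fun _ => hg)).trans (le_of_eq ?_)
  exact prod_ty _ _ _ (fun a => rfl) (fun a => rfl)

theorem ms_adj (A : V → V → Prop) (hA : ∀ u v, A u v → ¬ A v u) (c : V) (g : V → ℝ) :
    ms g (adj A c) = ms g (fun v => A c v) + ms g (fun v => A v c) := by
  exact ms_or g (fun v => A c v) (fun v => A v c) (fun v h => hA _ _ h)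

theorem Z0J (A : V → V → Prop) (hA : ∀ u v, A u v → ¬ A v u) (c : V) (g : V → ℝ) (hg : ∀ v, 0 ≤ g v) :
    Zp A c (fun _ : Lf k l => g) ≤ J k l * ms g (adj A c) ^ (k + l) := by
  refine (Z0 A c g hg).trans ?_
  exact amgmJ k l _ _ _ (ms_nonneg hg _) (ms_nonneg hg _) (ms_adj A hA c g).ge

theorem ms_adj2 (A : V → V → Prop) (hA : ∀ u v, A u v → ¬ A v u) (c u : V) (g : V → ℝ) :
    ms g (fun v => A c v ∧ ¬ adj A u v) + ms g (fun v => A v c ∧ ¬ adj A u v)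
      = ms g (fun v => adj A c v ∧ ¬ adj A u v) := by
  rw [← ms_or]
  · congr 1; funext v; unfold adj; apply propext; tauto
  · intro v h h'; exact hA _ _ h.1 h'.1

theorem Z1out (A : V → V → Prop) (c : V) (g f : V → ℝ) (hg : ∀ v, 0 ≤ g v)
    (hf : ∀ v, 0 ≤ f v) (a : Fin k) :
    Zp A c (F1 g (Sum.inl a : Lf k l) f) ≤ ∑ u, (if A c u then f u else 0) *
      (ms g (fun v => A c v ∧ ¬ adj A u v) ^ (k - 1) * ms g (fun v => A v c ∧ ¬ adj A u v) ^ l) := by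
  refine (Z1gen A c _ ?_ (Sum.inl a)).trans (le_of_eq ?_)
  · intro j v; unfold F1; split_ifs; exacts [hf v, hg v]
  · apply Finset.sum_congr rfl
    intro u _
    congr 1
    · simp [F1, ty]
    · apply card_erase_inl
      · intro b hb; simp [F1, hb, ty]
      · intro b; simp [F1, ty]

theorem Z1in (A : V → V → Prop) (c : V) (g f : V → ℝ) (hg : ∀ v, 0 ≤ g v)
    (hf : ∀ v, 0 ≤ f v) (a : Fin l) :
    Zp A c (F1 g (Sum.inr a : Lf k l) f) ≤ ∑ u, (if A u c then f u else 0) *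
      (ms g (fun v => A c v ∧ ¬ adj A u v) ^ k * ms g (fun v => A v c ∧ ¬ adj A u v) ^ (l - 1)) := by
  refine (Z1gen A c _ ?_ (Sum.inr a)).trans (le_of_eq ?_)
  · intro j v; unfold F1; split_ifs; exacts [hf v, hg v]
  · apply Finset.sum_congr rfl
    intro u _
    congr 1
    · simp [F1, ty]
    · apply card_erase_inr
      · intro b; simp [F1, ty]
      · intro b hb; simp [F1, hb, ty]

theorem Z1sum (A : V → V → Prop) (hA : ∀ u v, A u v → ¬ A v u) (hk : 1 ≤ k) (hl : 1 ≤ l)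
    (c : V) (g f : V → ℝ) (hg : ∀ v, 0 ≤ g v) (hf : ∀ v, 0 ≤ f v) :
    ∑ i : Lf k l, Zp A c (F1 g i f) ≤ Lam1 k l * ∑ u, (if adj A c u then
      f u * ms g (fun v => adj A c v ∧ ¬ adj A u v) ^ (k + l - 1) else 0) := by
  rw [Fintype.sum_sum_type]
  have h1 := Finset.sum_le_sum (s := Finset.univ) (fun a (_ : a ∈ Finset.univ) => Z1out (k := k) (l := l) A c g f hg hf a)
  have h2 := Finset.sum_le_sum (s := Finset.univ) (fun a (_ : a ∈ Finset.univ) => Z1in (k := k) (l := l) A c g f hg hf a)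
  refine (add_le_add h1 h2).trans ?_
  rw [Finset.sum_const, Finset.sum_const, Finset.card_univ, Finset.card_univ, Fintype.card_fin,
    Fintype.card_fin, nsmul_eq_mul, nsmul_eq_mul, Finset.mul_sum, Finset.mul_sum, Finset.mul_sum,
    ← Finset.sum_add_distrib]
  apply Finset.sum_le_sum
  intro u _
  have e := ms_adj2 A hA c u g
  have hp := ms_nonneg hg (fun v => A c v ∧ ¬ adj A u v)
  have hq := ms_nonneg hg (fun v => A v c ∧ ¬ adj A u v)
  have i1 := lam1_out k l hk _ _ _ hp hq e.le
  have i2 := lam1_in k l hl _ _ _ hp hq e.le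
  have hfu := hf u
  by_cases c1 : A c u
  · have c2 := hA _ _ c1
    simp only [c1, c2, adj, if_true, if_false, true_or, zero_mul, mul_zero, add_zero]
    have := mul_le_mul_of_nonneg_left i1 hfu
    simp only [adj] at this
    linarith
  · by_cases c2 : A u c
    · simp only [c1, c2, adj, if_true, if_false, or_true, zero_mul, mul_zero, zero_add]
      have := mul_le_mul_of_nonneg_left i2 hfu
      simp only [adj] at this
      linarith
    · simp [c1, c2, adj]

end P2
end OS

namespace OS
section P2b
open Classical

variable {V : Type} [Fintype V] {k l : ℕ}

theorem F1_nonneg {g f : V → ℝ} (hg : ∀ v, 0 ≤ g v) (hf : ∀ v, 0 ≤ f v) (i j : Lf k l) (v : V) :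
    0 ≤ F1 g i f j v := by
  unfold F1; split_ifs; exacts [hf v, hg v]

theorem F2_nonneg {g f h : V → ℝ} (hg : ∀ v, 0 ≤ g v) (hf : ∀ v, 0 ≤ f v) (hh : ∀ v, 0 ≤ h v)
    (i i' j : Lf k l) (v : V) : 0 ≤ F2 g i f i' h j v := by
  unfold F2; split_ifs; exacts [hf v, hh v, hg v]

theorem Z2any (A : V → V → Prop) (c : V) (g f h : V → ℝ) (hg : ∀ v, 0 ≤ g v)
    (hf : ∀ v, 0 ≤ f v) (hh : ∀ v, 0 ≤ h v) (i i' : Lf k l) (hi : i' ≠ i) :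
    Zp A c (F2 g i f i' h) ≤ ∑ u, ∑ v, (if ty A c i u then f u else 0) *
      (if ty A c i' v ∧ ¬ adj A u v then h v else 0) *
      ∏ j ∈ (Finset.univ.erase i).erase i', ms g (fun z => ty A c j z ∧ ¬ adj A u z) := by
  refine (Z2gen A c _ (F2_nonneg hg hf hh i i') i i' hi).trans ?_
  apply Finset.sum_le_sum
  intro u _
  apply Finset.sum_le_sum
  intro v _
  have e1 : F2 g i f i' h i = f := by simp [F2]
  have e2 : F2 g i f i' h i' = h := by simp [F2, hi]
  rw [e1, e2]
  apply mul_le_mul_of_nonneg_left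
  · apply Finset.prod_le_prod
    · intro j _; exact ms_nonneg (F2_nonneg hg hf hh i i' j) _
    · intro j hj
      have h1 : j ≠ i' := (Finset.mem_erase.mp hj).1
      have h2 : j ≠ i := (Finset.mem_erase.mp (Finset.mem_erase.mp hj).2).1
      have e3 : F2 g i f i' h j = g := by simp [F2, h1, h2]
      rw [e3]
      apply ms_mono hg (fun _ => le_rfl)
      intro z hz
      exact ⟨hz.1, hz.2.1⟩
  · apply mul_nonneg
    · split_ifs; exacts [hf u, le_rfl]
    · split_ifs; exacts [hh v, le_rfl]

theorem sum_offdiag (n : ℕ) (X : ℝ) :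
    (∑ a : Fin n, ∑ b : Fin n, if b ≠ a then X else 0) = (n : ℝ) * ((n : ℝ) - 1) * X := by
  have : ∀ a : Fin n, (∑ b : Fin n, if b ≠ a then X else 0) = ((n : ℝ) - 1) * X := by
    intro a
    have h1 : ∀ b : Fin n, (if b ≠ a then X else 0) = X - if b = a then X else 0 := by
      intro b; by_cases h : b = a <;> simp [h]
    simp_rw [h1]
    rw [Finset.sum_sub_distrib]
    simp
    ring
  simp_rw [this]
  simp
  ring

theorem Z2sum (A : V → V → Prop) (hA : ∀ u v, A u v → ¬ A v u) (hk : 1 ≤ k) (hl : 1 ≤ l)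
    (c : V) (g f h : V → ℝ) (hg : ∀ v, 0 ≤ g v) (hf : ∀ v, 0 ≤ f v) (hh : ∀ v, 0 ≤ h v) :
    ∑ i : Lf k l, ∑ i' : Lf k l, (if i' ≠ i then Zp A c (F2 g i f i' h) else 0) ≤
      Lam2 k l * ∑ u, ∑ v, (if adj A c u ∧ adj A c v ∧ ¬ adj A u v then
      f u * h v * ms g (fun v => adj A c v ∧ ¬ adj A u v) ^ (k + l - 2) else 0) := by
  have h1 : ∀ i i' : Lf k l, (if i' ≠ i then Zp A c (F2 g i f i' h) else 0) ≤
      ∑ u, ∑ v, (if i' ≠ i then (if ty A c i u then f u else 0) *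
      (if ty A c i' v ∧ ¬ adj A u v then h v else 0) *
      ∏ j ∈ (Finset.univ.erase i).erase i', ms g (fun z => ty A c j z ∧ ¬ adj A u z) else 0) := by
    intro i i'
    by_cases hi : i' ≠ i
    · simp only [if_pos hi]
      exact Z2any A c g f h hg hf hh i i' hi
    · simp [hi]
  refine (Finset.sum_le_sum (fun i _ => Finset.sum_le_sum (fun i' _ => h1 i i'))).trans ?_
  have e : ∀ X : Lf k l → Lf k l → V → V → ℝ, ∑ i, ∑ i', ∑ u, ∑ v, X i i' u v =
      ∑ u, ∑ v, ∑ i, ∑ i', X i i' u v := by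
    intro X
    calc _ = ∑ i, ∑ u, ∑ i', ∑ v, X i i' u v := by
          apply Finset.sum_congr rfl; intro i _; rw [Finset.sum_comm]
      _ = ∑ u, ∑ i, ∑ i', ∑ v, X i i' u v := Finset.sum_comm
      _ = _ := by
          apply Finset.sum_congr rfl; intro u _
          rw [show (∑ v, ∑ i, ∑ i', X i i' u v) = ∑ i, ∑ v, ∑ i', X i i' u v from Finset.sum_comm]
          apply Finset.sum_congr rfl; intro i _; rw [Finset.sum_comm]
  rw [e, Finset.mul_sum]
  apply Finset.sum_le_sum
  intro u _
  rw [Finset.mul_sum]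
  apply Finset.sum_le_sum
  intro v _
  have e := ms_adj2 A hA c u g
  have hp := ms_nonneg hg (fun v => A c v ∧ ¬ adj A u v)
  have hq := ms_nonneg hg (fun v => A v c ∧ ¬ adj A u v)
  set p := ms g (fun v => A c v ∧ ¬ adj A u v) with hpd
  set q := ms g (fun v => A v c ∧ ¬ adj A u v) with hqd
  set r := ms g (fun v => adj A c v ∧ ¬ adj A u v) with hrd
  have hfu := hf u
  have hhv := hh v
  have hfh : 0 ≤ f u * h v := mul_nonneg hfu hhv
  have hr : 0 ≤ r := ms_nonneg hg _
  have hL := (Lam2_pos k l).le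
  by_cases huv : adj A u v
  · simp [huv]
  have roo : ∀ a b : Fin k, b ≠ a → ∏ j ∈ (Finset.univ.erase (Sum.inl a : Lf k l)).erase (Sum.inl b), ms g (fun z => ty A c j z ∧ ¬ adj A u z) = p ^ (k-2) * q ^ l :=
    fun a b hab => erase_oo _ a b hab p q (fun _ _ _ => rfl) (fun _ => rfl)
  have rii : ∀ a b : Fin l, b ≠ a → ∏ j ∈ (Finset.univ.erase (Sum.inr a : Lf k l)).erase (Sum.inr b), ms g (fun z => ty A c j z ∧ ¬ adj A u z) = p ^ k * q ^ (l-2) :=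
    fun a b hab => erase_ii _ a b hab p q (fun _ => rfl) (fun _ _ _ => rfl)
  have roi : ∀ (a : Fin k) (b : Fin l), ∏ j ∈ (Finset.univ.erase (Sum.inl a : Lf k l)).erase (Sum.inr b), ms g (fun z => ty A c j z ∧ ¬ adj A u z) = p ^ (k-1) * q ^ (l-1) :=
    fun a b => erase_oi _ a b p q (fun _ _ => rfl) (fun _ _ => rfl)
  have rio : ∀ (a : Fin k) (b : Fin l), ∏ j ∈ (Finset.univ.erase (Sum.inr b : Lf k l)).erase (Sum.inl a), ms g (fun z => ty A c j z ∧ ¬ adj A u z) = p ^ (k-1) * q ^ (l-1) := by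
    intro a b
    rw [Finset.erase_right_comm]
    exact roi a b
  simp only [Fintype.sum_sum_type]
  by_cases cu : A c u
  · have cu' := hA _ _ cu
    by_cases cv : A c v
    · have cv' := hA _ _ cv
      have key : ∀ a b : Fin k, (if (Sum.inl b : Lf k l) ≠ Sum.inl a then f u * h v * ∏ j ∈ (Finset.univ.erase (Sum.inl a : Lf k l)).erase (Sum.inl b), ms g (fun z => ty A c j z ∧ ¬ adj A u z) else 0) = if b ≠ a then f u * h v * (p ^ (k-2) * q ^ l) else 0 := by
        intro a b
        by_cases hab : b = a
        · simp [hab]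
        · simp [hab, roo a b hab]
      simp only [ty, cu, cv, cu', cv', huv, adj, if_true, if_false, not_false_eq_true, and_true, true_and, true_or, and_false, false_and, zero_mul, mul_zero, ite_self, Finset.sum_const_zero, add_zero] at key huv ⊢
      simp only [huv, if_true, if_false, not_false_eq_true, mul_zero, zero_mul, ite_self, Finset.sum_const_zero, add_zero]
      rw [Finset.sum_congr rfl (fun a _ => Finset.sum_congr rfl (fun b _ => key a b)), sum_offdiag]
      by_cases hk2 : 2 ≤ k
      · have := mul_le_mul_of_nonneg_left (lam2_oo k l hk2 p q r hp hq e.le) hfh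
        linarith
      · have : k = 1 := by omega
        subst this
        simp only [Nat.cast_one, sub_self, mul_zero, zero_mul]
        positivity
    · by_cases cv' : A v c
      · simp only [ty, cu, cv, cu', cv', adj, if_true, if_false, not_false_eq_true, and_true, true_and, true_or, or_true, and_false, false_and, zero_mul, mul_zero, ite_self, Finset.sum_const_zero, add_zero, zero_add] at huv ⊢
        simp only [huv, if_true, if_false, not_false_eq_true, mul_zero, zero_mul, ite_self, Finset.sum_const_zero, add_zero, zero_add]
        simp only [ty, adj] at roi
        simp only [roi, ne_eq, reduceCtorEq, not_false_eq_true, if_true, Finset.sum_const, Finset.card_univ, Fintype.card_fin, nsmul_eq_mul]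
        have := mul_le_mul_of_nonneg_left (lam2_oi k l hk hl p q r hp hq e.le) hfh
        linarith
      · simp [ty, cv, cv', adj]
  · by_cases cu' : A u c
    · by_cases cv : A c v
      · have cv' := hA _ _ cv
        simp only [ty, cu, cv, cu', cv', adj, if_true, if_false, not_false_eq_true, and_true, true_and, true_or, or_true, and_false, false_and, zero_mul, mul_zero, ite_self, Finset.sum_const_zero, add_zero, zero_add] at huv ⊢
        simp only [huv, if_true, if_false, not_false_eq_true, mul_zero, zero_mul, ite_self, Finset.sum_const_zero, add_zero, zero_add]
        simp only [ty, adj] at rio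
        simp only [rio, ne_eq, reduceCtorEq, not_false_eq_true, if_true, Finset.sum_const, Finset.card_univ, Fintype.card_fin, nsmul_eq_mul]
        have := mul_le_mul_of_nonneg_left (lam2_oi k l hk hl p q r hp hq e.le) hfh
        linarith
      · by_cases cv' : A v c
        · have key : ∀ a b : Fin l, (if (Sum.inr b : Lf k l) ≠ Sum.inr a then f u * h v * ∏ j ∈ (Finset.univ.erase (Sum.inr a : Lf k l)).erase (Sum.inr b), ms g (fun z => ty A c j z ∧ ¬ adj A u z) else 0) = if b ≠ a then f u * h v * (p ^ k * q ^ (l-2)) else 0 := by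
            intro a b
            by_cases hab : b = a
            · simp [hab]
            · simp [hab, rii a b hab]
          simp only [ty, cu, cv, cu', cv', huv, adj, if_true, if_false, not_false_eq_true, and_true, true_and, or_true, and_false, false_and, zero_mul, mul_zero, ite_self, Finset.sum_const_zero, add_zero, zero_add] at key huv ⊢
          simp only [huv, if_true, if_false, not_false_eq_true, mul_zero, zero_mul, ite_self, Finset.sum_const_zero, add_zero, zero_add]
          rw [Finset.sum_congr rfl (fun a _ => Finset.sum_congr rfl (fun b _ => key a b)), sum_offdiag]
          by_cases hk2 : 2 ≤ l
          · have := mul_le_mul_of_nonneg_left (lam2_ii k l hk2 p q r hp hq e.le) hfh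
            linarith
          · have : l = 1 := by omega
            subst this
            simp only [Nat.cast_one, sub_self, mul_zero, zero_mul]
            positivity
        · simp [ty, cv, cv', adj]
    · simp [ty, cu, cu', adj]

end P2b
end OS

namespace OS
section P2c
open Classical

variable {V : Type} [Fintype V] {k l : ℕ}

theorem PI1 {ι : Type*} [Fintype ι] [DecidableEq ι] (x y : ι → ℝ) (hx : ∀ i, 0 ≤ x i) (hy : ∀ i, 0 ≤ y i)
    (hd : ∀ i, x i = 0 ∨ y i = 0) :
    ∏ i, (x i + y i) ≤ ∏ i, y i + ∑ i, ∏ j, (if j = i then x j else x j + y j) := by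
  have hn : ∀ i, 0 ≤ ∏ j, (if j = i then x j else x j + y j) := by
    intro i; apply Finset.prod_nonneg; intro j _; split_ifs; exacts [hx j, add_nonneg (hx j) (hy j)]
  have hyn : 0 ≤ ∏ i, y i := Finset.prod_nonneg (fun i _ => hy i)
  by_cases h : ∀ i, x i = 0
  · have : ∏ i, (x i + y i) = ∏ i, y i := Finset.prod_congr rfl (fun i _ => by simp [h i])
    rw [this]
    linarith [Finset.sum_nonneg (fun i (_ : i ∈ Finset.univ) => hn i)]
  · push Not at h
    obtain ⟨i, hi⟩ := h
    have hyi : y i = 0 := (hd i).resolve_left hi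
    have e : ∏ j, (x j + y j) = ∏ j, (if j = i then x j else x j + y j) := by
      apply Finset.prod_congr rfl
      intro j _
      by_cases hj : j = i
      · subst hj; simp [hyi]
      · simp [hj]
    rw [e]
    linarith [Finset.single_le_sum (fun i (_ : i ∈ Finset.univ) => hn i) (Finset.mem_univ i)]

theorem PI2 {ι : Type*} [Fintype ι] [DecidableEq ι] (x y : ι → ℝ) (hx : ∀ i, 0 ≤ x i) (hy : ∀ i, 0 ≤ y i)
    (hd : ∀ i, x i = 0 ∨ y i = 0) :
    ∏ i, (x i + y i) ≤ ∏ i, x i + ∏ i, y i +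
      ∑ i, ∑ i', (if i' ≠ i then ∏ j, (if j = i then x j else if j = i' then y j else x j + y j) else 0) := by
  have hn : ∀ i i', 0 ≤ (if i' ≠ i then ∏ j, (if j = i then x j else if j = i' then y j else x j + y j) else 0) := by
    intro i i'
    split_ifs
    · apply Finset.prod_nonneg; intro j _; split_ifs
      exacts [hx j, hy j, add_nonneg (hx j) (hy j)]
    · exact le_rfl
  have hn2 := Finset.sum_nonneg (fun i (_ : i ∈ Finset.univ) => Finset.sum_nonneg (fun i' (_ : i' ∈ Finset.univ) => hn i i'))
  have hyn : 0 ≤ ∏ i, y i := Finset.prod_nonneg (fun i _ => hy i)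
  have hxn : 0 ≤ ∏ i, x i := Finset.prod_nonneg (fun i _ => hx i)
  by_cases h : ∀ i, x i = 0
  · have : ∏ i, (x i + y i) = ∏ i, y i := Finset.prod_congr rfl (fun i _ => by simp [h i])
    rw [this]
    linarith
  by_cases h' : ∀ i, y i = 0
  · have : ∏ i, (x i + y i) = ∏ i, x i := Finset.prod_congr rfl (fun i _ => by simp [h' i])
    rw [this]
    linarith
  push Not at h h'
  obtain ⟨i, hi⟩ := h
  obtain ⟨i', hi'⟩ := h'
  have hyi : y i = 0 := (hd i).resolve_left hi
  have hxi : x i' = 0 := (hd i').resolve_right hi'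
  have hne : i' ≠ i := by rintro rfl; exact hi hxi
  have e : ∏ j, (x j + y j) = (if i' ≠ i then ∏ j, (if j = i then x j else if j = i' then y j else x j + y j) else 0) := by
    rw [if_pos hne]
    apply Finset.prod_congr rfl
    intro j _
    by_cases hj : j = i
    · subst hj; simp [hyi]
    · by_cases hj' : j = i'
      · subst hj'; simp [hj, hxi]
      · simp [hj, hj']
  rw [e]
  have s1 := Finset.single_le_sum (fun i' (_ : i' ∈ Finset.univ) => hn i i') (Finset.mem_univ i')
  have s2 := Finset.single_le_sum (fun i (_ : i ∈ Finset.univ) => Finset.sum_nonneg (fun i' (_ : i' ∈ Finset.univ) => hn i i')) (Finset.mem_univ i)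
  linarith

theorem PI3 {ι : Type*} [DecidableEq ι] (s : Finset ι) (x y : ι → ℝ) (hx : ∀ i, 0 ≤ x i) (hy : ∀ i, 0 ≤ y i) :
    ∏ i ∈ s, x i + ∑ i ∈ s, ∏ j ∈ s, (if j = i then y j else x j) ≤ ∏ i ∈ s, (x i + y i) := by
  induction s using Finset.induction_on with
  | empty => simp
  | insert a s ha ih =>
    rw [Finset.prod_insert ha, Finset.prod_insert ha, Finset.sum_insert ha, Finset.prod_insert ha]
    have e1 : ∏ j ∈ s, (if j = a then y j else x j) = ∏ j ∈ s, x j := by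
      apply Finset.prod_congr rfl; intro j hj
      have : j ≠ a := by rintro rfl; exact ha hj
      simp [this]
    have e2 : ∑ i ∈ s, ∏ j ∈ insert a s, (if j = i then y j else x j) = x a * ∑ i ∈ s, ∏ j ∈ s, (if j = i then y j else x j) := by
      rw [Finset.mul_sum]
      apply Finset.sum_congr rfl; intro i hi
      have : a ≠ i := by rintro rfl; exact ha hi
      rw [Finset.prod_insert ha]; simp [this]
    rw [e1, e2]
    simp only [if_true]
    have hn : 0 ≤ ∑ i ∈ s, ∏ j ∈ s, (if j = i then y j else x j) := by
      apply Finset.sum_nonneg; intro i _; apply Finset.prod_nonneg; intro j _; split_ifs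
      exacts [hy j, hx j]
    have := mul_le_mul_of_nonneg_left ih (add_nonneg (hx a) (hy a))
    have := mul_nonneg (hy a) hn
    nlinarith

theorem split1 (A : V → V → Prop) (c : V) (x y : V → ℝ) (hx : ∀ v, 0 ≤ x v) (hy : ∀ v, 0 ≤ y v)
    (hd : ∀ v, x v = 0 ∨ y v = 0) :
    Zp A c (fun _ : Lf k l => fun v => x v + y v) ≤ Zp A c (fun _ : Lf k l => y) +
      ∑ i : Lf k l, Zp A c (F1 (fun v => x v + y v) i x) := by
  unfold Zp
  rw [Finset.sum_comm, ← Finset.sum_add_distrib]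
  apply Finset.sum_le_sum
  intro L _
  by_cases h : Gd A c L
  · simp only [h, if_true]
    refine (PI1 (fun i => x (L i)) (fun i => y (L i)) (fun _ => hx _) (fun _ => hy _) (fun _ => hd _)).trans (le_of_eq ?_)
    congr 1
    apply Finset.sum_congr rfl; intro i _; apply Finset.prod_congr rfl; intro j _
    unfold F1; split_ifs <;> rfl
  · simp [h]

theorem split2 (A : V → V → Prop) (c : V) (x y : V → ℝ) (hx : ∀ v, 0 ≤ x v) (hy : ∀ v, 0 ≤ y v)
    (hd : ∀ v, x v = 0 ∨ y v = 0) :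
    Zp A c (fun _ : Lf k l => fun v => x v + y v) ≤ Zp A c (fun _ : Lf k l => x) + Zp A c (fun _ : Lf k l => y) +
      ∑ i : Lf k l, ∑ i' : Lf k l, (if i' ≠ i then Zp A c (F2 (fun v => x v + y v) i x i' y) else 0) := by
  have e : ∑ i : Lf k l, ∑ i' : Lf k l, (if i' ≠ i then Zp A c (F2 (fun v => x v + y v) i x i' y) else 0)
    = ∑ L : Lf k l → V, if Gd A c L then ∑ i : Lf k l, ∑ i' : Lf k l, (if i' ≠ i then ∏ j, F2 (fun v => x v + y v) i x i' y j (L j) else 0) else 0 := by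
    have : ∀ i i' : Lf k l, (if i' ≠ i then Zp A c (F2 (fun v => x v + y v) i x i' y) else 0) =
      ∑ L : Lf k l → V, if Gd A c L then (if i' ≠ i then ∏ j, F2 (fun v => x v + y v) i x i' y j (L j) else 0) else 0 := by
      intro i i'
      unfold Zp
      split_ifs <;> simp
    simp_rw [this]
    rw [Finset.sum_congr rfl (fun i _ => Finset.sum_comm), Finset.sum_comm]
    apply Finset.sum_congr rfl; intro L _
    split_ifs <;> simp
  rw [e]
  unfold Zp
  rw [← Finset.sum_add_distrib, ← Finset.sum_add_distrib]
  apply Finset.sum_le_sum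
  intro L _
  by_cases h : Gd A c L
  · simp only [h, if_true]
    refine (PI2 (fun i => x (L i)) (fun i => y (L i)) (fun _ => hx _) (fun _ => hy _) (fun _ => hd _)).trans (le_of_eq ?_)
    congr 1
    apply Finset.sum_congr rfl; intro i _; apply Finset.sum_congr rfl; intro i' _
    congr 1
    apply Finset.prod_congr rfl; intro j _
    unfold F2; split_ifs <;> rfl
  · simp [h]

theorem split3 (A : V → V → Prop) (c : V) (x y f : V → ℝ) (hx : ∀ v, 0 ≤ x v) (hy : ∀ v, 0 ≤ y v)
    (hf : ∀ v, 0 ≤ f v) (hd : ∀ v, x v = 0 ∨ y v = 0) (i : Lf k l) :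
    Zp A c (F1 (fun v => x v + y v) i f) ≤ Zp A c (F1 y i f) +
      ∑ i' : Lf k l, (if i ≠ i' then Zp A c (F2 (fun v => x v + y v) i' x i f) else 0) := by
  have e : ∑ i' : Lf k l, (if i ≠ i' then Zp A c (F2 (fun v => x v + y v) i' x i f) else 0) =
      ∑ L : Lf k l → V, if Gd A c L then ∑ i' : Lf k l, (if i ≠ i' then ∏ j, F2 (fun v => x v + y v) i' x i f j (L j) else 0) else 0 := by
    have : ∀ i' : Lf k l, (if i ≠ i' then Zp A c (F2 (fun v => x v + y v) i' x i f) else 0) =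
      ∑ L : Lf k l → V, if Gd A c L then (if i ≠ i' then ∏ j, F2 (fun v => x v + y v) i' x i f j (L j) else 0) else 0 := by
      intro i'
      unfold Zp
      split_ifs <;> simp
    simp_rw [this]
    rw [Finset.sum_comm]
    apply Finset.sum_congr rfl; intro L _
    split_ifs <;> simp
  rw [e]
  unfold Zp
  rw [← Finset.sum_add_distrib]
  apply Finset.sum_le_sum
  intro L _
  by_cases h : Gd A c L
  · simp only [h, if_true]
    have hn : ∀ i' : Lf k l, 0 ≤ (if i ≠ i' then ∏ j, F2 (fun v => x v + y v) i' x i f j (L j) else 0) := by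
      intro i'
      split_ifs
      · apply Finset.prod_nonneg; intro j _
        exact F2_nonneg (fun v => add_nonneg (hx v) (hy v)) hx hf _ _ _ _
      · exact le_rfl
    have hn1 : 0 ≤ ∏ j, F1 y i f j (L j) := Finset.prod_nonneg (fun j _ => F1_nonneg hy hf _ _ _)
    by_cases hh : ∀ j, j ≠ i → x (L j) = 0
    · have : ∏ j, F1 (fun v => x v + y v) i f j (L j) = ∏ j, F1 y i f j (L j) := by
        apply Finset.prod_congr rfl; intro j _; unfold F1
        by_cases hj : j = i
        · simp [hj]
        · simp [hj, hh j hj]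
      rw [this]
      linarith [Finset.sum_nonneg (fun i' (_ : i' ∈ Finset.univ) => hn i')]
    · push Not at hh
      obtain ⟨i', hi', hxi⟩ := hh
      have hyi : y (L i') = 0 := (hd _).resolve_left hxi
      have : ∏ j, F1 (fun v => x v + y v) i f j (L j) = (if i ≠ i' then ∏ j, F2 (fun v => x v + y v) i' x i f j (L j) else 0) := by
        rw [if_pos hi'.symm]
        apply Finset.prod_congr rfl; intro j _; unfold F1 F2
        by_cases hj : j = i'
        · subst hj; simp [hi', hyi]
        · simp only [hj, if_false]
      rw [this]
      linarith [Finset.single_le_sum (fun i' (_ : i' ∈ Finset.univ) => hn i') (Finset.mem_univ i')]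
  · simp [h]

theorem split_lower (A : V → V → Prop) (c : V) (x y : V → ℝ) (hx : ∀ v, 0 ≤ x v) (hy : ∀ v, 0 ≤ y v) :
    Zp A c (fun _ : Lf k l => x) + ∑ i : Lf k l, Zp A c (F1 x i y)
      ≤ Zp A c (fun _ : Lf k l => fun v => x v + y v) := by
  unfold Zp
  rw [Finset.sum_comm, ← Finset.sum_add_distrib]
  apply Finset.sum_le_sum
  intro L _
  by_cases h : Gd A c L
  · simp only [h, if_true]
    refine (le_of_eq ?_).trans (PI3 Finset.univ (fun i => x (L i)) (fun i => y (L i)) (fun _ => hx _) (fun _ => hy _))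
    congr 1
    apply Finset.sum_congr rfl; intro i _; apply Finset.prod_congr rfl; intro j _
    unfold F1; split_ifs <;> rfl
  · simp [h]

theorem Zp_scale (A : V → V → Prop) (c : V) (t : ℝ) (g : V → ℝ) :
    Zp A c (fun _ : Lf k l => fun v => t * g v) = t ^ (k + l) * Zp A c (fun _ : Lf k l => g) := by
  unfold Zp
  rw [Finset.mul_sum]
  apply Finset.sum_congr rfl; intro L _
  split_ifs
  · rw [Finset.prod_mul_distrib]; simp
  · simp

theorem prod_F1 (g f : V → ℝ) (i : Lf k l) (L : Lf k l → V) :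
    ∏ j, F1 g i f j (L j) = f (L i) * ∏ j ∈ Finset.univ.erase i, g (L j) := by
  rw [← Finset.mul_prod_erase _ _ (Finset.mem_univ i)]
  congr 1
  · simp [F1]
  · apply Finset.prod_congr rfl; intro j hj
    have : j ≠ i := (Finset.mem_erase.mp hj).1
    simp [F1, this]

theorem Zp_scale1 (A : V → V → Prop) (c : V) (t s : ℝ) (g f : V → ℝ) (i : Lf k l) :
    Zp A c (F1 (fun v => t * g v) i (fun v => s * f v)) = s * t ^ (k + l - 1) * Zp A c (F1 g i f) := by
  unfold Zp
  rw [Finset.mul_sum]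
  apply Finset.sum_congr rfl; intro L _
  split_ifs
  · rw [prod_F1, prod_F1, Finset.prod_mul_distrib, Finset.prod_const, Finset.card_erase_of_mem (Finset.mem_univ i)]
    simp only [Finset.card_univ, Fintype.card_sum, Fintype.card_fin]
    ring
  · simp

noncomputable def sW (k l : ℕ) (A : V → V → Prop) (g : V → ℝ) : ℝ :=
  ∑ c, g c * Zp A c (fun _ : Lf k l => g)

noncomputable def lf (k l : ℕ) (A : V → V → Prop) (g : V → ℝ) (v : V) : ℝ :=
  ∑ c, g c * ∑ i : Lf k l, Zp A c (F1 g i (Pi.single v 1))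

theorem single_nonneg (v : V) : ∀ u, 0 ≤ (Pi.single v (1 : ℝ) : V → ℝ) u := by
  intro u
  by_cases h : u = v
  · subst h; simp
  · simp [Pi.single_apply, h]

theorem sum_lf (A : V → V → Prop) (g : V → ℝ) :
    ∑ v, g v * lf k l A g v = ((k : ℝ) + l) * sW k l A g := by
  have h1 : ∀ c (i : Lf k l), ∑ v, g v * Zp A c (F1 g i (Pi.single v 1)) = Zp A c (fun _ : Lf k l => g) := by
    intro c i
    unfold Zp
    simp_rw [Finset.mul_sum]
    rw [Finset.sum_comm]
    apply Finset.sum_congr rfl; intro L _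
    by_cases h : Gd A c L
    · simp only [h, if_true]
      simp_rw [prod_F1]
      rw [← Finset.mul_prod_erase (Finset.univ) (fun j => g (L j)) (Finset.mem_univ i)]
      simp_rw [← mul_assoc]
      rw [← Finset.sum_mul]
      congr 1
      simp [Pi.single_apply]
    · simp [h]
  unfold lf sW
  simp_rw [Finset.mul_sum]
  rw [Finset.sum_comm]
  apply Finset.sum_congr rfl; intro c _
  rw [Finset.sum_comm]
  calc _ = ∑ i : Lf k l, g c * ∑ v, g v * Zp A c (F1 g i (Pi.single v 1)) := by
        apply Finset.sum_congr rfl; intro i _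
        rw [Finset.mul_sum]; apply Finset.sum_congr rfl; intro v _; ring
    _ = _ := by
        simp_rw [h1]
        simp

structure Opt (k l : ℕ) (A : V → V → Prop) (w : V → ℝ) (M : ℝ) : Prop where
  ori : ∀ u v, A u v → ¬ A v u
  nn : ∀ v, 0 ≤ w v
  sum1 : ∑ v, w v = 1
  hM : M = sW k l A w
  lag : ∀ v, Zp A v (fun _ : Lf k l => w) + lf k l A w v ≤ ((k : ℝ) + l + 1) * M
  lag_eq : ∀ v, w v ≠ 0 → ((k : ℝ) + l + 1) * M ≤ Zp A v (fun _ : Lf k l => w) + lf k l A w v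
  hom : ∀ g : V → ℝ, (∀ v, 0 ≤ g v) → sW k l A g ≤ M * (∑ v, g v) ^ (k + l + 1)

theorem sW_scale (A : V → V → Prop) (t : ℝ) (g : V → ℝ) :
    sW k l A (fun v => t * g v) = t ^ (k + l + 1) * sW k l A g := by
  unfold sW
  rw [Finset.mul_sum]
  apply Finset.sum_congr rfl; intro c _
  rw [Zp_scale]; ring

theorem sW_nonneg (A : V → V → Prop) (g : V → ℝ) (hg : ∀ v, 0 ≤ g v) : 0 ≤ sW k l A g :=
  Finset.sum_nonneg (fun c _ => mul_nonneg (hg c) (Zp_nonneg _ _ _ (fun _ => hg)))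

theorem exists_opt (k l : ℕ) (hkl : 1 ≤ k + l) (A : V → V → Prop) (hA : ∀ u v, A u v → ¬ A v u) [Nonempty V] :
    ∃ w M, Opt k l A w M := by
  have hc : Continuous (fun g : V → ℝ => sW k l A g) := by
    unfold sW Zp
    apply continuous_finset_sum; intro c _
    apply Continuous.mul (continuous_apply c)
    apply continuous_finset_sum; intro L _
    split_ifs
    · apply continuous_finset_prod; intro j _; exact continuous_apply _
    · exact continuous_const
  have hne : (stdSimplex ℝ V).Nonempty := ⟨_, single_mem_stdSimplex ℝ (Classical.arbitrary V)⟩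
  obtain ⟨w, hw, hmax⟩ := (isCompact_stdSimplex ℝ V).exists_isMaxOn hne hc.continuousOn
  have hmax' : ∀ g ∈ stdSimplex ℝ V, sW k l A g ≤ sW k l A w := fun g hg => hmax hg
  have nn := hw.1
  have sum1 := hw.2
  set M := sW k l A w with hM
  have hM0 : 0 ≤ M := sW_nonneg A w nn
  have lag : ∀ v, Zp A v (fun _ : Lf k l => w) + lf k l A w v ≤ ((k : ℝ) + l + 1) * M := by
    intro v
    set Q := Zp A v (fun _ : Lf k l => w) + lf k l A w v with hQ
    have hQ0 : 0 ≤ Q := by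
      apply add_nonneg (Zp_nonneg _ _ _ (fun _ => nn))
      unfold lf
      apply Finset.sum_nonneg; intro c _; apply mul_nonneg (nn c)
      apply Finset.sum_nonneg; intro i _; apply Zp_nonneg
      intro j u; exact F1_nonneg nn (single_nonneg v) _ _ _
    have key : ∀ t : ℝ, 0 < t → t < 1 → (1 - t) ^ (k + l) * Q ≤ ((k : ℝ) + l + 1) * M := by
      intro t ht0 ht1
      have h1t : 0 < 1 - t := by linarith
      have hmem : (fun u => (1 - t) * w u + t * (Pi.single v (1 : ℝ) : V → ℝ) u) ∈ stdSimplex ℝ V := by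
        constructor
        · intro u
          have := nn u
          have := single_nonneg v u
          positivity
        · rw [Finset.sum_add_distrib, ← Finset.mul_sum, ← Finset.mul_sum, sum1]
          simp
      have h1 := hmax' _ hmem
      have h2 : (1 - t) ^ (k + l + 1) * M + t * (1 - t) ^ (k + l) * Q ≤ sW k l A (fun u => (1 - t) * w u + t * (Pi.single v (1 : ℝ) : V → ℝ) u) := by
        have h3 : ∀ c, (1 - t) ^ (k + l) * Zp A c (fun _ : Lf k l => w) + t * (1 - t) ^ (k + l - 1) * ∑ i : Lf k l, Zp A c (F1 w i (Pi.single v 1)) ≤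
          Zp A c (fun _ : Lf k l => fun u => (1 - t) * w u + t * (Pi.single v (1 : ℝ) : V → ℝ) u) := by
          intro c
          have := split_lower (k := k) (l := l) A c (fun u => (1 - t) * w u) (fun u => t * (Pi.single v (1 : ℝ) : V → ℝ) u)
            (fun u => mul_nonneg h1t.le (nn u)) (fun u => mul_nonneg ht0.le (single_nonneg v u))
          rw [Zp_scale] at this
          simp_rw [Zp_scale1] at this
          rw [← Finset.mul_sum] at this
          exact this
        have h4 : ∀ c, 0 ≤ ∑ i : Lf k l, Zp A c (F1 w i (Pi.single v 1)) := by
          intro c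
          apply Finset.sum_nonneg; intro i _; apply Zp_nonneg
          intro j u; exact F1_nonneg nn (single_nonneg v) _ _ _
        have e : (1 - t) ^ (k + l + 1) * M + t * (1 - t) ^ (k + l) * Q
          = ∑ c, ((1 - t) * w c * ((1 - t) ^ (k + l) * Zp A c (fun _ : Lf k l => w) + t * (1 - t) ^ (k + l - 1) * ∑ i : Lf k l, Zp A c (F1 w i (Pi.single v 1))) + t * (Pi.single v (1 : ℝ) : V → ℝ) c * ((1 - t) ^ (k + l) * Zp A c (fun _ : Lf k l => w))) := by
          rw [Finset.sum_add_distrib]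
          have e2 : ∑ c, t * (Pi.single v (1 : ℝ) : V → ℝ) c * ((1 - t) ^ (k + l) * Zp A c (fun _ : Lf k l => w)) = t * (1 - t) ^ (k + l) * Zp A v (fun _ : Lf k l => w) := by
            rw [Finset.sum_eq_single v]
            · simp; ring
            · intro b _ hb; simp [Pi.single_apply, hb]
            · simp
          rw [e2, hQ, hM]
          have e3 : (1 - t) ^ (k + l) = (1 - t) ^ (k + l - 1) * (1 - t) := by
            rw [← pow_succ]; congr 1; omega
          unfold sW lf
          rw [mul_add, Finset.mul_sum, Finset.mul_sum]
          have e4 : ∑ c, (1 - t) * w c * ((1 - t) ^ (k + l) * Zp A c (fun _ : Lf k l => w) + t * (1 - t) ^ (k + l - 1) * ∑ i : Lf k l, Zp A c (F1 w i (Pi.single v 1)))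
            = ∑ c, (1 - t) ^ (k + l + 1) * (w c * Zp A c (fun _ : Lf k l => w)) + ∑ c, t * (1 - t) ^ (k + l) * (w c * ∑ i : Lf k l, Zp A c (F1 w i (Pi.single v 1))) := by
            rw [← Finset.sum_add_distrib]
            apply Finset.sum_congr rfl; intro c _
            rw [pow_succ, e3]; ring
          rw [e4]; ring
        rw [e]
        unfold sW
        apply Finset.sum_le_sum
        intro c _
        rw [add_mul]
        apply add_le_add
        · exact mul_le_mul_of_nonneg_left (h3 c) (mul_nonneg h1t.le (nn c))
        · apply mul_le_mul_of_nonneg_left _ (mul_nonneg ht0.le (single_nonneg v c))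
          refine le_trans ?_ (h3 c)
          have := h4 c
          have : 0 ≤ t * (1 - t) ^ (k + l - 1) * ∑ i : Lf k l, Zp A c (F1 w i (Pi.single v 1)) := by positivity
          linarith
      have hB : 1 - ((k : ℝ) + l + 1) * t ≤ (1 - t) ^ (k + l + 1) := by
        have := one_add_mul_le_pow (a := -t) (by linarith) (k + l + 1)
        push_cast at this
        have e : 1 + -t = 1 - t := by ring
        rw [e] at this
        linarith
      have h5 : t * ((1 - t) ^ (k + l) * Q) ≤ t * (((k : ℝ) + l + 1) * M) := by
        nlinarith [mul_le_mul_of_nonneg_right hB hM0]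
      exact le_of_mul_le_mul_left h5 ht0
    have hten : Filter.Tendsto (fun t : ℝ => (1 - t) ^ (k + l) * Q) (nhdsWithin 0 (Set.Ioi 0)) (nhds Q) := by
      have : Continuous (fun t : ℝ => (1 - t) ^ (k + l) * Q) := by fun_prop
      have h := this.tendsto 0
      simp only [sub_zero, one_pow, one_mul] at h
      exact h.mono_left nhdsWithin_le_nhds
    refine le_of_tendsto hten ?_
    filter_upwards [Ioo_mem_nhdsGT (show (0:ℝ) < 1 by norm_num)] with t ht
    exact key t ht.1 ht.2
  have hsum : ∑ v, w v * (Zp A v (fun _ : Lf k l => w) + lf k l A w v) = ((k : ℝ) + l + 1) * M := by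
    simp_rw [mul_add]
    rw [Finset.sum_add_distrib, sum_lf, hM]
    unfold sW
    ring
  refine ⟨w, M, hA, nn, sum1, hM, lag, ?_, ?_⟩
  · intro v hv
    by_contra hlt
    push Not at hlt
    have hwv : 0 < w v := lt_of_le_of_ne (nn v) (Ne.symm hv)
    have : ∑ v, w v * (Zp A v (fun _ : Lf k l => w) + lf k l A w v) < ∑ v, w v * (((k : ℝ) + l + 1) * M) := by
      apply Finset.sum_lt_sum
      · intro u _; exact mul_le_mul_of_nonneg_left (lag u) (nn u)
      · exact ⟨v, Finset.mem_univ v, mul_lt_mul_of_pos_left hlt hwv⟩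
    rw [hsum, ← Finset.sum_mul, sum1] at this
    linarith
  · intro g hg
    have hG : 0 ≤ ∑ v, g v := Finset.sum_nonneg (fun v _ => hg v)
    rcases hG.eq_or_lt with h0 | h0
    · have : ∀ v, g v = 0 := by
        intro v
        exact (Finset.sum_eq_zero_iff_of_nonneg (fun v _ => hg v)).mp h0.symm v (Finset.mem_univ v)
      unfold sW
      simp [this]
    · have hmem : (fun v => (∑ v, g v)⁻¹ * g v) ∈ stdSimplex ℝ V := by
        constructor
        · intro v; have := hg v; positivity
        · rw [← Finset.mul_sum]; field_simp
      have := hmax' _ hmem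
      rw [sW_scale, inv_pow, inv_mul_le_iff₀ (by positivity)] at this
      linarith

end P2c
end OS

namespace OS
section P3

noncomputable def th (n : ℕ) : ℝ := ((n : ℝ) / (n + 1)) ^ n

theorem th_ge (n : ℕ) (hn : 1 ≤ n) : 0.3678 ≤ th n := by
  unfold th
  have hn' : (0 : ℝ) < n := by exact_mod_cast hn
  have h1 : (1 + 1 / (n : ℝ)) ^ n ≤ Real.exp 1 := by
    have := Real.add_one_le_exp (1 / (n : ℝ))
    calc (1 + 1 / (n : ℝ)) ^ n ≤ (Real.exp (1 / (n : ℝ))) ^ n := by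
          apply pow_le_pow_left₀ (by positivity); linarith
      _ = Real.exp 1 := by rw [← Real.exp_nat_mul]; congr 1; field_simp
  have h2 := Real.exp_one_lt_d9
  have h3 : ((n : ℝ) / (n + 1)) ^ n * (1 + 1 / (n : ℝ)) ^ n = 1 := by
    rw [← mul_pow]
    have : (n : ℝ) / (n + 1) * (1 + 1 / (n : ℝ)) = 1 := by field_simp
    rw [this, one_pow]
  have h4 : 0 < ((n : ℝ) / (n + 1)) ^ n := by positivity
  nlinarith

theorem th_pos (n : ℕ) (hn : 1 ≤ n) : 0 < th n := by linarith [th_ge n hn]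

theorem th_gap (n : ℕ) (hn : 1 ≤ n) : (1 - 1 / (n : ℝ)) ^ n ≤ th n - th n / (n + 1) := by
  have hn' : (1 : ℝ) ≤ n := by exact_mod_cast hn
  have h := amgm n 1 ((n : ℝ) - 1) 1 (by linarith) (by norm_num)
  simp only [pow_one, mul_one, Nat.cast_one, sub_add_cancel] at h
  have e : th n - th n / (n + 1) = (n : ℝ) ^ (n + 1) / (n + 1) ^ (n + 1) := by
    unfold th
    rw [div_pow]
    field_simp
    ring
  rw [e, le_div_iff₀ (by positivity)]
  have e2 : (1 - 1 / (n : ℝ)) ^ n = ((n : ℝ) - 1) ^ n / (n : ℝ) ^ n := by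
    rw [← div_pow]; congr 1; field_simp
  rw [e2, div_mul_eq_mul_div, div_le_iff₀ (by positivity)]
  linarith

theorem Lam1_le (k l : ℕ) (h : 2 ≤ k + l) : Lam1 k l ≤ 2.72 * ((k : ℝ) + l) * J k l := by
  obtain ⟨n, hn⟩ : ∃ n, k + l = n + 1 := ⟨k + l - 1, by omega⟩
  have hn0 : (0 : ℝ) < n := by exact_mod_cast (by omega : 0 < n)
  have hc : (k : ℝ) + l = n + 1 := by exact_mod_cast hn
  unfold Lam1 J
  rw [hc, hn, Nat.add_sub_cancel]
  have h1 : (1 + 1 / (n : ℝ)) ^ n ≤ 2.72 := by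
    have := Real.add_one_le_exp (1 / (n : ℝ))
    have h2 := Real.exp_one_lt_d9
    calc (1 + 1 / (n : ℝ)) ^ n ≤ (Real.exp (1 / (n : ℝ))) ^ n := by
          apply pow_le_pow_left₀ (by positivity); linarith
      _ = Real.exp 1 := by rw [← Real.exp_nat_mul]; congr 1; field_simp
      _ ≤ 2.72 := by linarith
  have hP := mul_pos (npow_pos k) (npow_pos l)
  set P := (k : ℝ) ^ k * (l : ℝ) ^ l
  have e : (1 + 1 / (n : ℝ)) = (n + 1) / n := by field_simp
  rw [e, div_pow, div_le_iff₀ (by positivity)] at h1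
  rw [mul_div_assoc', div_le_div_iff₀ (by positivity) (by positivity), pow_succ]
  have := mul_le_mul_of_nonneg_left h1 (by positivity : 0 ≤ P * ((n : ℝ) + 1))
  linarith

theorem Lam2_le (k l : ℕ) (h : 3 ≤ k + l) : Lam2 k l ≤ 7.4 * ((k : ℝ) + l) ^ 2 * J k l := by
  obtain ⟨n, hn⟩ : ∃ n, k + l = n + 2 := ⟨k + l - 2, by omega⟩
  have hn0 : (0 : ℝ) < n := by exact_mod_cast (by omega : 0 < n)
  have hc : (k : ℝ) + l = n + 2 := by exact_mod_cast hn
  unfold Lam2 J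
  rw [hc, hn, Nat.add_sub_cancel]
  have h1 : (1 + 2 / (n : ℝ)) ^ n ≤ 7.4 := by
    have := Real.add_one_le_exp (2 / (n : ℝ))
    have h2 := Real.exp_one_lt_d9
    have h3 := Real.exp_pos 1
    calc (1 + 2 / (n : ℝ)) ^ n ≤ (Real.exp (2 / (n : ℝ))) ^ n := by
          apply pow_le_pow_left₀ (by positivity); linarith
      _ = Real.exp 1 ^ 2 := by rw [← Real.exp_nat_mul, ← Real.exp_nat_mul]; congr 1; push_cast; field_simp
      _ ≤ 7.4 := by nlinarith
  have hP := mul_pos (npow_pos k) (npow_pos l)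
  set P := (k : ℝ) ^ k * (l : ℝ) ^ l
  have e : (1 + 2 / (n : ℝ)) = (n + 2) / n := by field_simp
  rw [e, div_pow, div_le_iff₀ (by positivity)] at h1
  rw [mul_div_assoc', div_le_div_iff₀ (by positivity) (by positivity), pow_add]
  have := mul_le_mul_of_nonneg_left h1 (by positivity : 0 ≤ P * ((n : ℝ) + 2) ^ 2)
  linarith

theorem Lam1_J (k l : ℕ) (h : 1 ≤ k + l) (a r : ℝ) (ha : 0 ≤ a) (hr : 0 ≤ r) :
    Lam1 k l * (a * r ^ (k + l - 1)) ≤ J k l * (a + r) ^ (k + l) := by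
  obtain ⟨n, hn⟩ : ∃ n, k + l = n + 1 := ⟨k + l - 1, by omega⟩
  have hc : (k : ℝ) + l = n + 1 := by exact_mod_cast hn
  unfold Lam1 J
  rw [hc, hn, Nat.add_sub_cancel]
  have hP := mul_pos (npow_pos k) (npow_pos l)
  set P := (k : ℝ) ^ k * (l : ℝ) ^ l
  have := amgm n 1 r a hr ha
  simp only [pow_one, Nat.cast_one, mul_one] at this
  have hn1 := npow_pos n
  rw [div_mul_eq_mul_div, div_mul_eq_mul_div, div_le_div_iff₀ hn1 (by positivity)]
  have := mul_le_mul_of_nonneg_left this hP.le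
  rw [add_comm r a] at this
  linarith

theorem pow2 (n : ℕ) (hn : 6 ≤ n) : (64 : ℝ) ≤ 2 ^ n ∧ 64 * (n : ℝ) ≤ 6 * 2 ^ n := by
  induction n, hn using Nat.le_induction with
  | base => norm_num
  | succ n hn ih =>
    obtain ⟨h1, h2⟩ := ih
    have : (6 : ℝ) ≤ n := by exact_mod_cast hn
    rw [pow_succ]
    push_cast
    constructor <;> linarith

theorem pow3 (n : ℕ) (hn : 6 ≤ n) : (729 : ℝ) ≤ 3 ^ n ∧ 729 * (n : ℝ) ≤ 6 * 3 ^ n := by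
  induction n, hn using Nat.le_induction with
  | base => norm_num
  | succ n hn ih =>
    obtain ⟨h1, h2⟩ := ih
    have : (6 : ℝ) ≤ n := by exact_mod_cast hn
    rw [pow_succ]
    push_cast
    constructor <;> linarith

theorem inv_pow_le (n j i : ℕ) (hn : 6 ≤ n) (hj : i + j ≤ n) : (1 / (n : ℝ)) ^ (n - j) ≤ (1 / (n : ℝ)) ^ i := by
  have : (6 : ℝ) ≤ n := by exact_mod_cast hn
  apply pow_le_pow_of_le_one (by positivity)
  · rw [div_le_one (by linarith)]; linarith
  · omega

theorem chord (p q z : ℝ) (hpq : p < q) (h1 : p ≤ z) (h2 : z ≤ q) :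
    ∃ t, 0 ≤ t ∧ t ≤ 1 ∧ z = (1 - t) * p + t * q := by
  refine ⟨(z - p) / (q - p), ?_, ?_, ?_⟩
  · apply div_nonneg <;> linarith
  · rw [div_le_one (by linarith)]; linarith
  · have : q - p ≠ 0 := by linarith
    field_simp
    ring

theorem pow_chord (n : ℕ) (p q t : ℝ) (hp : 0 ≤ p) (hq : 0 ≤ q) (h0 : 0 ≤ t) (h1 : t ≤ 1) :
    ((1 - t) * p + t * q) ^ n ≤ (1 - t) * p ^ n + t * q ^ n := by
  have := (convexOn_pow (𝕜 := ℝ) n).2 (show p ∈ Set.Ici 0 from hp) (show q ∈ Set.Ici 0 from hq)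
    (show 0 ≤ 1 - t by linarith) h0 (by ring)
  simpa using this

theorem mix_lt (t a b c : ℝ) (h0 : 0 ≤ t) (h1 : t ≤ 1) (ha : a < c) (hb : b < c) :
    (1 - t) * a + t * b < c := by
  rcases h0.eq_or_lt with h | h
  · subst h; linarith
  · nlinarith

theorem NB (n : ℕ) (hn : 6 ≤ n) (z : ℝ) (hz1 : 1 / (n : ℝ) ≤ z) (hz2 : z ≤ 1 / 2) :
    (1 - z) ^ n + 2.72 * n * ((1 - z) * z ^ (n - 1)) < th n := by
  have hn' : (6 : ℝ) ≤ n := by exact_mod_cast hn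
  have hz0 : 0 ≤ z := le_trans (by positivity) hz1
  obtain ⟨h64, h64n⟩ := pow2 n hn
  have hth := th_ge n (by omega)
  have hgap := th_gap n (by omega)
  have s1 : (1 - z) * z ^ (n - 1) ≤ 1 / 4 * z ^ (n - 2) := by
    have e : z ^ (n - 1) = z * z ^ (n - 2) := by rw [← pow_succ']; congr 1; omega
    rw [e, ← mul_assoc]
    apply mul_le_mul_of_nonneg_right _ (by positivity)
    nlinarith [sq_nonneg (z - 1 / 2)]
  obtain ⟨t, t0, t1, ht⟩ := chord (1 / (n : ℝ)) (1 / 2) z (by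
    apply one_div_lt_one_div_of_lt <;> linarith) hz1 hz2
  have c1 : (1 - z) ^ n ≤ (1 - t) * (1 - 1 / (n : ℝ)) ^ n + t * (1 / 2) ^ n := by
    have := pow_chord n (1 - 1 / (n : ℝ)) (1 / 2) t (by
      rw [sub_nonneg, div_le_one (by linarith)]; linarith) (by norm_num) t0 t1
    convert this using 2
    rw [ht]; ring
  have c2 : z ^ (n - 2) ≤ (1 - t) * (1 / (n : ℝ)) ^ (n - 2) + t * (1 / 2) ^ (n - 2) := by
    have := pow_chord (n - 2) (1 / (n : ℝ)) (1 / 2) t (by positivity) (by norm_num) t0 t1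
    rwa [← ht] at this
  have i1 : (1 / (n : ℝ)) ^ (n - 2) ≤ (1 / (n : ℝ)) ^ 4 := inv_pow_le n 2 4 hn (by omega)
  have E1 : (1 - 1 / (n : ℝ)) ^ n + 0.68 * n * (1 / (n : ℝ)) ^ (n - 2) < th n := by
    have : 0.68 * n * (1 / (n : ℝ)) ^ (n - 2) ≤ 0.68 * n * (1 / (n : ℝ)) ^ 4 := by gcongr
    have h2 : 0.68 * n * (1 / (n : ℝ)) ^ 4 < 0.3678 / (n + 1) := by
      have : 0.68 * n * (1 / (n : ℝ)) ^ 4 = 0.68 / n ^ 3 := by field_simp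
      rw [this, div_lt_div_iff₀ (by positivity) (by positivity)]
      nlinarith [mul_nonneg (by linarith : (0:ℝ) ≤ n - 6) (by positivity : (0:ℝ) ≤ (n:ℝ)^2), mul_nonneg (by linarith : (0:ℝ) ≤ n - 6) (by positivity : (0:ℝ) ≤ (n:ℝ))]
    have h3 : 0.3678 / ((n : ℝ) + 1) ≤ th n / (n + 1) := by gcongr
    linarith
  have E2 : (1 / 2 : ℝ) ^ n + 0.68 * n * (1 / 2) ^ (n - 2) < th n := by
    have e : (1 / 2 : ℝ) ^ (n - 2) = 4 * (1 / 2) ^ n := by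
      have : n = (n - 2) + 2 := by omega
      conv_rhs => rw [this, pow_add]
      ring
    rw [e, one_div, inv_pow]
    have : ((2 : ℝ) ^ n)⁻¹ + 0.68 * n * (4 * ((2 : ℝ) ^ n)⁻¹) = (1 + 2.72 * n) / 2 ^ n := by
      field_simp; ring
    rw [this]
    refine lt_of_lt_of_le ?_ hth
    rw [div_lt_iff₀ (by positivity)]
    linarith
  have := mix_lt t _ _ _ t0 t1 E1 E2
  have hh : 2.72 * (n : ℝ) * ((1 - z) * z ^ (n - 1)) ≤ 0.68 * n * ((1 - t) * (1 / (n : ℝ)) ^ (n - 2) + t * (1 / 2) ^ (n - 2)) := by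
    calc 2.72 * (n : ℝ) * ((1 - z) * z ^ (n - 1)) ≤ 2.72 * n * (1 / 4 * z ^ (n - 2)) := by gcongr
      _ = 0.68 * n * z ^ (n - 2) := by ring
      _ ≤ _ := by gcongr
  linarith

theorem NC (n : ℕ) (hn : 6 ≤ n) (α : ℝ) (h1 : 1 / (n : ℝ) ≤ α) (h2 : α ≤ 1) :
    (1 - α) ^ n + 2.72 * n * (α * (1 / n) ^ (n - 1)) + 2.72 * n * (1 / n) ^ (n - 1) < th n := by
  have hn' : (6 : ℝ) ≤ n := by exact_mod_cast hn
  have hth := th_ge n (by omega)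
  have hgap := th_gap n (by omega)
  have i1 : (1 / (n : ℝ)) ^ (n - 1) ≤ (1 / (n : ℝ)) ^ 5 := inv_pow_le n 1 5 hn (by omega)
  have c1 : (1 - α) ^ n ≤ (1 - 1 / (n : ℝ)) ^ n := by
    apply pow_le_pow_left₀ <;> linarith
  have c2 : 2.72 * n * (α * (1 / (n : ℝ)) ^ (n - 1)) ≤ 2.72 * n * (1 * (1 / n) ^ 5) := by gcongr
  have c3 : 2.72 * n * (1 / (n : ℝ)) ^ (n - 1) ≤ 2.72 * n * ((1 / n) ^ 5) := by gcongr
  have h2 : 5.44 * (n * (1 / (n : ℝ)) ^ 5) < 0.3678 / (n + 1) := by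
    have : 5.44 * (n * (1 / (n : ℝ)) ^ 5) = 5.44 / n ^ 4 := by field_simp
    rw [this, div_lt_div_iff₀ (by positivity) (by positivity)]
    have : (216 : ℝ) ≤ n ^ 3 := by
      calc (216 : ℝ) = 6 ^ 3 := by norm_num
        _ ≤ _ := by gcongr
    have : 216 * (n : ℝ) ≤ n ^ 4 := by nlinarith
    linarith
  have h3 : 0.3678 / ((n : ℝ) + 1) ≤ th n / (n + 1) := by gcongr
  linarith

theorem ND (n : ℕ) (hn : 6 ≤ n) (α β : ℝ) (h0 : 0 ≤ α) (h1 : α ≤ 1 / n) (hz1 : 1 / (n : ℝ) ≤ β) (hz2 : β ≤ 1 / 2) :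
    (1 / 2) ^ n + 2.72 * n * β ^ n + (1 - β) ^ n + 7.4 * n ^ 2 * (α * (1 / n) ^ (n - 2)) < th n := by
  have hn' : (6 : ℝ) ≤ n := by exact_mod_cast hn
  have hz0 : 0 ≤ β := le_trans (by positivity) hz1
  obtain ⟨h64, h64n⟩ := pow2 n hn
  have hth := th_ge n (by omega)
  have hgap := th_gap n (by omega)
  have h3 : 0.3678 / ((n : ℝ) + 1) ≤ th n / (n + 1) := by gcongr
  obtain ⟨t, t0, t1, ht⟩ := chord (1 / (n : ℝ)) (1 / 2) β (by
    apply one_div_lt_one_div_of_lt <;> linarith) hz1 hz2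
  have c1 : (1 - β) ^ n ≤ (1 - t) * (1 - 1 / (n : ℝ)) ^ n + t * (1 / 2) ^ n := by
    have := pow_chord n (1 - 1 / (n : ℝ)) (1 / 2) t (by
      rw [sub_nonneg, div_le_one (by linarith)]; linarith) (by norm_num) t0 t1
    convert this using 2
    rw [ht]; ring
  have c2 : β ^ n ≤ (1 - t) * (1 / (n : ℝ)) ^ n + t * (1 / 2) ^ n := by
    have := pow_chord n (1 / (n : ℝ)) (1 / 2) t (by positivity) (by norm_num) t0 t1
    rwa [← ht] at this
  have i1 : (1 / (n : ℝ)) ^ (n - 2) ≤ (1 / (n : ℝ)) ^ 4 := inv_pow_le n 2 4 hn (by omega)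
  have i2 : (1 / (n : ℝ)) ^ n ≤ (1 / (n : ℝ)) ^ 6 := inv_pow_le n 0 6 hn (by omega)
  have n3 : (216 : ℝ) ≤ n ^ 3 := by
    calc (216 : ℝ) = 6 ^ 3 := by norm_num
      _ ≤ _ := by gcongr
  have ex : 7.4 * (n : ℝ) ^ 2 * (α * (1 / n) ^ (n - 2)) ≤ 7.4 / n ^ 3 := by
    calc 7.4 * (n : ℝ) ^ 2 * (α * (1 / n) ^ (n - 2)) ≤ 7.4 * (n : ℝ) ^ 2 * (1 / n * (1 / n) ^ 4) := by gcongr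
      _ = _ := by field_simp
  have p2 : (1 / 2 : ℝ) ^ n = 1 / 2 ^ n := by rw [one_div, inv_pow, one_div]
  have E1 : (1 / 2) ^ n + 2.72 * n * (1 / (n : ℝ)) ^ n + (1 - 1 / (n : ℝ)) ^ n + 7.4 / n ^ 3 < th n := by
    have a1 : (1 / 2 : ℝ) ^ n ≤ 0.1094 / (n + 1) := by
      rw [p2, div_le_div_iff₀ (by positivity) (by positivity)]
      linarith
    have a2 : 2.72 * n * (1 / (n : ℝ)) ^ n ≤ 0.01 / (n + 1) := by
      calc 2.72 * n * (1 / (n : ℝ)) ^ n ≤ 2.72 * n * (1 / (n : ℝ)) ^ 6 := by gcongr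
        _ = 2.72 / n ^ 5 := by field_simp
        _ ≤ _ := by
          rw [div_le_div_iff₀ (by positivity) (by positivity)]
          have : 216 * 36 * (1:ℝ) ≤ n ^ 5 := by
            calc 216 * 36 * (1:ℝ) ≤ 6 ^ 5 := by norm_num
              _ ≤ _ := by gcongr
          have : 216 * 6 * (n : ℝ) ≤ n ^ 5 := by
            calc 216 * 6 * (n : ℝ) = 6 ^ 4 * n := by norm_num
              _ ≤ n ^ 4 * n := by gcongr
              _ = _ := by ring
          linarith
    have a3 : 7.4 / (n : ℝ) ^ 3 ≤ 0.2399 / (n + 1) := by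
      rw [div_le_div_iff₀ (by positivity) (by positivity)]
      have : 36 * (n : ℝ) ≤ n ^ 3 := by
        calc 36 * (n : ℝ) = 6 ^ 2 * n := by norm_num
          _ ≤ n ^ 2 * n := by gcongr
          _ = _ := by ring
      linarith
    have : 0.1094 / ((n : ℝ) + 1) + 0.01 / (n + 1) + 0.2399 / (n + 1) < 0.3678 / (n + 1) := by
      rw [← add_div, ← add_div]
      apply div_lt_div_of_pos_right (by norm_num) (by positivity)
    linarith
  have E2 : (1 / 2 : ℝ) ^ n + 2.72 * n * (1 / 2) ^ n + (1 / 2) ^ n + 7.4 / n ^ 3 < th n := by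
    have b1 : 7.4 / (n : ℝ) ^ 3 ≤ 0.035 := by
      rw [div_le_iff₀ (by positivity)]; linarith
    have b2 : (1 / 2 : ℝ) ^ n + 2.72 * n * (1 / 2) ^ n + (1 / 2) ^ n ≤ 0.29 := by
      rw [p2]
      have : 1 / (2 : ℝ) ^ n + 2.72 * n * (1 / 2 ^ n) + 1 / 2 ^ n = (2 + 2.72 * n) / 2 ^ n := by
        field_simp; ring
      rw [this, div_le_iff₀ (by positivity)]
      linarith
    linarith
  have := mix_lt t _ _ _ t0 t1 E1 E2
  have hh : 2.72 * (n : ℝ) * β ^ n ≤ 2.72 * n * ((1 - t) * (1 / (n : ℝ)) ^ n + t * (1 / 2) ^ n) := by gcongr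
  linarith

theorem NE (n : ℕ) (hn : 6 ≤ n) : ((n : ℝ) + 1) * (2 / n) ^ n ≤ 7 / 729 := by
  have hn' : (6 : ℝ) ≤ n := by exact_mod_cast hn
  obtain ⟨h1, h2⟩ := pow3 n hn
  have : (2 / (n : ℝ)) ^ n ≤ (1 / 3) ^ n := by
    apply pow_le_pow_left₀ (by positivity)
    rw [div_le_div_iff₀ (by positivity) (by norm_num)]
    linarith
  calc ((n : ℝ) + 1) * (2 / n) ^ n ≤ (n + 1) * (1 / 3) ^ n := by gcongr
    _ = (n + 1) / 3 ^ n := by rw [one_div, inv_pow]; rfl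
    _ ≤ _ := by
      rw [div_le_div_iff₀ (by positivity) (by norm_num)]
      linarith

end P3
end OS

namespace OS
section P4
open Classical

variable {V : Type} [Fintype V] {k l : ℕ} {A : V → V → Prop} {w : V → ℝ} {M : ℝ}

noncomputable def rh (A : V → V → Prop) (w : V → ℝ) (v : V) : ℝ := ms w (adj A v)
noncomputable def wX (A : V → V → Prop) (w : V → ℝ) (v : V) : ℝ := if 1 / 2 ≤ rh A w v then w v else 0
noncomputable def wY (A : V → V → Prop) (w : V → ℝ) (v : V) : ℝ := if 1 / 2 ≤ rh A w v then 0 else w v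
noncomputable def al (A : V → V → Prop) (w : V → ℝ) : ℝ := ∑ v, wX A w v
noncomputable def be (A : V → V → Prop) (w : V → ℝ) (v : V) : ℝ := ms (wY A w) (adj A v)
noncomputable def de (A : V → V → Prop) (w : V → ℝ) (v : V) : ℝ := ms (wY A w) (fun u => ¬ adj A v u)
noncomputable def im (k l : ℕ) : ℝ := 1 / ((k + l : ℕ) : ℝ)

structure Ctx (k l : ℕ) (A : V → V → Prop) (w : V → ℝ) (M : ℝ) : Prop extends Opt k l A w M where
  hm : 6 ≤ k + l
  hl : 1 ≤ l
  hlk : l ≤ k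
  hS : J k l * th (k + l) ≤ ((k : ℝ) + l + 1) * M

theorem adj_symm {u v : V} (h : adj A u v) : adj A v u := h.symm

theorem adj_comm' (u v : V) : adj A u v = adj A v u := propext ⟨Or.symm, Or.symm⟩

theorem wXY (v : V) : w v = wX A w v + wY A w v := by
  unfold wX wY; split_ifs <;> simp

theorem wXYf : w = fun v => wX A w v + wY A w v := funext wXY

theorem wXYd (v : V) : wX A w v = 0 ∨ wY A w v = 0 := by
  unfold wX wY; split_ifs <;> simp

theorem wX_ne {v : V} (h : wX A w v ≠ 0) : w v ≠ 0 ∧ 1 / 2 ≤ rh A w v := by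
  unfold wX at h; split_ifs at h with h1
  · exact ⟨h, h1⟩
  · simp at h

theorem wY_ne {v : V} (h : wY A w v ≠ 0) : w v ≠ 0 ∧ rh A w v < 1 / 2 := by
  unfold wY at h; split_ifs at h with h1
  · simp at h
  · exact ⟨h, not_le.mp h1⟩

theorem mul_le_of_ne {a x y : ℝ} (ha : 0 ≤ a) (h : a ≠ 0 → x ≤ y) : a * x ≤ a * y := by
  rcases ha.eq_or_lt with h0 | h0
  · simp [← h0]
  · exact mul_le_mul_of_nonneg_left (h h0.ne') ha

namespace Ctx

theorem Xnn (C : Ctx k l A w M) (v : V) : 0 ≤ wX A w v := by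
  unfold wX; split_ifs; exacts [C.nn v, le_rfl]
theorem Ynn (C : Ctx k l A w M) (v : V) : 0 ≤ wY A w v := by
  unfold wY; split_ifs; exacts [le_rfl, C.nn v]
theorem Xle (C : Ctx k l A w M) (v : V) : wX A w v ≤ w v := by
  have := C.Ynn v; have := wXY (A := A) (w := w) v; linarith
theorem Yle (C : Ctx k l A w M) (v : V) : wY A w v ≤ w v := by
  have := C.Xnn v; have := wXY (A := A) (w := w) v; linarith
theorem sumY (C : Ctx k l A w M) : ∑ v, wY A w v = 1 - al A w := by
  have := C.sum1
  rw [Finset.sum_congr rfl (fun v _ => wXY (A := A) (w := w) v), Finset.sum_add_distrib] at this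
  unfold al; linarith
theorem al_nn (C : Ctx k l A w M) : 0 ≤ al A w := Finset.sum_nonneg (fun v _ => C.Xnn v)
theorem al_le1 (C : Ctx k l A w M) : al A w ≤ 1 := by
  have := Finset.sum_nonneg (fun v (_ : v ∈ Finset.univ) => C.Ynn v)
  rw [C.sumY] at this; linarith
theorem hk (C : Ctx k l A w M) : 1 ≤ k := by have := C.hm; have := C.hlk; omega
theorem m6 (C : Ctx k l A w M) : (6 : ℝ) ≤ ((k + l : ℕ) : ℝ) := by exact_mod_cast C.hm
theorem im_pos (C : Ctx k l A w M) : 0 < im k l := by have := C.m6; unfold im; positivity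
theorem im_le (C : Ctx k l A w M) : im k l ≤ 1 / 6 := by
  have := C.m6; unfold im; exact one_div_le_one_div_of_le (by norm_num) this
theorem im_mul (C : Ctx k l A w M) : im k l * ((k + l : ℕ) : ℝ) = 1 := by
  have := C.m6; unfold im; field_simp

theorem msw_le (C : Ctx k l A w M) (P : V → Prop) : ms w P ≤ 1 := by
  have := ms_le_sum C.nn P; rwa [C.sum1] at this
theorem rh_le (C : Ctx k l A w M) (v : V) : rh A w v ≤ 1 := C.msw_le _
theorem rh_nn (C : Ctx k l A w M) (v : V) : 0 ≤ rh A w v := ms_nonneg C.nn _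
theorem ms_not_adj (C : Ctx k l A w M) (u : V) : ms w (fun v => ¬ adj A u v) = 1 - rh A w u := by
  have := ms_not w (adj A u)
  rw [C.sum1] at this; unfold rh; linarith
theorem ms_na_le (C : Ctx k l A w M) (c u : V) : ms w (fun v => adj A c v ∧ ¬ adj A u v) ≤ 1 - rh A w u := by
  rw [← C.ms_not_adj]
  exact ms_mono C.nn (fun _ => le_rfl) (fun v h => h.2)

theorem scA (C : Ctx k l A w M) (v : V) : Zp A v (fun _ : Lf k l => w) ≤ J k l * rh A w v ^ (k + l) :=
  Z0J A C.ori v w C.nn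

theorem lf_le (C : Ctx k l A w M) (v : V) : lf k l A w v ≤ Lam1 k l * ∑ c, (if adj A v c then w c * ms w (fun u => adj A c u ∧ ¬ adj A v u) ^ (k + l - 1) else 0) := by
  unfold lf
  rw [Finset.mul_sum]
  apply Finset.sum_le_sum
  intro c _
  have h := Z1sum (k := k) (l := l) A C.ori C.hk C.hl c w (Pi.single v 1) C.nn (single_nonneg v)
  refine (mul_le_mul_of_nonneg_left h (C.nn c)).trans (le_of_eq ?_)
  rw [Finset.sum_eq_single v]
  · rw [adj_comm' v c]
    split_ifs
    · simp; ring
    · simp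
  · intro b _ hb; simp [hb]
  · simp

theorem lfA (C : Ctx k l A w M) (v : V) : lf k l A w v ≤ Lam1 k l * (rh A w v * (1 - rh A w v) ^ (k + l - 1)) := by
  refine (C.lf_le v).trans ?_
  apply mul_le_mul_of_nonneg_left _ (Lam1_pos k l).le
  unfold rh
  conv_rhs => rw [ms, Finset.sum_mul]
  apply Finset.sum_le_sum
  intro c _
  split_ifs
  · apply mul_le_mul_of_nonneg_left _ (C.nn c)
    exact pow_le_pow_left₀ (ms_nonneg C.nn _) (C.ms_na_le c v) _
  · simp

theorem Jp (C : Ctx k l A w M) : 0 < J k l := J_pos k l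
theorem L1 (C : Ctx k l A w M) : Lam1 k l ≤ 2.72 * ((k + l : ℕ) : ℝ) * J k l := by
  have := Lam1_le k l (by have := C.hm; omega); push_cast; exact this
theorem L2 (C : Ctx k l A w M) : Lam2 k l ≤ 7.4 * ((k + l : ℕ) : ℝ) ^ 2 * J k l := by
  have := Lam2_le k l (by have := C.hm; omega); push_cast; exact this

theorem stepB' (C : Ctx k l A w M) (x : V) (hx : w x ≠ 0) (h : 1 / 2 ≤ rh A w x) : 1 - rh A w x ≤ im k l := by
  by_contra hc
  push Not at hc
  have h1 := C.lag_eq x hx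
  have h2 := C.scA x
  have h3 := C.lfA x
  have h4 := NB (k + l) C.hm (1 - rh A w x) hc.le (by linarith)
  have h5 := C.L1
  have h6 := C.hS
  have hr := C.rh_le x
  have hr0 := C.rh_nn x
  rw [sub_sub_cancel] at h4
  have h7 : Lam1 k l * (rh A w x * (1 - rh A w x) ^ (k + l - 1)) ≤ 2.72 * ((k + l : ℕ) : ℝ) * J k l * (rh A w x * (1 - rh A w x) ^ (k + l - 1)) := by
    apply mul_le_mul_of_nonneg_right h5
    have : 0 ≤ 1 - rh A w x := by linarith
    positivity
  have := mul_lt_mul_of_pos_left h4 C.Jp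
  linarith

theorem stepB (C : Ctx k l A w M) (x : V) (hx : wX A w x ≠ 0) : 1 - rh A w x ≤ im k l :=
  C.stepB' x (wX_ne hx).1 (wX_ne hx).2

/-- weighted sums of `wX` against bounded powers -/
theorem X_pow (C : Ctx k l A w M) (c u : V) (j : ℕ) (hu : wX A w u ≠ 0) :
    ms w (fun v => adj A c v ∧ ¬ adj A u v) ^ j ≤ im k l ^ j :=
  pow_le_pow_left₀ (ms_nonneg C.nn _) ((C.ms_na_le c u).trans (C.stepB u hu)) _

theorem F1X (C : Ctx k l A w M) (c : V) : ∑ i : Lf k l, Zp A c (F1 w i (wX A w)) ≤ Lam1 k l * (al A w * im k l ^ (k + l - 1)) := by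
  refine (Z1sum A C.ori C.hk C.hl c w (wX A w) C.nn C.Xnn).trans ?_
  apply mul_le_mul_of_nonneg_left _ (Lam1_pos k l).le
  unfold al
  rw [Finset.sum_mul]
  apply Finset.sum_le_sum
  intro u _
  have := C.im_pos
  have h0 := C.Xnn u
  split_ifs
  · exact mul_le_of_ne h0 (fun hu => C.X_pow c u _ hu)
  · positivity

theorem lfX (C : Ctx k l A w M) (x : V) (hx : wX A w x ≠ 0) : lf k l A w x ≤ Lam1 k l * im k l ^ (k + l - 1) := by
  refine (C.lfA x).trans ?_
  apply mul_le_mul_of_nonneg_left _ (Lam1_pos k l).le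
  have h1 := C.rh_le x
  have h2 := C.rh_nn x
  have h3 := pow_le_pow_left₀ (by linarith) (C.stepB x hx) (k + l - 1)
  have h4 := pow_nonneg (by linarith : 0 ≤ 1 - rh A w x) (k + l - 1)
  nlinarith

theorem sc_split (C : Ctx k l A w M) (c : V) : Zp A c (fun _ : Lf k l => w) ≤ Zp A c (fun _ : Lf k l => wY A w) + Lam1 k l * (al A w * im k l ^ (k + l - 1)) := by
  have h := split1 (k := k) (l := l) A c (wX A w) (wY A w) C.Xnn C.Ynn wXYd
  rw [← wXYf] at h
  linarith [C.F1X c]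

theorem stepC (C : Ctx k l A w M) : al A w ≤ im k l := by
  by_contra hc
  push Not at hc
  have hp := C.im_pos
  obtain ⟨x, _, hx⟩ := Finset.exists_ne_zero_of_sum_ne_zero (show ∑ v, wX A w v ≠ 0 by
    have : al A w ≠ 0 := by linarith
    exact this)
  have h1 := C.lag_eq x (wX_ne hx).1
  have h2 := C.sc_split x
  have h3 := C.lfX x hx
  have h4 := NC (k + l) C.hm (al A w) hc.le C.al_le1
  have h5 := C.L1
  have h6 := C.hS
  have h8 : Zp A x (fun _ : Lf k l => wY A w) ≤ J k l * (1 - al A w) ^ (k + l) := by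
    refine (Z0J A C.ori x (wY A w) C.Ynn).trans ?_
    apply mul_le_mul_of_nonneg_left _ C.Jp.le
    apply pow_le_pow_left₀ (ms_nonneg C.Ynn _)
    rw [← C.sumY]
    exact ms_le_sum C.Ynn _
  have ha := C.al_nn
  have h9 := mul_le_mul_of_nonneg_right h5 (by positivity : 0 ≤ al A w * im k l ^ (k + l - 1))
  have h10 := mul_le_mul_of_nonneg_right h5 (by positivity : 0 ≤ im k l ^ (k + l - 1))
  have := mul_lt_mul_of_pos_left h4 C.Jp
  change J k l * ((1 - al A w) ^ (k + l) + 2.72 * ((k + l : ℕ) : ℝ) * (al A w * im k l ^ (k + l - 1)) + 2.72 * ((k + l : ℕ) : ℝ) * im k l ^ (k + l - 1)) < _ at this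
  linarith

theorem F2X (C : Ctx k l A w M) (c : V) (h : V → ℝ) (hh : ∀ v, 0 ≤ h v) :
    ∑ i : Lf k l, ∑ i' : Lf k l, (if i' ≠ i then Zp A c (F2 w i (wX A w) i' h) else 0) ≤
      Lam2 k l * (im k l ^ (k + l - 2) * ∑ u, wX A w u * ms h (fun v => adj A c v ∧ ¬ adj A u v)) := by
  refine (Z2sum A C.ori C.hk C.hl c w (wX A w) h C.nn C.Xnn hh).trans ?_
  apply mul_le_mul_of_nonneg_left _ (Lam2_pos k l).le
  rw [Finset.mul_sum]
  apply Finset.sum_le_sum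
  intro u _
  unfold ms
  rw [← mul_assoc, Finset.mul_sum]
  apply Finset.sum_le_sum
  intro v _
  have := C.im_pos
  have h0 := C.Xnn u
  have h1 := hh v
  by_cases hc : adj A c u ∧ adj A c v ∧ ¬ adj A u v
  · rw [if_pos hc, if_pos hc.2]
    have := mul_le_of_ne h0 (fun hu => C.X_pow c u (k + l - 2) hu)
    have := mul_le_mul_of_nonneg_right this h1
    unfold ms at this
    linarith
  · rw [if_neg hc]
    split_ifs
    · positivity
    · simp

theorem be_nn (C : Ctx k l A w M) (y : V) : 0 ≤ be A w y := ms_nonneg C.Ynn _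

theorem stepD (C : Ctx k l A w M) (y : V) (hy : wY A w y ≠ 0) : be A w y ≤ im k l := by
  have hne : (Finset.univ.filter (fun v => wY A w v ≠ 0)).Nonempty := ⟨y, by simp [hy]⟩
  obtain ⟨z, hz, hmax⟩ := Finset.exists_max_image _ (be A w) hne
  simp only [Finset.mem_filter, Finset.mem_univ, true_and] at hz hmax
  refine (hmax y hy).trans ?_
  by_contra hc
  push Not at hc
  set β := be A w z with hβ
  have hp := C.im_pos
  have hrz := (wY_ne hz).2
  have hb2 : β ≤ 1 / 2 := by
    have : β ≤ rh A w z := ms_mono C.nn C.Yle (fun _ h => h)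
    linarith
  have h1 := C.lag_eq z (wY_ne hz).1
  have h2 := C.scA z
  have h4 := ND (k + l) C.hm (al A w) β C.al_nn C.stepC hc.le hb2
  have h5 := C.L1
  have h5' := C.L2
  have h6 := C.hS
  have ha := C.al_nn
  have hab : al A w + β ≤ 1 := by
    have : β ≤ ∑ v, wY A w v := ms_le_sum C.Ynn _
    rw [C.sumY] at this; linarith
  have e2 : Zp A z (fun _ : Lf k l => w) ≤ J k l * (1 / 2) ^ (k + l) := by
    refine h2.trans ?_
    apply mul_le_mul_of_nonneg_left _ C.Jp.le
    exact pow_le_pow_left₀ (C.rh_nn z) hrz.le _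
  have p1 : ∀ c, ∑ i : Lf k l, Zp A c (F1 w i (Pi.single z 1)) ≤
      Lam1 k l * (if adj A c z then ms (wY A w) (fun v => adj A c v ∧ ¬ adj A z v) ^ (k + l - 1) else 0) +
      Lam2 k l * (im k l ^ (k + l - 2) * al A w) := by
    intro c
    have s : ∀ i : Lf k l, Zp A c (F1 w i (Pi.single z 1)) ≤ Zp A c (F1 (wY A w) i (Pi.single z 1)) +
      ∑ i' : Lf k l, (if i ≠ i' then Zp A c (F2 w i' (wX A w) i (Pi.single z 1)) else 0) := by
      intro i
      have := split3 A c (wX A w) (wY A w) (Pi.single z 1) C.Xnn C.Ynn (single_nonneg z) wXYd i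
      rwa [← wXYf] at this
    refine (Finset.sum_le_sum (fun i _ => s i)).trans ?_
    rw [Finset.sum_add_distrib]
    apply add_le_add
    · refine (Z1sum A C.ori C.hk C.hl c (wY A w) (Pi.single z 1) C.Ynn (single_nonneg z)).trans (le_of_eq ?_)
      congr 1
      rw [Finset.sum_eq_single z]
      · simp
      · intro b _ hb; simp [hb]
      · simp
    · rw [Finset.sum_comm]
      refine (C.F2X c (Pi.single z 1) (single_nonneg z)).trans ?_
      apply mul_le_mul_of_nonneg_left _ (Lam2_pos k l).le
      apply mul_le_mul_of_nonneg_left _ (by positivity)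
      unfold al
      apply Finset.sum_le_sum
      intro u _
      have : ms (Pi.single z (1:ℝ) : V → ℝ) (fun v => adj A c v ∧ ¬ adj A u v) ≤ 1 := by
        refine (ms_le_sum (single_nonneg z) _).trans ?_
        simp
      have := mul_le_mul_of_nonneg_left this (C.Xnn u)
      linarith
  have p2 : lf k l A w z ≤ Lam1 k l * (al A w * (1 - al A w - β) ^ (k + l - 1)) + Lam1 k l * β ^ (k + l) + Lam2 k l * (al A w * im k l ^ (k + l - 2)) := by
    unfold lf
    refine (Finset.sum_le_sum (fun c _ => mul_le_mul_of_nonneg_left (p1 c) (C.nn c))).trans ?_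
    simp_rw [mul_add]
    rw [Finset.sum_add_distrib, ← Finset.sum_mul, C.sum1]
    have q : ∀ c, w c * (Lam1 k l * (if adj A c z then ms (wY A w) (fun v => adj A c v ∧ ¬ adj A z v) ^ (k + l - 1) else 0)) ≤
      Lam1 k l * (wX A w c * (1 - al A w - β) ^ (k + l - 1)) + Lam1 k l * ((if adj A z c then wY A w c else 0) * β ^ (k + l - 1)) := by
      intro c
      have hX := C.Xnn c
      have hY := C.Ynn c
      have hL := (Lam1_pos k l).le
      have hab' : 0 ≤ 1 - al A w - β := by linarith
      rw [adj_comm' z c]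
      by_cases hcz : adj A c z
      · simp only [hcz, if_true]
        have r1 : ms (wY A w) (fun v => adj A c v ∧ ¬ adj A z v) ^ (k + l - 1) ≤ (1 - al A w - β) ^ (k + l - 1) := by
          apply pow_le_pow_left₀ (ms_nonneg C.Ynn _)
          have e := ms_not (wY A w) (adj A z)
          rw [C.sumY] at e
          have e2 : ms (wY A w) (fun v => adj A c v ∧ ¬ adj A z v) ≤ ms (wY A w) (fun v => ¬ adj A z v) :=
            ms_mono C.Ynn (fun _ => le_rfl) (fun v h => h.2)
          have e3 : β = ms (wY A w) (adj A z) := rfl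
          linarith
        have r2 : wY A w c * ms (wY A w) (fun v => adj A c v ∧ ¬ adj A z v) ^ (k + l - 1) ≤ wY A w c * β ^ (k + l - 1) := by
          apply mul_le_of_ne hY
          intro hcy
          apply pow_le_pow_left₀ (ms_nonneg C.Ynn _)
          refine le_trans ?_ (hmax c hcy)
          exact ms_mono C.Ynn (fun _ => le_rfl) (fun v h => h.1)
        have r3 := mul_le_mul_of_nonneg_left r1 hX
        have r4 := wXY (A := A) (w := w) c
        rw [r4]
        have := mul_le_mul_of_nonneg_left (add_le_add r3 r2) hL
        linarith
      · simp only [hcz, if_false, mul_zero, zero_mul, add_zero]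
        positivity
    have q2 := Finset.sum_le_sum (s := Finset.univ) (fun c (_ : c ∈ Finset.univ) => q c)
    rw [Finset.sum_add_distrib, ← Finset.mul_sum, ← Finset.mul_sum, ← Finset.sum_mul, ← Finset.sum_mul] at q2
    have e3 : ∑ c, (if adj A z c then wY A w c else 0) = β := rfl
    have e4 : β * β ^ (k + l - 1) = β ^ (k + l) := by
      rw [← pow_succ']; congr 1; have := C.hm; omega
    rw [e3, e4] at q2
    have e5 : ∑ c, wX A w c = al A w := rfl
    rw [e5] at q2
    linarith
  have p3 := Lam1_J k l (by have := C.hm; omega) (al A w) (1 - al A w - β) ha (by linarith)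
  have e6 : al A w + (1 - al A w - β) = 1 - β := by ring
  rw [e6] at p3
  have hβ0 : 0 ≤ β := by linarith
  have h9 := mul_le_mul_of_nonneg_right h5 (by positivity : 0 ≤ β ^ (k + l))
  have h10 := mul_le_mul_of_nonneg_right h5' (by positivity : 0 ≤ al A w * im k l ^ (k + l - 2))
  have := mul_lt_mul_of_pos_left h4 C.Jp
  change J k l * ((1 / 2) ^ (k + l) + 2.72 * ((k + l : ℕ) : ℝ) * β ^ (k + l) + (1 - β) ^ (k + l) + 7.4 * ((k + l : ℕ) : ℝ) ^ 2 * (al A w * im k l ^ (k + l - 2))) < _ at this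
  linarith

theorem scX_le (C : Ctx k l A w M) (x : V) : Zp A x (fun _ : Lf k l => w) ≤ J k l := by
  refine (C.scA x).trans ?_
  have := pow_le_one₀ (n := k + l) (C.rh_nn x) (C.rh_le x)
  have := C.Jp
  nlinarith

theorem rhY (C : Ctx k l A w M) (y : V) (hy : wY A w y ≠ 0) : rh A w y ≤ 2 / ((k + l : ℕ) : ℝ) := by
  have h1 := C.stepD y hy
  have h2 := C.stepC
  have h3 : rh A w y = ms (wX A w) (adj A y) + be A w y := by
    unfold rh be
    rw [← ms_add]
    congr 1
    exact wXYf
  have h4 : ms (wX A w) (adj A y) ≤ al A w := ms_le_sum C.Xnn _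
  have h5 : 2 / ((k + l : ℕ) : ℝ) = im k l + im k l := by unfold im; ring
  linarith

theorem scY_le (C : Ctx k l A w M) (y : V) (hy : wY A w y ≠ 0) : Zp A y (fun _ : Lf k l => w) ≤ J k l * (2 / ((k + l : ℕ) : ℝ)) ^ (k + l) := by
  refine (C.scA y).trans ?_
  apply mul_le_mul_of_nonneg_left _ C.Jp.le
  exact pow_le_pow_left₀ (C.rh_nn y) (C.rhY y hy) _

theorem M_le (C : Ctx k l A w M) (B : ℝ) (hB : ∀ x, wX A w x ≠ 0 → Zp A x (fun _ : Lf k l => w) ≤ B) :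
    M ≤ al A w * B + J k l * (2 / ((k + l : ℕ) : ℝ)) ^ (k + l) := by
  have hb : ∀ c, w c * Zp A c (fun _ : Lf k l => w) ≤ wX A w c * B + wY A w c * (J k l * (2 / ((k + l : ℕ) : ℝ)) ^ (k + l)) := by
    intro c
    have h1 := mul_le_of_ne (C.Xnn c) (fun h => hB c h)
    have h2 := mul_le_of_ne (C.Ynn c) (fun h => C.scY_le c h)
    rw [wXY (A := A) (w := w) c]
    rw [← wXY (A := A) (w := w) c]
    have e : w c * Zp A c (fun _ : Lf k l => w) = wX A w c * Zp A c (fun _ : Lf k l => w) + wY A w c * Zp A c (fun _ : Lf k l => w) := by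
      rw [← add_mul, ← wXY]
    linarith
  rw [C.hM]
  unfold sW
  refine (Finset.sum_le_sum (fun c _ => hb c)).trans ?_
  rw [Finset.sum_add_distrib, ← Finset.sum_mul, ← Finset.sum_mul, C.sumY]
  have : 0 ≤ J k l * (2 / ((k + l : ℕ) : ℝ)) ^ (k + l) := by
    have := C.Jp; positivity
  have h0 := C.al_nn
  change al A w * B + _ ≤ _
  nlinarith

theorem mcast (C : Ctx k l A w M) : ((k + l : ℕ) : ℝ) = (k : ℝ) + l := by push_cast; ring

theorem stepE (C : Ctx k l A w M) : 0.95 ≤ al A w * (((k + l : ℕ) : ℝ) + 1) := by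
  have h := C.M_le (((k : ℝ) + l + 1) * M) (by
    intro x hx
    have h1 := C.lag x
    have : 0 ≤ lf k l A w x := by
      unfold lf
      apply Finset.sum_nonneg; intro c _; apply mul_nonneg (C.nn c)
      apply Finset.sum_nonneg; intro i _; apply Zp_nonneg
      intro j u; exact F1_nonneg C.nn (single_nonneg x) _ _ _
    linarith)
  have hne := NE (k + l) C.hm
  have hS := C.hS
  have hth := th_ge (k + l) (by have := C.hm; omega)
  have hJ := C.Jp
  have hm := C.m6
  rw [← C.mcast] at h hS
  set m := ((k + l : ℕ) : ℝ)
  have h1 : J k l * 0.3678 ≤ (m + 1) * M := le_trans (mul_le_mul_of_nonneg_left hth hJ.le) hS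
  have h2 : J k l * ((m + 1) * (2 / m) ^ (k + l)) ≤ J k l * (7 / 729) := mul_le_mul_of_nonneg_left hne hJ.le
  by_contra hc
  push Not at hc
  have hT : 0 < (m + 1) * M := by nlinarith
  have h3 : (m + 1) * M ≤ (al A w * (m + 1)) * ((m + 1) * M) + J k l * (7 / 729) := by
    have := mul_le_mul_of_nonneg_left h (by linarith : 0 ≤ m + 1)
    nlinarith
  nlinarith

theorem stepF (C : Ctx k l A w M) : M ≤ 0.19 * J k l := by
  have h := C.M_le (J k l) (fun x _ => C.scX_le x)
  have hne := NE (k + l) C.hm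
  have hm := C.m6
  have hJ := C.Jp
  have h1 := C.stepC
  have h2 := C.im_le
  have h3 : (2 / ((k + l : ℕ) : ℝ)) ^ (k + l) ≤ 1 / 729 := by
    have : 0 ≤ (2 / ((k + l : ℕ) : ℝ)) ^ (k + l) := by positivity
    nlinarith
  have := mul_le_mul_of_nonneg_left h3 hJ.le
  have : al A w * J k l ≤ 1 / 6 * J k l := by
    apply mul_le_mul_of_nonneg_right _ hJ.le
    linarith
  linarith

theorem stepG (C : Ctx k l A w M) (x : V) (hx : wX A w x ≠ 0) : 0.36 * J k l ≤ Zp A x (fun _ : Lf k l => wY A w) := by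
  have h1 := C.lag_eq x (wX_ne hx).1
  have h2 := C.sc_split x
  have h3 := C.lfX x hx
  have h5 := C.L1
  have h6 := C.hS
  have hJ := C.Jp
  have hth := th_ge (k + l) (by have := C.hm; omega)
  have hm := C.m6
  have hp := C.im_pos
  have ha := C.al_nn
  have hc := C.stepC
  have hi := C.im_le
  have i1 : im k l ^ (k + l - 1) ≤ im k l ^ 5 := inv_pow_le (k + l) 1 5 C.hm (by have := C.hm; omega)
  have e1 : Lam1 k l * (al A w * im k l ^ (k + l - 1)) + Lam1 k l * im k l ^ (k + l - 1) ≤ J k l * 0.005 := by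
    calc Lam1 k l * (al A w * im k l ^ (k + l - 1)) + Lam1 k l * im k l ^ (k + l - 1)
        = Lam1 k l * ((al A w + 1) * im k l ^ (k + l - 1)) := by ring
      _ ≤ (2.72 * ((k + l : ℕ) : ℝ) * J k l) * ((1 / 6 + 1) * im k l ^ 5) := by
          have := (Lam1_pos k l).le
          gcongr
          linarith
      _ = (2.72 * J k l) * (7 / 6) * (im k l * ((k + l : ℕ) : ℝ)) * im k l ^ 4 := by ring
      _ = (2.72 * J k l) * (7 / 6) * im k l ^ 4 := by rw [C.im_mul]; ring
      _ ≤ (2.72 * J k l) * (7 / 6) * (1 / 6) ^ 4 := by gcongr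
      _ ≤ _ := by nlinarith
  have := mul_le_mul_of_nonneg_left hth hJ.le
  linarith

theorem stepH (C : Ctx k l A w M) : M ≤ ∑ c, w c * Zp A c (fun _ : Lf k l => wX A w) + ∑ c, w c * Zp A c (fun _ : Lf k l => wY A w)
    + Lam2 k l * im k l ^ (k + l - 2) * ∑ u, wX A w u * de A w u := by
  have h : ∀ c, Zp A c (fun _ : Lf k l => w) ≤ Zp A c (fun _ : Lf k l => wX A w) + Zp A c (fun _ : Lf k l => wY A w)
    + Lam2 k l * im k l ^ (k + l - 2) * ∑ u, wX A w u * de A w u := by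
    intro c
    have h1 := split2 (k := k) (l := l) A c (wX A w) (wY A w) C.Xnn C.Ynn wXYd
    rw [← wXYf] at h1
    have h2 := C.F2X c (wY A w) C.Ynn
    have h3 : ∑ u, wX A w u * ms (wY A w) (fun v => adj A c v ∧ ¬ adj A u v) ≤ ∑ u, wX A w u * de A w u := by
      apply Finset.sum_le_sum
      intro u _
      apply mul_le_mul_of_nonneg_left _ (C.Xnn u)
      exact ms_mono C.Ynn (fun _ => le_rfl) (fun v h => h.2)
    have hp := C.im_pos
    have hL := Lam2_pos k l
    have := mul_le_mul_of_nonneg_left h3 (by positivity : 0 ≤ Lam2 k l * im k l ^ (k + l - 2))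
    linarith
  rw [C.hM]
  unfold sW
  refine (Finset.sum_le_sum (fun c _ => mul_le_mul_of_nonneg_left (h c) (C.nn c))).trans (le_of_eq ?_)
  simp_rw [mul_add]
  rw [Finset.sum_add_distrib, Finset.sum_add_distrib, ← Finset.sum_mul, C.sum1, one_mul]

theorem Lam2_im (C : Ctx k l A w M) : Lam2 k l * im k l ^ (k + l - 2) ≤ 0.206 * J k l := by
  have h := C.L2
  have hp := C.im_pos
  have hJ := C.Jp
  have hi := C.im_le
  have i1 : im k l ^ (k + l - 2) ≤ im k l ^ 4 := inv_pow_le (k + l) 2 4 C.hm (by have := C.hm; omega)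
  calc Lam2 k l * im k l ^ (k + l - 2) ≤ (7.4 * ((k + l : ℕ) : ℝ) ^ 2 * J k l) * im k l ^ 4 := by
        have := (Lam2_pos k l).le
        gcongr
    _ = 7.4 * J k l * (im k l * ((k + l : ℕ) : ℝ)) ^ 2 * im k l ^ 2 := by ring
    _ = 7.4 * J k l * im k l ^ 2 := by rw [C.im_mul]; ring
    _ ≤ 7.4 * J k l * (1 / 6) ^ 2 := by gcongr
    _ ≤ _ := by nlinarith

end Ctx
end P4
end OS

namespace OS
section P5
open Classical

variable {V : Type} [Fintype V] {k l : ℕ} {A : V → V → Prop} {w : V → ℝ} {M : ℝ}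

/-- adjacency weight between two weight functions -/
noncomputable def EE (A : V → V → Prop) (p q : V → ℝ) : ℝ := ∑ u, p u * ms q (adj A u)

noncomputable def pO (A : V → V → Prop) (g : V → ℝ) (x u : V) : ℝ := if A x u then g u else 0
noncomputable def pI (A : V → V → Prop) (g : V → ℝ) (x u : V) : ℝ := if A u x then g u else 0

theorem sum_pO (g : V → ℝ) (x : V) : ∑ u, pO A g x u = ms g (fun v => A x v) := rfl
theorem sum_pI (g : V → ℝ) (x : V) : ∑ u, pI A g x u = ms g (fun v => A v x) := rfl
theorem pO_nn {g : V → ℝ} (hg : ∀ v, 0 ≤ g v) (x u : V) : 0 ≤ pO A g x u := by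
  unfold pO; split_ifs; exacts [hg u, le_rfl]
theorem pI_nn {g : V → ℝ} (hg : ∀ v, 0 ≤ g v) (x u : V) : 0 ≤ pI A g x u := by
  unfold pI; split_ifs; exacts [hg u, le_rfl]
theorem EE_nn {p q : V → ℝ} (hp : ∀ v, 0 ≤ p v) (hq : ∀ v, 0 ≤ q v) : 0 ≤ EE A p q :=
  Finset.sum_nonneg (fun u _ => mul_nonneg (hp u) (ms_nonneg hq _))

theorem EE_comm (p q : V → ℝ) : EE A p q = EE A q p := by
  unfold EE ms
  simp_rw [Finset.mul_sum]
  rw [Finset.sum_comm]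
  refine Finset.sum_congr rfl fun u _ => Finset.sum_congr rfl fun v _ => ?_
  rw [adj_comm' v u]
  split_ifs <;> ring

theorem EE_addl (p p' q : V → ℝ) : EE A (fun v => p v + p' v) q = EE A p q + EE A p' q := by
  unfold EE
  rw [← Finset.sum_add_distrib]
  exact Finset.sum_congr rfl fun u _ => by ring

theorem EE_addr (p q q' : V → ℝ) : EE A p (fun v => q v + q' v) = EE A p q + EE A p q' := by
  rw [EE_comm, EE_addl, EE_comm q, EE_comm q']

noncomputable def pN (A : V → V → Prop) (g : V → ℝ) (x u : V) : ℝ := if ¬ adj A x u then g u else 0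
theorem pN_nn {g : V → ℝ} (hg : ∀ v, 0 ≤ g v) (x u : V) : 0 ≤ pN A g x u := by
  unfold pN; split_ifs <;> simp [hg u]

theorem EE_monol {p p' q : V → ℝ} (hp : ∀ v, p v ≤ p' v) (hq : ∀ v, 0 ≤ q v) : EE A p q ≤ EE A p' q :=
  Finset.sum_le_sum fun u _ => mul_le_mul_of_nonneg_right (hp u) (ms_nonneg hq _)

theorem bern0 (n : ℕ) (a d : ℝ) (ha : 0 ≤ a) (hd : 0 ≤ d) :
    a ^ (n + 1) + (n + 1) * d * a ^ n ≤ (a + d) ^ (n + 1) := by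
  induction n with
  | zero => simp
  | succ n ih =>
    have h := mul_le_mul_of_nonneg_right ih (by linarith : 0 ≤ a + d)
    have e : (a + d) ^ (n + 1 + 1) = (a + d) ^ (n + 1) * (a + d) := pow_succ _ _
    rw [e]
    refine le_trans ?_ h
    push_cast
    have : 0 ≤ (n + 1) * d * a ^ n * d := by positivity
    have e2 : a ^ (n + 1) = a ^ n * a := pow_succ _ _
    have e3 : a ^ (n + 1 + 1) = a ^ n * a * a := by rw [pow_succ, pow_succ]
    rw [e3, e2]
    linarith

theorem pair_loss (A : V → V → Prop) (c : V) (g : V → ℝ) (hg : ∀ v, 0 ≤ g v) (i i' : Lf k l) (hi : i' ≠ i) (p q : V → ℝ)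
    (hp : ∀ u, p u = if ty A c i u then g u else 0) (hq : ∀ u, q u = if ty A c i' u then g u else 0) (Q : ℝ)
    (hQ : ∏ j ∈ (Finset.univ.erase i).erase i', ms g (ty A c j) = Q) :
    Zp A c (fun _ : Lf k l => g) ≤ ((∑ u, p u) * (∑ u, q u) - EE A p q) * Q := by
  have h := Z2any A c g g g hg hg hg i i' hi
  have e : F2 g i g i' g = fun _ : Lf k l => g := by
    funext j; unfold F2; split_ifs <;> rfl
  rw [e] at h
  refine h.trans ?_
  have e2 : (∑ u, p u) * (∑ u, q u) - EE A p q = ∑ u, ∑ v, p u * (if ¬ adj A u v then q v else 0) := by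
    unfold EE
    rw [Finset.sum_mul, ← Finset.sum_sub_distrib]
    refine Finset.sum_congr rfl fun u _ => ?_
    rw [ms_not q (adj A u), ← Finset.mul_sum]
    unfold ms; ring
  rw [e2, Finset.sum_mul]
  apply Finset.sum_le_sum; intro u _
  rw [Finset.sum_mul]
  apply Finset.sum_le_sum; intro v _
  have hpn : 0 ≤ p u := by rw [hp]; split_ifs; exacts [hg u, le_rfl]
  have hqn : 0 ≤ q v := by rw [hq]; split_ifs; exacts [hg v, le_rfl]
  have e3 : (if ty A c i' v ∧ ¬ adj A u v then g v else 0) = (if ¬ adj A u v then q v else 0) := by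
    rw [hq]; split_ifs <;> simp_all
  rw [e3, ← hp, ← hQ]
  apply mul_le_mul_of_nonneg_left
  · apply Finset.prod_le_prod
    · intro j _; exact ms_nonneg hg _
    · intro j _; exact ms_mono hg (fun _ => le_rfl) (fun v h => h.1)
  · apply mul_nonneg hpn; split_ifs <;> simp [hqn]

theorem loss_arith (P Z e s Q : ℝ) (hs : 0 ≤ s) (h : Z ≤ (s - e) * Q) (hP : P = s * Q) : P * e ≤ s * (P - Z) := by
  subst hP
  have := mul_le_mul_of_nonneg_left h hs
  nlinarith

theorem loss_oo (A : V → V → Prop) (hk : 2 ≤ k) (c : V) (g : V → ℝ) (hg : ∀ v, 0 ≤ g v) (a b P : ℝ)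
    (ha : a = ms g (fun v => A c v)) (hb : b = ms g (fun v => A v c)) (hP : P = a ^ k * b ^ l) :
    P * EE A (pO A g c) (pO A g c) ≤ a * a * (P - Zp A c (fun _ : Lf k l => g)) := by
  have hne : (⟨1, by omega⟩ : Fin k) ≠ ⟨0, by omega⟩ := by simp
  have h := pair_loss (k := k) (l := l) A c g hg (Sum.inl ⟨0, by omega⟩) (Sum.inl ⟨1, by omega⟩)
    (by simpa using hne) (pO A g c) (pO A g c) (fun u => rfl) (fun u => rfl) (a ^ (k - 2) * b ^ l)
    (erase_oo _ _ _ hne _ _ (fun d _ _ => ha.symm) (fun d => hb.symm))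
  rw [sum_pO, ← ha] at h
  have ha0 : 0 ≤ a := ha ▸ ms_nonneg hg _
  refine loss_arith P _ _ (a * a) _ (by positivity) h ?_
  rw [hP]
  obtain ⟨n, rfl⟩ : ∃ n, k = n + 2 := ⟨k - 2, by omega⟩
  simp only [Nat.add_sub_cancel]; ring

theorem loss_oi (A : V → V → Prop) (hk : 1 ≤ k) (hl : 1 ≤ l) (c : V) (g : V → ℝ) (hg : ∀ v, 0 ≤ g v) (a b P : ℝ)
    (ha : a = ms g (fun v => A c v)) (hb : b = ms g (fun v => A v c)) (hP : P = a ^ k * b ^ l) :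
    P * EE A (pO A g c) (pI A g c) ≤ a * b * (P - Zp A c (fun _ : Lf k l => g)) := by
  have h := pair_loss (k := k) (l := l) A c g hg (Sum.inl ⟨0, by omega⟩) (Sum.inr ⟨0, by omega⟩)
    (by simp) (pO A g c) (pI A g c) (fun u => rfl) (fun u => rfl) (a ^ (k - 1) * b ^ (l - 1))
    (erase_oi _ _ _ _ _ (fun d _ => ha.symm) (fun d _ => hb.symm))
  rw [sum_pO, sum_pI, ← ha, ← hb] at h
  have ha0 : 0 ≤ a := ha ▸ ms_nonneg hg _
  have hb0 : 0 ≤ b := hb ▸ ms_nonneg hg _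
  refine loss_arith P _ _ (a * b) _ (by positivity) h ?_
  rw [hP]
  obtain ⟨n, rfl⟩ : ∃ n, k = n + 1 := ⟨k - 1, by omega⟩
  obtain ⟨n, rfl⟩ : ∃ n, l = n + 1 := ⟨l - 1, by omega⟩
  simp only [Nat.add_sub_cancel]; ring

theorem loss_ii (A : V → V → Prop) (hl : 2 ≤ l) (c : V) (g : V → ℝ) (hg : ∀ v, 0 ≤ g v) (a b P : ℝ)
    (ha : a = ms g (fun v => A c v)) (hb : b = ms g (fun v => A v c)) (hP : P = a ^ k * b ^ l) :
    P * EE A (pI A g c) (pI A g c) ≤ b * b * (P - Zp A c (fun _ : Lf k l => g)) := by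
  have hne : (⟨1, by omega⟩ : Fin l) ≠ ⟨0, by omega⟩ := by simp
  have h := pair_loss (k := k) (l := l) A c g hg (Sum.inr ⟨0, by omega⟩) (Sum.inr ⟨1, by omega⟩)
    (by simpa using hne) (pI A g c) (pI A g c) (fun u => rfl) (fun u => rfl) (a ^ k * b ^ (l - 2))
    (erase_ii _ _ _ hne _ _ (fun d => ha.symm) (fun d _ _ => hb.symm))
  rw [sum_pI, ← hb] at h
  have hb0 : 0 ≤ b := hb ▸ ms_nonneg hg _
  refine loss_arith P _ _ (b * b) _ (by positivity) h ?_
  rw [hP]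
  obtain ⟨n, rfl⟩ : ∃ n, l = n + 2 := ⟨l - 2, by omega⟩
  simp only [Nat.add_sub_cancel]; ring

noncomputable def aa (A : V → V → Prop) (w : V → ℝ) (x : V) : ℝ := ms (wY A w) (fun v => A x v)
noncomputable def bb (A : V → V → Prop) (w : V → ℝ) (x : V) : ℝ := ms (wY A w) (fun v => A v x)
/-- the out-part of the internal adjacency -/
noncomputable def eO (A : V → V → Prop) (w : V → ℝ) (x : V) : ℝ :=
  EE A (pO A (wY A w) x) (pO A (wY A w) x) + EE A (pO A (wY A w) x) (pI A (wY A w) x)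
noncomputable def eI (A : V → V → Prop) (w : V → ℝ) (x : V) : ℝ :=
  EE A (pO A (wY A w) x) (pI A (wY A w) x) + EE A (pI A (wY A w) x) (pI A (wY A w) x)

namespace Ctx

theorem aa_nn (C : Ctx k l A w M) (x : V) : 0 ≤ aa A w x := ms_nonneg C.Ynn _
theorem bb_nn (C : Ctx k l A w M) (x : V) : 0 ≤ bb A w x := ms_nonneg C.Ynn _
theorem de_nn (C : Ctx k l A w M) (x : V) : 0 ≤ de A w x := ms_nonneg C.Ynn _
theorem abd (C : Ctx k l A w M) (x : V) : aa A w x + bb A w x + de A w x = 1 - al A w := by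
  rw [← C.sumY, ms_not (wY A w) (adj A x), ms_adj A C.ori]
  rfl

theorem Pge (C : Ctx k l A w M) (x : V) (hx : wX A w x ≠ 0) : 0.36 * J k l ≤ aa A w x ^ k * bb A w x ^ l :=
  (C.stepG x hx).trans (Z0 A x _ C.Ynn)

theorem al_pos (C : Ctx k l A w M) : 0 < al A w := by
  have := C.stepE
  have := C.m6
  by_contra h
  push Not at h
  nlinarith

theorem lossO (C : Ctx k l A w M) (x : V) (hx : wX A w x ≠ 0) :
    Zp A x (fun _ : Lf k l => wY A w) ≤ aa A w x ^ k * bb A w x ^ l - 0.36 * J k l * eO A w x := by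
  have hP := C.Pge x hx
  have hk2 : 2 ≤ k := by have := C.hm; have := C.hlk; omega
  have h1 := loss_oo (l := l) A hk2 x (wY A w) C.Ynn (aa A w x) (bb A w x) _ rfl rfl rfl
  have h2 := loss_oi A C.hk C.hl x (wY A w) C.Ynn (aa A w x) (bb A w x) _ rfl rfl rfl
  have hZ : Zp A x (fun _ : Lf k l => wY A w) ≤ aa A w x ^ k * bb A w x ^ l := Z0 A x _ C.Ynn
  have ha := C.aa_nn x
  have hb := C.bb_nn x
  have hd := C.de_nn x
  have habd := C.abd x
  have hal := C.al_pos
  have hE : 0 ≤ eO A w x := add_nonneg (EE_nn (pO_nn C.Ynn x) (pO_nn C.Ynn x)) (EE_nn (pO_nn C.Ynn x) (pI_nn C.Ynn x))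
  set a := aa A w x
  set b := bb A w x
  set P := a ^ k * b ^ l
  have h3 : P * eO A w x ≤ P - Zp A x (fun _ : Lf k l => wY A w) := by
    have e : P * eO A w x ≤ (a * (a + b)) * (P - Zp A x (fun _ : Lf k l => wY A w)) := by
      unfold eO; rw [mul_add]; linarith
    refine e.trans ?_
    have : a * (a + b) ≤ 1 := by nlinarith
    nlinarith
  have := mul_le_mul_of_nonneg_right hP hE
  linarith

theorem lossN (C : Ctx k l A w M) (hl : 2 ≤ l) (x : V) (hx : wX A w x ≠ 0) :
    Zp A x (fun _ : Lf k l => wY A w) ≤ aa A w x ^ k * bb A w x ^ l - 0.36 * J k l * (eO A w x + eI A w x) := by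
  have hP := C.Pge x hx
  have hk2 : 2 ≤ k := by have := C.hm; have := C.hlk; omega
  have h1 := loss_oo (l := l) A hk2 x (wY A w) C.Ynn (aa A w x) (bb A w x) _ rfl rfl rfl
  have h2 := loss_oi A C.hk C.hl x (wY A w) C.Ynn (aa A w x) (bb A w x) _ rfl rfl rfl
  have h2' := loss_ii (k := k) A hl x (wY A w) C.Ynn (aa A w x) (bb A w x) _ rfl rfl rfl
  have hZ : Zp A x (fun _ : Lf k l => wY A w) ≤ aa A w x ^ k * bb A w x ^ l := Z0 A x _ C.Ynn
  have ha := C.aa_nn x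
  have hb := C.bb_nn x
  have hd := C.de_nn x
  have habd := C.abd x
  have hal := C.al_pos
  have hE : 0 ≤ eO A w x := add_nonneg (EE_nn (pO_nn C.Ynn x) (pO_nn C.Ynn x)) (EE_nn (pO_nn C.Ynn x) (pI_nn C.Ynn x))
  have hE' : 0 ≤ eI A w x := add_nonneg (EE_nn (pO_nn C.Ynn x) (pI_nn C.Ynn x)) (EE_nn (pI_nn C.Ynn x) (pI_nn C.Ynn x))
  set a := aa A w x
  set b := bb A w x
  set P := a ^ k * b ^ l
  have h3 : P * (eO A w x + eI A w x) ≤ P - Zp A x (fun _ : Lf k l => wY A w) := by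
    have e : P * (eO A w x + eI A w x) ≤ ((a + b) * (a + b)) * (P - Zp A x (fun _ : Lf k l => wY A w)) := by
      unfold eO eI; simp only [mul_add]; linarith
    refine e.trans ?_
    have : (a + b) * (a + b) ≤ 1 := by nlinarith
    nlinarith
  have := mul_le_mul_of_nonneg_right hP (add_nonneg hE hE')
  linarith

theorem Pg (C : Ctx k l A w M) (x : V) (hx : wX A w x ≠ 0) :
    aa A w x ^ k * bb A w x ^ l ≤ (1 - al A w - bb A w x) ^ k * bb A w x ^ l - 0.36 * J k l * (k * de A w x) := by
  have hP := C.Pge x hx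
  have ha := C.aa_nn x
  have hb := C.bb_nn x
  have hd := C.de_nn x
  have habd := C.abd x
  have hal := C.al_pos
  have e : 1 - al A w - bb A w x = aa A w x + de A w x := by linarith
  rw [e]
  obtain ⟨n, hn⟩ : ∃ n, k = n + 1 := ⟨k - 1, by have := C.hk; omega⟩
  have h1 : aa A w x ^ k + k * de A w x * aa A w x ^ n ≤ (aa A w x + de A w x) ^ k := by
    rw [hn]; have := bern0 n _ _ ha hd; push_cast; linarith
  have h2 : aa A w x ^ k * bb A w x ^ l ≤ aa A w x ^ n * bb A w x ^ l := by
    apply mul_le_mul_of_nonneg_right _ (by positivity)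
    rw [hn, pow_succ]
    have : 0 ≤ aa A w x ^ n := by positivity
    nlinarith
  have h3 := mul_le_mul_of_nonneg_right h1 (by positivity : 0 ≤ bb A w x ^ l)
  have h4 := mul_le_mul_of_nonneg_left (hP.trans h2) (by positivity : 0 ≤ k * de A w x)
  linarith

/-- combination step -/
theorem combine (C : Ctx k l A w M) (E : V → ℝ) (R T S κ : ℝ)
    (hE : ∀ x, wX A w x ≠ 0 → Zp A x (fun _ : Lf k l => wY A w) ≤ aa A w x ^ k * bb A w x ^ l - 0.36 * J k l * E x)
    (hY : ∑ c, wY A w c * Zp A c (fun _ : Lf k l => wY A w) ≤ R + T * S) (hS : 0 ≤ S)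
    (hT : T ≤ 0.36 * J k l * (κ * al A w))
    (hSE : κ * al A w * S ≤ ∑ x, wX A w x * (E x + 2 * im k l * de A w x)) :
    M ≤ ∑ c, w c * Zp A c (fun _ : Lf k l => wX A w) +
      ∑ x, wX A w x * ((1 - al A w - bb A w x) ^ k * bb A w x ^ l) + R := by
  have h1 := C.stepH
  have hJ := C.Jp
  have e1 : ∑ c, w c * Zp A c (fun _ : Lf k l => wY A w) = ∑ c, wX A w c * Zp A c (fun _ : Lf k l => wY A w) + ∑ c, wY A w c * Zp A c (fun _ : Lf k l => wY A w) := by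
    rw [← Finset.sum_add_distrib]
    refine Finset.sum_congr rfl fun c _ => ?_
    rw [← add_mul, ← wXY]
  have hk : (1 : ℝ) ≤ k := by exact_mod_cast C.hk
  have h2 : ∑ c, wX A w c * Zp A c (fun _ : Lf k l => wY A w) ≤ ∑ x, wX A w x * (((1 - al A w - bb A w x) ^ k * bb A w x ^ l) - 0.36 * J k l * (de A w x + E x)) := by
    apply Finset.sum_le_sum; intro x _
    apply mul_le_of_ne (C.Xnn x); intro hx
    have := hE x hx
    have := C.Pg x hx
    have hd := C.de_nn x
    have : 0.36 * J k l * de A w x ≤ 0.36 * J k l * (k * de A w x) := by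
      apply mul_le_mul_of_nonneg_left _ (by positivity)
      nlinarith
    linarith
  have h3 : ∑ x, wX A w x * (((1 - al A w - bb A w x) ^ k * bb A w x ^ l) - 0.36 * J k l * (de A w x + E x)) =
    ∑ x, wX A w x * ((1 - al A w - bb A w x) ^ k * bb A w x ^ l) - 0.36 * J k l * (∑ x, wX A w x * de A w x) - 0.36 * J k l * (∑ x, wX A w x * E x) := by
    rw [Finset.mul_sum, Finset.mul_sum, ← Finset.sum_sub_distrib, ← Finset.sum_sub_distrib]
    exact Finset.sum_congr rfl fun c _ => by ring
  have h4 : ∑ x, wX A w x * (E x + 2 * im k l * de A w x) = ∑ x, wX A w x * E x + 2 * im k l * ∑ x, wX A w x * de A w x := by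
    rw [Finset.mul_sum, ← Finset.sum_add_distrib]
    exact Finset.sum_congr rfl fun c _ => by ring
  have hD : 0 ≤ ∑ x, wX A w x * de A w x := Finset.sum_nonneg fun x _ => mul_nonneg (C.Xnn x) (C.de_nn x)
  have h5 := mul_le_mul_of_nonneg_right hT hS
  have h6 := mul_le_mul_of_nonneg_left hSE (by positivity : 0 ≤ 0.36 * J k l)
  have h7 := mul_le_mul_of_nonneg_right C.Lam2_im hD
  have h8 := mul_le_mul_of_nonneg_right C.im_le (mul_nonneg hJ.le hD)
  rw [h4] at h6
  rw [h3] at h2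
  have h9 := mul_nonneg hJ.le hD
  nlinarith

theorem sum_pN (x : V) : ∑ u, pN A (wY A w) x u = de A w x := by
  unfold de ms pN
  refine Finset.sum_congr rfl fun u _ => ?_
  congr

/-- sums of internal adjacency over non-neighbours -/
theorem nonadj_sum (C : Ctx k l A w M) (x : V) :
    ∑ u, pN A (wY A w) x u * be A w u ≤ im k l * de A w x := by
  rw [← sum_pN, Finset.mul_sum]
  apply Finset.sum_le_sum; intro u _
  unfold pN
  have := mul_le_of_ne (C.Ynn u) (fun hu => C.stepD u hu)
  by_cases h : adj A x u
  · simp [h]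
  · simp only [h, not_false_eq_true, if_true]; linarith

theorem Ydec (C : Ctx k l A w M) (x : V) : wY A w = fun u => (pO A (wY A w) x u + pI A (wY A w) x u) + pN A (wY A w) x u := by
  funext u
  have := C.ori x u
  unfold pO pI pN adj
  by_cases h1 : A x u <;> by_cases h2 : A u x <;> simp_all

theorem EE_dec (C : Ctx k l A w M) (x : V) (p : V → ℝ) : EE A p (wY A w) =
    EE A p (pO A (wY A w) x) + EE A p (pI A (wY A w) x) + EE A p (pN A (wY A w) x) := by
  rw [← EE_addr, ← EE_addr, ← C.Ydec x]

theorem EE_pN (C : Ctx k l A w M) (x : V) : EE A (wY A w) (pN A (wY A w) x) ≤ im k l * de A w x := by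
  rw [EE_comm]; exact C.nonadj_sum x

theorem out_sum (C : Ctx k l A w M) (x : V) :
    ∑ u, pO A (wY A w) x u * be A w u ≤ eO A w x + im k l * de A w x := by
  have e : ∑ u, pO A (wY A w) x u * be A w u = EE A (pO A (wY A w) x) (wY A w) := rfl
  rw [e, C.EE_dec x]
  have : EE A (pO A (wY A w) x) (pN A (wY A w) x) ≤ EE A (wY A w) (pN A (wY A w) x) := by
    apply EE_monol
    · intro u; unfold pO; split_ifs; exacts [le_rfl, C.Ynn u]
    · exact pN_nn C.Ynn x
  unfold eO
  linarith [C.EE_pN x]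

theorem in_sum (C : Ctx k l A w M) (x : V) :
    EE A (pI A (wY A w) x) (wY A w) ≤ eI A w x + EE A (pI A (wY A w) x) (pN A (wY A w) x) := by
  rw [C.EE_dec x, EE_comm (pI A (wY A w) x) (pO A (wY A w) x)]
  unfold eI
  linarith

theorem tot_sum (C : Ctx k l A w M) (x : V) :
    EE A (wY A w) (wY A w) ≤ eO A w x + eI A w x + 2 * im k l * de A w x := by
  have e : EE A (wY A w) (wY A w) = EE A (wY A w) (pO A (wY A w) x) + EE A (wY A w) (pI A (wY A w) x) + EE A (wY A w) (pN A (wY A w) x) := C.EE_dec x _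
  have h1 := C.in_sum x
  have h2 : EE A (pO A (wY A w) x) (wY A w) = eO A w x + EE A (pO A (wY A w) x) (pN A (wY A w) x) := by
    rw [C.EE_dec x]; unfold eO; ring
  rw [EE_comm (wY A w) (pO A (wY A w) x), EE_comm (wY A w) (pI A (wY A w) x)] at e
  have h3 : EE A (pO A (wY A w) x) (pN A (wY A w) x) + EE A (pI A (wY A w) x) (pN A (wY A w) x) ≤ EE A (wY A w) (pN A (wY A w) x) := by
    rw [← EE_addl]
    apply EE_monol
    · intro u
      have := congrFun (C.Ydec x) u
      have h := pN_nn (A := A) C.Ynn x u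
      linarith
    · exact pN_nn C.Ynn x
  have := C.EE_pN x
  linarith

theorem im5 (C : Ctx k l A w M) : im k l ^ (k + l - 1) ≤ 0.002 * al A w := by
  have hE := C.stepE
  have hp := C.im_pos
  have hi := C.im_le
  have i1 : im k l ^ (k + l - 1) ≤ im k l ^ 5 := inv_pow_le (k + l) 1 5 C.hm (by have := C.hm; omega)
  have i2 := C.im_mul
  have ha := C.al_pos
  have h1 : 0.95 * im k l ≤ al A w * (7 / 6) := by
    have := mul_le_mul_of_nonneg_right hE hp.le
    have e : al A w * (((k + l : ℕ) : ℝ) + 1) * im k l = al A w * (1 + im k l) := by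
      linear_combination (al A w) * i2
    rw [e] at this
    nlinarith
  have h2 : im k l ^ 4 ≤ (1 / 6) ^ 4 := by gcongr
  have h3 : im k l ^ 5 = im k l ^ 4 * im k l := by ring
  have h4 : im k l ^ 4 * im k l ≤ (1 / 6) ^ 4 * im k l := mul_le_mul_of_nonneg_right h2 hp.le
  linarith

/-- main inequality for `l ≥ 2` -/
theorem main2 (C : Ctx k l A w M) (hl2 : 2 ≤ l) :
    M ≤ ∑ c, w c * Zp A c (fun _ : Lf k l => wX A w) +
      ∑ x, wX A w x * ((1 - al A w - bb A w x) ^ k * bb A w x ^ l) := by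
  have hJ := C.Jp
  have h := C.combine (fun x => eO A w x + eI A w x) 0 (J k l * im k l ^ (k + l - 1)) (EE A (wY A w) (wY A w)) 1
    (fun x hx => C.lossN hl2 x hx) ?_ (EE_nn C.Ynn C.Ynn) ?_ ?_
  · linarith
  · rw [zero_add]
    unfold EE
    rw [Finset.mul_sum]
    apply Finset.sum_le_sum; intro c _
    have h1 : Zp A c (fun _ : Lf k l => wY A w) ≤ J k l * be A w c ^ (k + l) := Z0J A C.ori c (wY A w) C.Ynn
    have hb := C.be_nn c
    have h2 : wY A w c * Zp A c (fun _ : Lf k l => wY A w) ≤ wY A w c * (J k l * im k l ^ (k + l - 1) * be A w c) := by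
      apply mul_le_of_ne (C.Ynn c); intro hc
      refine h1.trans ?_
      have h3 : be A w c ^ (k + l) = be A w c ^ (k + l - 1) * be A w c := by
        rw [← pow_succ]; congr 1; have := C.hm; omega
      rw [h3, mul_assoc]
      have := pow_le_pow_left₀ hb (C.stepD c hc) (k + l - 1)
      gcongr
    refine h2.trans (le_of_eq ?_)
    unfold be; ring
  · have := C.im5
    have := C.al_pos
    nlinarith
  · rw [one_mul]
    unfold al
    rw [Finset.sum_mul]
    apply Finset.sum_le_sum; intro x _
    exact mul_le_mul_of_nonneg_left (C.tot_sum x) (C.Xnn x)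

end Ctx
end P5
end OS

namespace OS
section P5b
open Classical

variable {V : Type} [Fintype V] {k l : ℕ} {A : V → V → Prop} {w : V → ℝ} {M : ℝ}

theorem bern (n : ℕ) (N ρ η α : ℝ) (h0 : 0 ≤ η) (h1 : η ≤ α) (hN : 0 ≤ N) (h : α * ρ ≤ n * N) :
    (N + ρ * η) * (α - η) ^ n ≤ N * α ^ n := by
  rcases (h0.trans h1).eq_or_lt with ha | ha
  · have : η = 0 := by linarith
    subst this; simp
  · obtain ⟨t, ht⟩ : ∃ t, t = η / α := ⟨_, rfl⟩
    have he : η = t * α := by rw [ht]; field_simp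
    have ht0 : 0 ≤ t := by rw [ht]; positivity
    have ht1 : t ≤ 1 := by rw [ht, div_le_one ha]; exact h1
    have e1 : N + ρ * η ≤ N * (1 + n * t) := by
      rw [he]; nlinarith
    have e2 : 1 + n * t ≤ (1 + t) ^ n := one_add_mul_le_pow (by linarith) n
    have e3 : (α - η) ^ n = α ^ n * (1 - t) ^ n := by rw [← mul_pow]; congr 1; rw [he]; ring
    have e4 : (1 + t) ^ n * (1 - t) ^ n ≤ 1 := by
      rw [← mul_pow]; apply pow_le_one₀ <;> nlinarith
    have p1 : 0 ≤ (1 - t) ^ n := pow_nonneg (by linarith) n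
    calc (N + ρ * η) * (α - η) ^ n ≤ (N * (1 + t) ^ n) * (α ^ n * (1 - t) ^ n) := by
          rw [e3]
          apply mul_le_mul_of_nonneg_right _ (by positivity)
          exact e1.trans (mul_le_mul_of_nonneg_left e2 hN)
      _ = N * α ^ n * ((1 + t) ^ n * (1 - t) ^ n) := by ring
      _ ≤ N * α ^ n * 1 := by apply mul_le_mul_of_nonneg_left e4 (by positivity)
      _ = _ := by ring

noncomputable def Fo (k l : ℕ) (α d : ℝ) : ℝ :=
  α * (1 - α) ^ (k + l) * d ^ k * (1 - d) ^ l + J (k - 1) l * (1 - α) * α ^ (k + l) * (1 - d)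

noncomputable def bh (k l : ℕ) (α b : ℝ) : ℝ := max b ((l : ℝ) / ((k : ℝ) + l) * (1 - α))

theorem J_val (k l : ℕ) (hk : 1 ≤ k) (s : ℝ) :
    (k / ((k : ℝ) + l) * s) ^ k * (l / ((k : ℝ) + l) * s) ^ l = J k l * s ^ (k + l) := by
  have : (0 : ℝ) < (k : ℝ) + l := by
    have : (1 : ℝ) ≤ k := by exact_mod_cast hk
    positivity
  unfold J
  rw [mul_pow, mul_pow, div_pow, div_pow, pow_add, pow_add]
  field_simp

theorem bh_ge (k l : ℕ) (α b : ℝ) : b ≤ bh k l α b := le_max_left _ _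

theorem bh_ge' (k l : ℕ) (α b : ℝ) : (l : ℝ) / ((k : ℝ) + l) * (1 - α) ≤ bh k l α b := le_max_right _ _

theorem bh_le (k l : ℕ) (hk : 1 ≤ k) (α b : ℝ) (ha : α ≤ 1) (hb : b ≤ 1 - α) : bh k l α b ≤ 1 - α := by
  unfold bh
  apply max_le hb
  have hk' : (1 : ℝ) ≤ k := by exact_mod_cast hk
  have : (l : ℝ) / ((k : ℝ) + l) ≤ 1 := by
    rw [div_le_one (by positivity)]; linarith
  nlinarith

theorem gmono (k l : ℕ) (hk : 1 ≤ k) (α b : ℝ) (ha : α ≤ 1) (hb0 : 0 ≤ b) (hb : b ≤ 1 - α) :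
    (1 - α - b) ^ k * b ^ l ≤ (1 - α - bh k l α b) ^ k * bh k l α b ^ l := by
  have hk' : (1 : ℝ) ≤ k := by exact_mod_cast hk
  rcases le_total ((l : ℝ) / ((k : ℝ) + l) * (1 - α)) b with h | h
  · have : bh k l α b = b := max_eq_left h
    rw [this]
  · have : bh k l α b = (l : ℝ) / ((k : ℝ) + l) * (1 - α) := max_eq_right h
    rw [this]
    have e : 1 - α - (l : ℝ) / ((k : ℝ) + l) * (1 - α) = k / ((k : ℝ) + l) * (1 - α) := by
      have : (0 : ℝ) < (k : ℝ) + l := by positivity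
      field_simp; ring
    rw [e, J_val k l hk]
    exact amgmJ k l _ _ _ (by linarith) hb0 (by linarith)

theorem Fo_eq (k l : ℕ) (hkl : 1 ≤ k + l) (α b : ℝ) (ha : α < 1) :
    Fo k l α (1 - b / (1 - α)) = α * ((1 - α - b) ^ k * b ^ l + J (k - 1) l * α ^ (k + l - 1) * b) := by
  have h1 : 1 - α ≠ 0 := by linarith
  have e1 : 1 - α - b = (1 - α) * (1 - b / (1 - α)) := by field_simp
  have e2 : b = (1 - α) * (1 - (1 - b / (1 - α))) := by field_simp; ring
  unfold Fo
  rw [e1]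
  set d := 1 - b / (1 - α)
  rw [e2]
  obtain ⟨n, hn⟩ : ∃ n, k + l = n + 1 := ⟨k + l - 1, by omega⟩
  have e3 : α ^ (k + l) = α ^ (k + l - 1) * α := by rw [hn, pow_succ]; rfl
  rw [e3, mul_pow, mul_pow, pow_add (1 - α)]
  ring

theorem FA (k l : ℕ) (hk : 1 ≤ k) (Ω : ℝ)
    (hΩ : ∀ α d : ℝ, 0 ≤ α → α ≤ 1 / 2 → 0 ≤ d → d ≤ (k : ℝ) / ((k : ℝ) + l) → Fo k l α d ≤ Ω)
    (α b : ℝ) (h0 : 0 ≤ α) (h1 : α ≤ 1 / 2) (hb0 : 0 ≤ b) (hb : b ≤ 1 - α) :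
    α * ((1 - α - b) ^ k * b ^ l + J (k - 1) l * α ^ (k + l - 1) * bh k l α b) ≤ Ω := by
  have hk' : (1 : ℝ) ≤ k := by exact_mod_cast hk
  have hg := gmono k l hk α b (by linarith) hb0 hb
  have hl := bh_le k l hk α b (by linarith) hb
  have hge := bh_ge' k l α b
  have hge2 := bh_ge k l α b
  have hpos : 0 < 1 - α := by linarith
  have h := hΩ α (1 - bh k l α b / (1 - α)) h0 h1 ?_ ?_
  · rw [Fo_eq k l (by omega) α _ (by linarith)] at h
    refine le_trans ?_ h
    apply mul_le_mul_of_nonneg_left _ h0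
    linarith
  · have : bh k l α b / (1 - α) ≤ 1 := by rw [div_le_one hpos]; exact hl
    linarith
  · have : (l : ℝ) / ((k : ℝ) + l) ≤ bh k l α b / (1 - α) := by
      rw [le_div_iff₀ hpos]; exact hge
    have e : (k : ℝ) / ((k : ℝ) + l) = 1 - (l : ℝ) / ((k : ℝ) + l) := by
      have : (0 : ℝ) < (k : ℝ) + l := by positivity
      field_simp; ring
    linarith

noncomputable def et (A : V → V → Prop) (w : V → ℝ) (x : V) : ℝ := ms (wX A w) (adj A x)

theorem swap_out (f g h : V → ℝ) :
    ∑ c, f c * ∑ u, (if A c u then g u else 0) * h u = ∑ u, g u * h u * ms f (fun c => A c u) := by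
  unfold ms
  simp_rw [Finset.mul_sum]
  rw [Finset.sum_comm]
  refine Finset.sum_congr rfl fun u _ => Finset.sum_congr rfl fun c _ => ?_
  split_ifs <;> ring

theorem swap_adj (f g : V → ℝ) :
    ∑ c, f c * ms g (adj A c) = ∑ u, g u * ms f (adj A u) := EE_comm (A := A) f g

namespace Ctx

theorem et_nn (C : Ctx k l A w M) (x : V) : 0 ≤ et A w x := ms_nonneg C.Xnn _
theorem et_le (C : Ctx k l A w M) (x : V) : et A w x ≤ al A w := ms_le_sum C.Xnn _
theorem et_sub (C : Ctx k l A w M) (c u : V) :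
    ms (wX A w) (fun v => adj A c v ∧ ¬ adj A u v) ≤ al A w - et A w u := by
  have h := ms_not (wX A w) (adj A u)
  have h2 : ms (wX A w) (fun v => adj A c v ∧ ¬ adj A u v) ≤ ms (wX A w) (fun v => ¬ adj A u v) :=
    ms_mono C.Xnn (fun _ => le_rfl) (fun v h => h.2)
  unfold al et
  linarith

theorem al_half (C : Ctx k l A w M) : al A w ≤ 1 / 6 := C.stepC.trans C.im_le

theorem bb_le (C : Ctx k l A w M) (x : V) : bb A w x ≤ 1 - al A w := by
  have := C.abd x; have := C.aa_nn x; have := C.de_nn x; linarith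

theorem ZXout (C : Ctx k l A w M) (c : V) : Zp A c (fun _ : Lf k l => wX A w) ≤
    ∑ u, (if A c u then wX A w u else 0) * (ms (wX A w) (fun v => A c v ∧ ¬ adj A u v) ^ (k - 1) * ms (wX A w) (fun v => A v c ∧ ¬ adj A u v) ^ l) := by
  have h := Z1out (l := l) A c (wX A w) (wX A w) C.Xnn C.Xnn (⟨0, C.hk⟩ : Fin k)
  have e : F1 (wX A w) (Sum.inl (⟨0, C.hk⟩ : Fin k) : Lf k l) (wX A w) = fun _ => wX A w := by
    funext j; unfold F1; split_ifs <;> rfl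
  rwa [e] at h

theorem pq_le (C : Ctx k l A w M) (c u : V) :
    ms (wX A w) (fun v => A c v ∧ ¬ adj A u v) ^ (k - 1) * ms (wX A w) (fun v => A v c ∧ ¬ adj A u v) ^ l ≤
      J (k - 1) l * (al A w - et A w u) ^ (k + l - 1) := by
  have h := amgmJ (k - 1) l (ms (wX A w) (fun v => A c v ∧ ¬ adj A u v)) (ms (wX A w) (fun v => A v c ∧ ¬ adj A u v)) (al A w - et A w u)
    (ms_nonneg C.Xnn _) (ms_nonneg C.Xnn _) (by rw [ms_adj2 A C.ori]; exact C.et_sub c u)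
  have e : k - 1 + l = k + l - 1 := by have := C.hk; omega
  rwa [e] at h

theorem inX (C : Ctx k l A w M) (u : V) : ms (wX A w) (fun c => A c u) ≤ et A w u :=
  ms_mono C.Xnn (fun _ => le_rfl) (fun v h => Or.inr h)

theorem inw (C : Ctx k l A w M) (u : V) : ms w (fun c => A c u) ≤ bb A w u + et A w u := by
  have e : ms w (fun c => A c u) = ms (wX A w) (fun c => A c u) + ms (wY A w) (fun c => A c u) := by
    rw [← ms_add, ← wXYf]
  have := C.inX u
  unfold bb
  linarith

theorem UX_out (C : Ctx k l A w M) : ∑ c, w c * Zp A c (fun _ : Lf k l => wX A w) ≤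
    J (k - 1) l * ∑ u, wX A w u * ((bb A w u + et A w u) * (al A w - et A w u) ^ (k + l - 1)) := by
  have hJ := (J_pos (k - 1) l).le
  calc ∑ c, w c * Zp A c (fun _ : Lf k l => wX A w) ≤
      ∑ c, w c * ∑ u, (if A c u then wX A w u else 0) * (J (k - 1) l * (al A w - et A w u) ^ (k + l - 1)) := by
        apply Finset.sum_le_sum; intro c _
        apply mul_le_mul_of_nonneg_left _ (C.nn c)
        refine (C.ZXout c).trans ?_
        apply Finset.sum_le_sum; intro u _
        apply mul_le_mul_of_nonneg_left (C.pq_le c u)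
        split_ifs; exacts [C.Xnn u, le_rfl]
    _ ≤ _ := by
        rw [swap_out, Finset.mul_sum]
        apply Finset.sum_le_sum; intro u _
        have h1 := C.inw u
        have h2 : 0 ≤ al A w - et A w u := by linarith [C.et_le u]
        have := mul_le_mul_of_nonneg_left h1 (by have := C.Xnn u; positivity : 0 ≤ wX A w u * (J (k - 1) l * (al A w - et A w u) ^ (k + l - 1)))
        linarith

theorem sum_le_Om (C : Ctx k l A w M) (f : V → ℝ) (Ω : ℝ) (h : ∀ x, wX A w x ≠ 0 → al A w * f x ≤ Ω) :
    ∑ x, wX A w x * f x ≤ Ω := by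
  have ha := C.al_pos
  have : ∑ x, wX A w x * f x ≤ ∑ x, wX A w x * (Ω / al A w) := by
    apply Finset.sum_le_sum; intro x _
    apply mul_le_of_ne (C.Xnn x); intro hx
    rw [le_div_iff₀ ha]; linarith [h x hx]
  refine this.trans (le_of_eq ?_)
  rw [← Finset.sum_mul]
  change al A w * _ = _
  field_simp

theorem bh_low (C : Ctx k l A w M) (x : V) : 5 / 6 * im k l ≤ bh k l (al A w) (bb A w x) := by
  refine le_trans ?_ (bh_ge' k l _ _)
  have h1 := C.al_half
  have h2 : (1 : ℝ) ≤ l := by exact_mod_cast C.hl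
  have h3 := C.m6
  have h4 : im k l ≤ (l : ℝ) / ((k : ℝ) + l) := by
    unfold im
    rw [C.mcast]
    rw [C.mcast] at h3
    gcongr
  have := C.im_pos
  nlinarith

/-- final bound in the case `k > l ≥ 2` -/
theorem final_gt2 (C : Ctx k l A w M) (hl2 : 2 ≤ l) (Ω : ℝ)
    (hΩ : ∀ α d : ℝ, 0 ≤ α → α ≤ 1 / 2 → 0 ≤ d → d ≤ (k : ℝ) / ((k : ℝ) + l) → Fo k l α d ≤ Ω) : M ≤ Ω := by
  have h1 := C.main2 hl2
  have h2 := C.UX_out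
  have ha := C.al_half
  have ha0 := C.al_pos
  have hJ := (J_pos (k - 1) l).le
  refine le_trans ?_ (C.sum_le_Om (fun x => (1 - al A w - bb A w x) ^ k * bb A w x ^ l + J (k - 1) l * al A w ^ (k + l - 1) * bh k l (al A w) (bb A w x)) Ω
    (fun x _ => FA k l C.hk Ω hΩ (al A w) (bb A w x) ha0.le (by linarith) (C.bb_nn x) (C.bb_le x)))
  have h3 : ∑ u, wX A w u * ((bb A w u + et A w u) * (al A w - et A w u) ^ (k + l - 1)) ≤
      ∑ u, wX A w u * (bh k l (al A w) (bb A w u) * al A w ^ (k + l - 1)) := by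
    apply Finset.sum_le_sum; intro u _
    apply mul_le_mul_of_nonneg_left _ (C.Xnn u)
    have hb := C.bh_low u
    have hge := bh_ge k l (al A w) (bb A w u)
    have hip := C.im_pos
    have h4 := bern (k + l - 1) (bh k l (al A w) (bb A w u)) 1 (et A w u) (al A w) (C.et_nn u) (C.et_le u) (by linarith) (by
      have : ((k + l - 1 : ℕ) : ℝ) = ((k + l : ℕ) : ℝ) - 1 := by
        rw [Nat.cast_sub (by have := C.hm; omega)]; simp
      rw [this]
      have := C.stepC
      have := C.m6
      nlinarith)
    refine le_trans ?_ h4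
    apply mul_le_mul_of_nonneg_right
    · linarith
    · exact pow_nonneg (by linarith [C.et_le u]) _
  have h5 := mul_le_mul_of_nonneg_left h3 hJ
  have e : ∑ x, wX A w x * ((1 - al A w - bb A w x) ^ k * bb A w x ^ l + J (k - 1) l * al A w ^ (k + l - 1) * bh k l (al A w) (bb A w x)) =
    ∑ x, wX A w x * ((1 - al A w - bb A w x) ^ k * bb A w x ^ l) + J (k - 1) l * ∑ u, wX A w u * (bh k l (al A w) (bb A w u) * al A w ^ (k + l - 1)) := by
    rw [Finset.mul_sum, ← Finset.sum_add_distrib]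
    exact Finset.sum_congr rfl fun x _ => by ring
  rw [e]
  linarith

end Ctx
end P5b
end OS

namespace OS
section P5c
open Classical

variable {V : Type} [Fintype V] {k l : ℕ} {A : V → V → Prop} {w : V → ℝ} {M : ℝ}

namespace Ctx

theorem ZXeq (C : Ctx k k A w M) (c : V) : Zp A c (fun _ : Lf k k => wX A w) ≤
    (1 / 4) ^ k * ms (fun x => wX A w x * (al A w - et A w x) ^ (k - 1)) (adj A c) ^ 2 := by
  have hk := C.hk
  obtain ⟨n, hn⟩ : ∃ n, k = n + 1 := ⟨k - 1, by omega⟩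
  have h := Z2gen (k := k) (l := k) A c (fun _ => wX A w) (fun _ => C.Xnn) (Sum.inl ⟨0, hk⟩) (Sum.inr ⟨0, hk⟩) (by simp)
  have hr : ∀ u, 0 ≤ al A w - et A w u := fun u => by linarith [C.et_le u]
  have hpos : ∀ u, 0 ≤ wX A w u * (al A w - et A w u) ^ (k - 1) := fun u => mul_nonneg (C.Xnn u) (pow_nonneg (hr u) _)
  rw [ms_adj A C.ori]
  have key : Zp A c (fun _ : Lf k k => wX A w) ≤ (1 / 4) ^ (k - 1) *
      (ms (fun x => wX A w x * (al A w - et A w x) ^ (k - 1)) (fun v => A c v) *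
        ms (fun x => wX A w x * (al A w - et A w x) ^ (k - 1)) (fun v => A v c)) := by
    refine h.trans ?_
    unfold ms
    rw [Finset.sum_mul_sum, Finset.mul_sum]
    apply Finset.sum_le_sum; intro u _
    rw [Finset.mul_sum]
    apply Finset.sum_le_sum; intro v _
    have hprod : ∏ j ∈ (Finset.univ.erase (Sum.inl (⟨0, hk⟩ : Fin k) : Lf k k)).erase (Sum.inr ⟨0, hk⟩),
        ms (wX A w) (fun z => ty A c j z ∧ ¬ adj A u z ∧ ¬ adj A v z) ≤ (1 / 4) ^ (k - 1) * ((al A w - et A w u) ^ (k - 1) * (al A w - et A w v) ^ (k - 1)) := by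
      rw [erase_oi _ _ _ (ms (wX A w) (fun z => A c z ∧ ¬ adj A u z ∧ ¬ adj A v z)) (ms (wX A w) (fun z => A z c ∧ ¬ adj A u z ∧ ¬ adj A v z)) (fun d _ => rfl) (fun d _ => rfl)]
      rw [← mul_pow, ← mul_pow, ← mul_pow]
      have p0 : 0 ≤ ms (wX A w) (fun z => A c z ∧ ¬ adj A u z ∧ ¬ adj A v z) := ms_nonneg C.Xnn _
      have q0 : 0 ≤ ms (wX A w) (fun z => A z c ∧ ¬ adj A u z ∧ ¬ adj A v z) := ms_nonneg C.Xnn _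
      have hu : ms (wX A w) (fun z => A c z ∧ ¬ adj A u z ∧ ¬ adj A v z) + ms (wX A w) (fun z => A z c ∧ ¬ adj A u z ∧ ¬ adj A v z) ≤ al A w - et A w u := by
        refine le_trans ?_ (C.et_sub c u)
        rw [← ms_adj2 A C.ori]
        exact add_le_add (ms_mono C.Xnn (fun _ => le_rfl) (fun v h => ⟨h.1, h.2.1⟩)) (ms_mono C.Xnn (fun _ => le_rfl) (fun v h => ⟨h.1, h.2.1⟩))
      have hv : ms (wX A w) (fun z => A c z ∧ ¬ adj A u z ∧ ¬ adj A v z) + ms (wX A w) (fun z => A z c ∧ ¬ adj A u z ∧ ¬ adj A v z) ≤ al A w - et A w v := by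
        refine le_trans ?_ (C.et_sub c v)
        rw [← ms_adj2 A C.ori]
        exact add_le_add (ms_mono C.Xnn (fun _ => le_rfl) (fun v h => ⟨h.1, h.2.2⟩)) (ms_mono C.Xnn (fun _ => le_rfl) (fun v h => ⟨h.1, h.2.2⟩))
      apply pow_le_pow_left₀ (by positivity)
      have := mul_le_mul hu hv (by linarith) (hr u)
      nlinarith [sq_nonneg (ms (wX A w) (fun z => A c z ∧ ¬ adj A u z ∧ ¬ adj A v z) - ms (wX A w) (fun z => A z c ∧ ¬ adj A u z ∧ ¬ adj A v z))]
    have t1 : (if ty A c (Sum.inl (⟨0, hk⟩ : Fin k) : Lf k k) u then wX A w u else 0) = if A c u then wX A w u else 0 := rfl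
    have t2 : (if ty A c (Sum.inr (⟨0, hk⟩ : Fin k) : Lf k k) v ∧ ¬ adj A u v then wX A w v else 0) ≤ if A v c then wX A w v else 0 := by
      have hx := C.Xnn v
      change (if A v c ∧ ¬ adj A u v then wX A w v else 0) ≤ _
      split_ifs <;> simp_all
    have u1 : 0 ≤ (if A c u then wX A w u else 0) := by split_ifs; exacts [C.Xnn u, le_rfl]
    have u2 : 0 ≤ (if A v c then wX A w v else 0) := by split_ifs; exacts [C.Xnn v, le_rfl]
    rw [t1]
    refine (mul_le_mul (mul_le_mul_of_nonneg_left t2 u1) hprod (Finset.prod_nonneg fun j _ => ms_nonneg C.Xnn _) (mul_nonneg u1 u2)).trans (le_of_eq ?_)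
    split_ifs <;> ring
  refine key.trans ?_
  have e : ((1 : ℝ) / 4) ^ k = (1 / 4) ^ (k - 1) * (1 / 4) := by
    rw [← pow_succ]; congr 1; omega
  rw [e, mul_assoc]
  apply mul_le_mul_of_nonneg_left _ (by positivity)
  nlinarith [sq_nonneg (ms (fun x => wX A w x * (al A w - et A w x) ^ (k - 1)) (fun v => A c v) - ms (fun x => wX A w x * (al A w - et A w x) ^ (k - 1)) (fun v => A v c))]

theorem UX_eq (C : Ctx k k A w M) : ∑ c, w c * Zp A c (fun _ : Lf k k => wX A w) ≤
    (1 / 4) ^ k * ((1 - al A w) * al A w ^ (2 * k)) := by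
  have hk := C.hk
  have hk2 : 2 ≤ k := by have := C.hm; omega
  have ha := C.al_pos
  have ha6 := C.al_half
  have hr : ∀ u, 0 ≤ al A w - et A w u := fun u => by linarith [C.et_le u]
  have hpos : ∀ u, 0 ≤ wX A w u * (al A w - et A w u) ^ (k - 1) := fun u => mul_nonneg (C.Xnn u) (pow_nonneg (hr u) _)
  obtain ⟨t, ht⟩ : ∃ t : V → ℝ, ∀ u, al A w - et A w u = al A w * t u := ⟨fun u => (al A w - et A w u) / al A w, fun u => by field_simp⟩
  have ht0 : ∀ u, 0 ≤ t u := fun u => by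
    have := hr u; rw [ht u] at this; exact nonneg_of_mul_nonneg_right this ha
  have ht1 : ∀ u, t u ≤ 1 := fun u => by
    have := C.et_nn u; have := ht u; nlinarith
  set α := al A w with hα
  set Vv := ∑ u, wX A w u * t u ^ (k - 1) with hV
  have hV0 : 0 ≤ Vv := Finset.sum_nonneg fun u _ => mul_nonneg (C.Xnn u) (pow_nonneg (ht0 u) _)
  have hV1 : Vv ≤ α := by
    rw [hα]; unfold al
    apply Finset.sum_le_sum; intro u _
    have := pow_le_one₀ (n := k - 1) (ht0 u) (ht1 u)
    have := C.Xnn u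
    nlinarith
  have hT : ∀ c, ms (fun x => wX A w x * (α - et A w x) ^ (k - 1)) (adj A c) ≤ α ^ (k - 1) * Vv := by
    intro c
    refine (ms_le_sum hpos _).trans (le_of_eq ?_)
    rw [hV, Finset.mul_sum]
    refine Finset.sum_congr rfl fun u _ => ?_
    rw [ht u, mul_pow]; ring
  have hT0 : ∀ c, 0 ≤ ms (fun x => wX A w x * (α - et A w x) ^ (k - 1)) (adj A c) := fun c => ms_nonneg hpos _
  have hXs : ∑ c, wX A w c * ms (fun x => wX A w x * (α - et A w x) ^ (k - 1)) (adj A c) ≤ α ^ (k - 1) * (α * (α - Vv)) := by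
    rw [swap_adj]
    have : α * (α - Vv) = ∑ u, wX A w u * (α * (1 - t u ^ (k - 1))) := by
      have e1 : ∑ u, wX A w u * (α * (1 - t u ^ (k - 1))) = α * (∑ u, wX A w u) - α * Vv := by
        rw [hV, Finset.mul_sum, Finset.mul_sum, ← Finset.sum_sub_distrib]
        exact Finset.sum_congr rfl fun u _ => by ring
      rw [e1]
      change _ = α * α - _
      ring
    rw [this, Finset.mul_sum]
    apply Finset.sum_le_sum; intro u _
    change wX A w u * (α - et A w u) ^ (k - 1) * et A w u ≤ _
    have h1 : (α - et A w u) ^ (k - 1) ≤ α ^ (k - 1) := pow_le_pow_left₀ (hr u) (by linarith [C.et_nn u]) _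
    have h2 : et A w u ≤ α * (1 - t u ^ (k - 1)) := by
      have : t u ^ (k - 1) ≤ t u := pow_le_of_le_one (ht0 u) (ht1 u) (by omega)
      have := ht u
      nlinarith
    have h3 := mul_le_mul h1 h2 (C.et_nn u) (by positivity)
    have := mul_le_mul_of_nonneg_left h3 (C.Xnn u)
    linarith
  have hc : ∀ c, w c * Zp A c (fun _ : Lf k k => wX A w) ≤ (1 / 4) ^ k * (wY A w c * (α ^ (k - 1) * Vv) ^ 2 +
      wX A w c * ms (fun x => wX A w x * (α - et A w x) ^ (k - 1)) (adj A c) * (α ^ (k - 1) * Vv)) := by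
    intro c
    refine (mul_le_mul_of_nonneg_left (C.ZXeq c) (C.nn c)).trans ?_
    have h1 : ms (fun x => wX A w x * (α - et A w x) ^ (k - 1)) (adj A c) ^ 2 ≤ (α ^ (k - 1) * Vv) ^ 2 := pow_le_pow_left₀ (hT0 c) (hT c) 2
    have h2 : ms (fun x => wX A w x * (α - et A w x) ^ (k - 1)) (adj A c) ^ 2 ≤ ms (fun x => wX A w x * (α - et A w x) ^ (k - 1)) (adj A c) * (α ^ (k - 1) * Vv) := by
      rw [sq]; exact mul_le_mul_of_nonneg_left (hT c) (hT0 c)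
    have e : w c * ((1 / 4) ^ k * ms (fun x => wX A w x * (α - et A w x) ^ (k - 1)) (adj A c) ^ 2) = (1 / 4) ^ k * (wY A w c * ms (fun x => wX A w x * (α - et A w x) ^ (k - 1)) (adj A c) ^ 2 + wX A w c * ms (fun x => wX A w x * (α - et A w x) ^ (k - 1)) (adj A c) ^ 2) := by
      have hwc := wXY (A := A) (w := w) c
      linear_combination ((1 / 4) ^ k * ms (fun x => wX A w x * (α - et A w x) ^ (k - 1)) (adj A c) ^ 2) * hwc
    rw [e]
    apply mul_le_mul_of_nonneg_left _ (by positivity)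
    have := mul_le_mul_of_nonneg_left h1 (C.Ynn c)
    have := mul_le_mul_of_nonneg_left h2 (C.Xnn c)
    linarith
  refine (Finset.sum_le_sum fun c _ => hc c).trans ?_
  rw [← Finset.mul_sum]
  apply mul_le_mul_of_nonneg_left _ (by positivity)
  rw [Finset.sum_add_distrib, ← Finset.sum_mul, ← Finset.sum_mul, C.sumY]
  have h5 := mul_le_mul_of_nonneg_right hXs (by positivity : 0 ≤ α ^ (k - 1) * Vv)
  have e : α ^ (2 * k) = (α ^ (k - 1)) ^ 2 * α ^ 2 := by
    rw [← pow_mul, ← pow_add]; congr 1; omega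
  rw [e]
  have h6 : (1 - α) * Vv ^ 2 + α * (α - Vv) * Vv ≤ (1 - α) * α ^ 2 := by
    have hq : 0 ≤ (1 - 2 * α) * (α + Vv) + α ^ 2 := by
      have : 0 ≤ 1 - 2 * α := by linarith
      positivity
    have := mul_nonneg (sub_nonneg.2 hV1) hq
    linarith
  have h7 := mul_le_mul_of_nonneg_left h6 (by positivity : 0 ≤ (α ^ (k - 1)) ^ 2)
  linarith

/-- final bound in the case `k = l` -/
theorem final_eq (C : Ctx k k A w M) (Ω : ℝ)
    (hΩ : ∀ α : ℝ, 0 ≤ α → α ≤ 1 → (1 / 2 ^ (2 * k)) * (α * (1 - α) ^ (2 * k) + (1 - α) * α ^ (2 * k)) ≤ Ω) : M ≤ Ω := by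
  have hk2 : 2 ≤ k := by have := C.hm; omega
  have h1 := C.main2 hk2
  have h2 := C.UX_eq
  have ha := C.al_half
  have ha0 := C.al_pos
  refine le_trans ?_ (hΩ (al A w) ha0.le (by linarith))
  have e : (1 : ℝ) / 2 ^ (2 * k) = (1 / 4) ^ k := by
    rw [pow_mul, one_div_pow]; norm_num
  rw [e]
  have h3 : ∑ x, wX A w x * ((1 - al A w - bb A w x) ^ k * bb A w x ^ k) ≤ al A w * ((1 / 4) ^ k * (1 - al A w) ^ (2 * k)) := by
    conv_rhs => unfold al
    rw [Finset.sum_mul]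
    apply Finset.sum_le_sum; intro x _
    apply mul_le_mul_of_nonneg_left _ (C.Xnn x)
    change _ ≤ (1 / 4) ^ k * (1 - al A w) ^ (2 * k)
    rw [pow_mul, ← mul_pow, ← mul_pow]
    have := C.bb_nn x
    have := C.bb_le x
    apply pow_le_pow_left₀
    · apply mul_nonneg <;> linarith
    · nlinarith [sq_nonneg (1 - al A w - 2 * bb A w x)]
  linarith

end Ctx
end P5c
end OS

namespace OS
section P5d
open Classical

variable {V : Type} [Fintype V] {k l : ℕ} {A : V → V → Prop} {w : V → ℝ} {M : ℝ}

theorem J_one (k : ℕ) (hk : 1 ≤ k) : J k 1 = th k / ((k : ℝ) + 1) := by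
  unfold J th
  have : (0 : ℝ) < k := by exact_mod_cast hk
  rw [div_pow, div_div, ← pow_succ]
  push_cast
  simp

theorem th_half (n : ℕ) (hn : 1 ≤ n) : th n ≤ 1 / 2 := by
  have hn' : (0 : ℝ) < n := by exact_mod_cast hn
  unfold th
  have h := one_add_mul_le_pow (a := (1 : ℝ) / n) (by have : (0 : ℝ) < 1 / n := by positivity
                                                      linarith) n
  have e : (n : ℝ) * (1 / n) = 1 := by field_simp
  rw [e] at h
  have e2 : (n : ℝ) / (n + 1) = (1 + 1 / (n : ℝ))⁻¹ := by field_simp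
  rw [e2, inv_pow, show (1 : ℝ) / 2 = 2⁻¹ by norm_num]
  exact inv_anti₀ (by norm_num) (by linarith)

theorem J_step (k : ℕ) (hk : 1 ≤ k) (l : ℕ) : J k l ≤ J (k - 1) l := by
  have hk' : (1 : ℝ) ≤ k := by exact_mod_cast hk
  have h := J_val k l hk 1
  rw [one_pow, mul_one, mul_one, mul_one] at h
  rw [← h]
  have p0 : (0 : ℝ) ≤ k / ((k : ℝ) + l) := by positivity
  have q0 : (0 : ℝ) ≤ l / ((k : ℝ) + l) := by positivity
  have hs : (k : ℝ) / ((k : ℝ) + l) + l / ((k : ℝ) + l) = 1 := by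
    have : (0 : ℝ) < (k : ℝ) + l := by positivity
    field_simp
  have h2 := amgmJ (k - 1) l _ _ 1 p0 q0 hs.le
  rw [one_pow, mul_one] at h2
  refine le_trans ?_ h2
  apply mul_le_mul_of_nonneg_right _ (by positivity)
  exact pow_le_pow_of_le_one p0 (by linarith) (by omega)

theorem claim (m : ℕ) (hm : 6 ≤ m) (α β B s M l0 lam : ℝ) (ha : 0 < α) (hB : 0 ≤ B) (hs : 0 < s)
    (hsB : s * B ≤ β) (hb0 : 0 < β) (hb : β ≤ 1 / 2) (hl0 : 0 < l0) (hll : l0 ≤ lam) (hM0 : 0 ≤ M)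
    (hM1 : M ≤ 0.19 * l0) (hM2 : M ≤ 1.011 * α * l0) (hs2 : 0.65 ≤ s ^ (m + 1)) :
    lam * α ^ m * β - 0.32 * lam * α ^ m * (s * B) + M * B ^ (m + 1) ≤ lam * α ^ m * β ∨
    lam * α ^ m * β - 0.32 * lam * α ^ m * (s * B) + M * B ^ (m + 1) ≤ lam * α * β ^ m := by
  obtain ⟨D, hD⟩ : ∃ D, D = s * B := ⟨_, rfl⟩
  rw [← hD] at hsB ⊢
  have hD0 : 0 ≤ D := by rw [hD]; positivity
  obtain ⟨M', hM'⟩ : ∃ M', M' = M / 0.65 := ⟨_, rfl⟩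
  have hMM : M = 0.65 * M' := by rw [hM']; ring
  have hM'0 : 0 ≤ M' := by rw [hM']; positivity
  have h1 : M * B ^ (m + 1) ≤ M' * D ^ (m + 1) := by
    rw [hD, mul_pow, hMM]
    have : 0 ≤ M' * B ^ (m + 1) := by positivity
    nlinarith
  have hl : 0 < lam := by linarith
  have ham : 0 < α ^ m := by positivity
  by_cases hc : M' * D ^ m ≤ 0.32 * lam * α ^ m
  · left
    have := mul_le_mul_of_nonneg_left hc hD0
    rw [pow_succ D] at h1
    linarith
  · right
    push Not at hc
    have hDm : D ^ m ≤ β ^ m := pow_le_pow_left₀ hD0 hsB m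
    have hc2 : 0.32 * lam * α ^ m < M' * β ^ m := hc.trans_le (mul_le_mul_of_nonneg_left hDm hM'0)
    have h2 : D * (M' * D ^ m - 0.32 * lam * α ^ m) ≤ β * (M' * β ^ m - 0.32 * lam * α ^ m) := by
      apply mul_le_mul hsB _ (by linarith) hb0.le
      have := mul_le_mul_of_nonneg_left hDm hM'0
      linarith
    suffices h3 : 0.68 * lam * α ^ m + M' * β ^ m ≤ lam * α * β ^ (m - 1) by
      have h4 := mul_le_mul_of_nonneg_left h3 hb0.le
      have e : β ^ m = β ^ (m - 1) * β := by rw [← pow_succ]; congr 1; omega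
      rw [pow_succ D] at h1
      have e2 : β * (lam * α * β ^ (m - 1)) = lam * α * β ^ m := by rw [e]; ring
      linarith
    have hM1' : M' ≤ 0.2924 * lam := by rw [hMM] at hM1; linarith
    have hM2' : M' ≤ 1.5554 * α * lam := by
      have : α * l0 ≤ α * lam := by gcongr
      rw [hMM] at hM2; linarith
    have hab : α ≤ β := by
      by_contra hh
      push Not at hh
      have : β ^ m ≤ α ^ m := pow_le_pow_left₀ hb0.le hh.le m
      have := mul_le_mul hM1' this (by positivity) (by positivity)
      nlinarith [mul_pos hl ham]
    by_cases ht : 0.32 * β ≤ α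
    · have e1 : α ^ m ≤ α ^ 3 * β ^ (m - 3) := by
        have : α ^ m = α ^ 3 * α ^ (m - 3) := by rw [← pow_add]; congr 1; omega
        rw [this]; gcongr
      have e2 : β ^ m = β ^ 3 * β ^ (m - 3) := by rw [← pow_add]; congr 1; omega
      have e3 : β ^ (m - 1) = β ^ 2 * β ^ (m - 3) := by rw [← pow_add]; congr 1; omega
      have hp : 0.68 * α ^ 3 + 0.2924 * β ^ 3 ≤ α * β ^ 2 := by
        have q : 0 ≤ (α - 0.32 * β) * (β - α) := mul_nonneg (by linarith) (by linarith)
        have q2 := mul_nonneg q (by linarith : 0 ≤ α + 1.32 * β)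
        -- chord: α^3 ≤ (1.32^2 - .32) αβ² ...
        nlinarith [mul_nonneg (sq_nonneg β) (by linarith : 0 ≤ α - 0.32 * β), mul_nonneg (sq_nonneg β) (by linarith : 0 ≤ β - α)]
      have hb3 : 0 < β ^ (m - 3) := by positivity
      have h5 := mul_le_mul_of_nonneg_left hp (mul_pos hl hb3).le
      have h6 := mul_le_mul_of_nonneg_left e1 (by positivity : 0 ≤ 0.68 * lam)
      have h7 := mul_le_mul_of_nonneg_right hM1' (by positivity : 0 ≤ β ^ 3 * β ^ (m - 3))
      rw [e2, e3]
      linarith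
    · push Not at ht
      have e0 : α ^ m = α * (α * α ^ (m - 2)) := by rw [← pow_succ', ← pow_succ']; congr 1; omega
      have e1 : β ^ m = β * (β * β ^ (m - 2)) := by rw [← pow_succ', ← pow_succ']; congr 1; omega
      have e2 : β ^ (m - 1) = β * β ^ (m - 2) := by rw [← pow_succ']; congr 1; omega
      have h5 : α * α ^ (m - 2) ≤ 0.32 * β * β ^ (m - 2) := by gcongr
      have h6 := mul_le_mul_of_nonneg_left h5 (by positivity : 0 ≤ 0.68 * lam * α)
      have h7 : M' * β ≤ 0.7777 * α * lam := by
        have := mul_le_mul hM2' hb hb0.le (by positivity)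
        linarith
      have h8 := mul_le_mul_of_nonneg_right h7 (by positivity : 0 ≤ β * β ^ (m - 2))
      have h9 : 0 ≤ lam * α * (β * β ^ (m - 2)) := by positivity
      rw [e0, e1, e2]
      linarith

noncomputable def kp (k : ℕ) : ℝ := 1 / (4 * (k : ℝ))
noncomputable def isB (k : ℕ) (A : V → V → Prop) (w : V → ℝ) (y : V) : Prop :=
  (1 - kp k) * al A w ≤ ms (wX A w) (fun v => A y v)
noncomputable def wB (k : ℕ) (A : V → V → Prop) (w : V → ℝ) (y : V) : ℝ := if isB k A w y then wY A w y else 0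
noncomputable def wN (k : ℕ) (A : V → V → Prop) (w : V → ℝ) (y : V) : ℝ := if isB k A w y then 0 else wY A w y

theorem wNB (v : V) : wY A w v = wN k A w v + wB k A w v := by
  unfold wN wB; split_ifs <;> simp
theorem wNBf : wY A w = fun v => wN k A w v + wB k A w v := funext wNB
theorem wNBd (v : V) : wN k A w v = 0 ∨ wB k A w v = 0 := by
  unfold wN wB; split_ifs <;> simp
theorem wN_ne {v : V} (h : wN k A w v ≠ 0) : wY A w v ≠ 0 ∧ ¬ isB k A w v := by
  unfold wN at h; split_ifs at h with h1
  · simp at h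
  · exact ⟨h, h1⟩
theorem wB_ne {v : V} (h : wB k A w v ≠ 0) : wY A w v ≠ 0 ∧ isB k A w v := by
  unfold wB at h; split_ifs at h with h1
  · exact ⟨h, h1⟩
  · simp at h

namespace Ctx

theorem Nnn (C : Ctx k l A w M) (v : V) : 0 ≤ wN k A w v := by
  unfold wN; split_ifs; exacts [le_rfl, C.Ynn v]
theorem Bnn (C : Ctx k l A w M) (v : V) : 0 ≤ wB k A w v := by
  unfold wB; split_ifs; exacts [C.Ynn v, le_rfl]

theorem k5 (C : Ctx k 1 A w M) : (5 : ℝ) ≤ k := by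
  have := C.hm; exact_mod_cast (by omega : 5 ≤ k)
theorem lam_lo (C : Ctx k 1 A w M) : 0.3678 ≤ J (k - 1) 1 * k := by
  have h5 := C.k5
  have : 5 ≤ k := by exact_mod_cast h5
  rw [J_one _ (by omega), Nat.cast_sub (by omega)]
  have := th_ge (k - 1) (by omega)
  push_cast
  rw [sub_add_cancel, div_mul_cancel₀ _ (by linarith)]; exact this
theorem lam_hi (C : Ctx k 1 A w M) : J (k - 1) 1 * k ≤ 1 / 2 := by
  have h5 := C.k5
  have : 5 ≤ k := by exact_mod_cast h5
  rw [J_one _ (by omega), Nat.cast_sub (by omega)]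
  have := th_half (k - 1) (by omega)
  push_cast
  rw [sub_add_cancel, div_mul_cancel₀ _ (by linarith)]; exact this
theorem kp_mul (C : Ctx k 1 A w M) : kp k * k = 1 / 4 := by
  have h5 := C.k5
  unfold kp; field_simp
theorem kp_pos (C : Ctx k 1 A w M) : 0 < kp k := by
  have h5 := C.k5
  unfold kp; positivity
theorem kp_lo (C : Ctx k 1 A w M) : 0.5 * J (k - 1) 1 ≤ kp k := by
  have h5 := C.k5; have := C.lam_hi; have := C.kp_mul
  by_contra h; push Not at h; nlinarith
theorem kp_hi (C : Ctx k 1 A w M) : kp k ≤ 0.68 * J (k - 1) 1 := by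
  have h5 := C.k5; have := C.lam_lo; have := C.kp_mul
  by_contra h; push Not at h; nlinarith
theorem kp_20 (C : Ctx k 1 A w M) : kp k ≤ 1 / 20 := by
  have h5 := C.k5; have := C.kp_mul
  by_contra h; push Not at h; nlinarith

theorem UX_one (C : Ctx k 1 A w M) : ∑ c, w c * Zp A c (fun _ : Lf k 1 => wX A w) ≤
    ∑ u, wX A w u * (J (k - 1) 1 * al A w ^ k * bh k 1 (al A w) (bb A w u) - 0.32 * J (k - 1) 1 * al A w ^ k * ms (wB k A w) (fun c => A c u)) := by
  have hJ := (J_pos (k - 1) 1).le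
  have hκ := C.kp_pos.le
  have ha := C.al_pos
  have hr : ∀ u, 0 ≤ al A w - et A w u := fun u => by linarith [C.et_le u]
  have h1 : ∀ c, w c * Zp A c (fun _ : Lf k 1 => wX A w) ≤
      (wX A w c + wN k A w c) * (∑ u, (if A c u then wX A w u else 0) * (J (k - 1) 1 * (al A w - et A w u) ^ k)) +
      wB k A w c * (∑ u, (if A c u then wX A w u else 0) * (kp k * al A w * (al A w - et A w u) ^ (k - 1))) := by
    intro c
    have e : w c * Zp A c (fun _ : Lf k 1 => wX A w) = (wX A w c + wN k A w c) * Zp A c (fun _ : Lf k 1 => wX A w) + wB k A w c * Zp A c (fun _ : Lf k 1 => wX A w) := by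
      have := wXY (A := A) (w := w) c
      have := wNB (k := k) (A := A) (w := w) c
      rw [← add_mul]; congr 1; linarith
    rw [e]
    apply add_le_add
    · apply mul_le_mul_of_nonneg_left _ (add_nonneg (C.Xnn c) (C.Nnn c))
      refine (C.ZXout c).trans ?_
      apply Finset.sum_le_sum; intro u _
      apply mul_le_mul_of_nonneg_left
      · exact C.pq_le c u
      · split_ifs; exacts [C.Xnn u, le_rfl]
    · apply mul_le_of_ne (C.Bnn c); intro hc
      have hB : (1 - kp k) * al A w ≤ ms (wX A w) (fun v => A c v) := (wB_ne hc).2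
      refine (C.ZXout c).trans ?_
      apply Finset.sum_le_sum; intro u _
      apply mul_le_mul_of_nonneg_left
      · have q1 : ms (wX A w) (fun v => A v c ∧ ¬ adj A u v) ≤ kp k * al A w := by
          have t1 : ms (wX A w) (fun v => A v c ∧ ¬ adj A u v) ≤ ms (wX A w) (fun v => A v c) := ms_mono C.Xnn (fun _ => le_rfl) (fun v h => h.1)
          have t2 := ms_adj A C.ori c (wX A w)
          have t3 : ms (wX A w) (adj A c) ≤ al A w := C.et_le c
          linarith
        have q2 : ms (wX A w) (fun v => A c v ∧ ¬ adj A u v) ≤ al A w - et A w u := by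
          refine le_trans ?_ (C.et_sub c u)
          exact ms_mono C.Xnn (fun _ => le_rfl) (fun v h => ⟨Or.inl h.1, h.2⟩)
        rw [pow_one, mul_comm]
        apply mul_le_mul q1 (pow_le_pow_left₀ (ms_nonneg C.Xnn _) q2 _) (pow_nonneg (ms_nonneg C.Xnn _) _) (by positivity)
      · split_ifs; exacts [C.Xnn u, le_rfl]
  refine (Finset.sum_le_sum fun c _ => h1 c).trans ?_
  rw [Finset.sum_add_distrib, swap_out, swap_out, ← Finset.sum_add_distrib]
  apply Finset.sum_le_sum; intro u _
  rw [mul_assoc, mul_assoc (wX A w u), ← mul_add]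
  apply mul_le_mul_of_nonneg_left _ (C.Xnn u)
  obtain ⟨b1, hb1⟩ : ∃ b1, b1 = ms (wN k A w) (fun c => A c u) := ⟨_, rfl⟩
  obtain ⟨b2, hb2⟩ : ∃ b2, b2 = ms (wB k A w) (fun c => A c u) := ⟨_, rfl⟩
  have e1 : ms (fun c => wX A w c + wN k A w c) (fun c => A c u) = ms (wX A w) (fun c => A c u) + b1 := by
    rw [hb1, ← ms_add]
  have e2 : bb A w u = b1 + b2 := by
    unfold bb; rw [hb1, hb2, ← ms_add, ← wNBf]
  rw [e1, ← hb2]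
  have hb1n : 0 ≤ b1 := by rw [hb1]; exact ms_nonneg C.Nnn _
  have hb2n : 0 ≤ b2 := by rw [hb2]; exact ms_nonneg C.Bnn _
  have hx := C.inX u
  have hbh := bh_ge k 1 (al A w) (bb A w u)
  have hlow := C.bh_low u
  obtain ⟨h, hh⟩ : ∃ h, h = bh k 1 (al A w) (bb A w u) := ⟨_, rfl⟩
  rw [← hh] at hbh hlow ⊢
  obtain ⟨η, hη⟩ : ∃ η, η = et A w u := ⟨_, rfl⟩
  have hη0 := C.et_nn u
  have hη1 := C.et_le u
  rw [← hη] at hx hη0 hη1 ⊢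
  have hkl := C.kp_lo
  have hkh := C.kp_hi
  have hk5 := C.k5
  have hstepC := C.stepC
  have hip := C.im_pos
  set α := al A w
  set lam := J (k - 1) 1
  have hlam : 0 < lam := J_pos _ _
  have hcast : ((k - 1 : ℕ) : ℝ) = k - 1 := by
    rw [Nat.cast_sub C.hk]; simp
  obtain ⟨N, hN⟩ : ∃ N, N = lam * (h - b2) + kp k * b2 := ⟨_, rfl⟩
  have hN2 : 0.5 * lam * h ≤ N := by
    rw [hN]
    have : 0 ≤ h - b2 := by linarith
    nlinarith [mul_nonneg hlam.le this, mul_le_mul_of_nonneg_right hkl hb2n]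
  have hN0 : 0 ≤ N := le_trans (mul_nonneg (by positivity) (by linarith)) hN2
  have hbn := bern (k - 1) N lam η α hη0 hη1 hN0 (by
    rw [hcast]
    have t1 : α * lam ≤ im k 1 * lam := mul_le_mul_of_nonneg_right hstepC hlam.le
    have t2 : 0.5 * lam * (5 / 6 * im k 1) ≤ N := le_trans (mul_le_mul_of_nonneg_left hlow (by positivity)) hN2
    have t3 : 4 * N ≤ (k - 1) * N := mul_le_mul_of_nonneg_right (by linarith) hN0
    have : 0 < lam * im k 1 := by positivity
    linarith)
  have ek : ∀ z : ℝ, z ^ k = z * z ^ (k - 1) := fun z => by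
    rw [← pow_succ']; congr 1; have := C.hk; omega
  have hη2 : 0 ≤ α - η := by linarith
  have hP : 0 ≤ (α - η) ^ (k - 1) := by positivity
  have key : lam * (α - η) * (ms (wX A w) (fun c => A c u) + b1) + kp k * α * b2 ≤ α * (N + lam * η) := by
    have t1 : lam * (α - η) * (ms (wX A w) (fun c => A c u) + b1) ≤ lam * α * (η + (h - b2)) := by
      apply mul_le_mul
      · apply mul_le_mul_of_nonneg_left _ hlam.le; linarith
      · linarith
      · have := ms_nonneg C.Xnn (fun c => A c u); linarith
      · positivity
    rw [hN]; linarith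
  have k2 := mul_le_mul_of_nonneg_right key hP
  have k3 := mul_le_mul_of_nonneg_left hbn ha.le
  have k4 : N * α ^ k ≤ lam * α ^ k * h - 0.32 * lam * α ^ k * b2 := by
    have : N ≤ lam * h - 0.32 * lam * b2 := by rw [hN]; nlinarith
    have := mul_le_mul_of_nonneg_right this (by positivity : 0 ≤ α ^ k)
    linarith
  refine le_trans ?_ k4
  rw [ek (α - η), ek α]
  linarith

theorem mainone (C : Ctx k 1 A w M) :
    M ≤ ∑ c, w c * Zp A c (fun _ : Lf k 1 => wX A w) +
      ∑ x, wX A w x * ((1 - al A w - bb A w x) ^ k * bb A w x ^ 1) + M * (∑ v, wB k A w v) ^ (k + 1 + 1) := by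
  have hJ := C.Jp
  have hL := (Lam1_pos k 1).le
  have hip := C.im_pos
  have hm := C.hm
  refine C.combine (fun x => eO A w x) (M * (∑ v, wB k A w v) ^ (k + 1 + 1)) ((J k 1 + Lam1 k 1) * im k 1 ^ (k + 1 - 1)) (∑ u, wN k A w u * be A w u) (kp k)
    (fun x hx => C.lossO x hx) ?_ (Finset.sum_nonneg fun u _ => mul_nonneg (C.Nnn u) (C.be_nn u)) ?_ ?_
  · have h0 : ∀ c, wY A w c * Zp A c (fun _ : Lf k 1 => wY A w) ≤ wB k A w c * Zp A c (fun _ : Lf k 1 => wB k A w) +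
        (J k 1 * im k 1 ^ (k + 1 - 1) * (wN k A w c * be A w c) + wB k A w c * (Lam1 k 1 * im k 1 ^ (k + 1 - 1) * ms (wN k A w) (adj A c))) := by
      intro c
      have e : wY A w c * Zp A c (fun _ : Lf k 1 => wY A w) = wN k A w c * Zp A c (fun _ : Lf k 1 => wY A w) + wB k A w c * Zp A c (fun _ : Lf k 1 => wY A w) := by
        rw [← add_mul, ← wNB]
      rw [e]
      have t1 : wN k A w c * Zp A c (fun _ : Lf k 1 => wY A w) ≤ wN k A w c * (J k 1 * im k 1 ^ (k + 1 - 1) * be A w c) := by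
        apply mul_le_of_ne (C.Nnn c); intro hc
        have h1 : Zp A c (fun _ : Lf k 1 => wY A w) ≤ J k 1 * be A w c ^ (k + 1) := Z0J A C.ori c (wY A w) C.Ynn
        refine h1.trans ?_
        have hb := C.be_nn c
        have h3 : be A w c ^ (k + 1) = be A w c ^ (k + 1 - 1) * be A w c := by
          rw [← pow_succ]; congr 1
        rw [h3, mul_assoc]
        have := pow_le_pow_left₀ hb (C.stepD c (wN_ne hc).1) (k + 1 - 1)
        gcongr
      have t2 : wB k A w c * Zp A c (fun _ : Lf k 1 => wY A w) ≤ wB k A w c * (Zp A c (fun _ : Lf k 1 => wB k A w) + Lam1 k 1 * im k 1 ^ (k + 1 - 1) * ms (wN k A w) (adj A c)) := by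
        apply mul_le_of_ne (C.Bnn c); intro hc
        have hs := split1 (k := k) (l := 1) A c (wN k A w) (wB k A w) C.Nnn C.Bnn wNBd
        rw [← wNBf] at hs
        refine hs.trans ?_
        apply add_le_add le_rfl
        refine (Z1sum A C.ori C.hk C.hl c _ _ C.Ynn C.Nnn).trans ?_
        rw [mul_assoc]
        apply mul_le_mul_of_nonneg_left _ hL
        unfold ms
        rw [Finset.mul_sum]
        apply Finset.sum_le_sum; intro u _
        split_ifs
        · rw [mul_comm]
          apply mul_le_mul_of_nonneg_right _ (C.Nnn u)
          apply pow_le_pow_left₀ (ms_nonneg C.Ynn (fun v => adj A c v ∧ ¬ adj A u v))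
          refine le_trans ?_ (C.stepD c (wB_ne hc).1)
          exact ms_mono C.Ynn (fun _ => le_rfl) (fun v h => h.1)
        · simp
      linarith
    refine (Finset.sum_le_sum fun c _ => h0 c).trans ?_
    rw [Finset.sum_add_distrib, Finset.sum_add_distrib, ← Finset.mul_sum]
    have t3 := C.hom (wB k A w) C.Bnn
    unfold sW at t3
    have t4 : ∑ c, wB k A w c * (Lam1 k 1 * im k 1 ^ (k + 1 - 1) * ms (wN k A w) (adj A c)) ≤ Lam1 k 1 * im k 1 ^ (k + 1 - 1) * ∑ u, wN k A w u * be A w u := by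
      have e : ∑ c, wB k A w c * (Lam1 k 1 * im k 1 ^ (k + 1 - 1) * ms (wN k A w) (adj A c)) = Lam1 k 1 * im k 1 ^ (k + 1 - 1) * ∑ c, wB k A w c * ms (wN k A w) (adj A c) := by
        rw [Finset.mul_sum]; exact Finset.sum_congr rfl fun c _ => by ring
      rw [e]
      apply mul_le_mul_of_nonneg_left _ (by positivity)
      rw [swap_adj]
      apply Finset.sum_le_sum; intro u _
      apply mul_le_mul_of_nonneg_left _ (C.Nnn u)
      exact ms_mono C.Ynn (fun v => by have := wNB (k := k) (A := A) (w := w) v; have := C.Nnn v; linarith) (fun v h => h)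
    linarith
  · have hL1 := C.L1
    have hE := C.stepE
    have hi := C.im_le
    have i1 : im k 1 ^ (k + 1 - 1) ≤ im k 1 ^ 5 := inv_pow_le (k + 1) 1 5 C.hm (by omega)
    have hmul := C.im_mul
    have hkm := C.kp_mul
    have hk5 := C.k5
    have ha := C.al_pos
    have hca := C.mcast
    rw [hca] at hL1 hE hmul
    push_cast at hL1 hE hmul
    have hJi : (J k 1 + Lam1 k 1) * im k 1 ^ (k + 1 - 1) ≤ J k 1 * ((1 + 2.72 * (k + 1)) * im k 1 ^ 5) := by
      have : J k 1 + Lam1 k 1 ≤ J k 1 * (1 + 2.72 * (k + 1)) := by linarith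
      have := mul_le_mul this i1 (by positivity) (by positivity)
      linarith
    refine hJi.trans ?_
    rw [mul_comm (0.36 : ℝ), mul_assoc]
    apply mul_le_mul_of_nonneg_left _ hJ.le
    -- (1+2.72m) im^5 ≤ .36 κ α
    set i := im k 1
    have s1 : (1 + 2.72 * ((k : ℝ) + 1)) * i ^ 5 = (i + 2.72) * i ^ 4 := by
      have : (1 + 2.72 * ((k : ℝ) + 1)) * i = i + 2.72 := by linarith
      linear_combination i ^ 4 * this
    rw [s1]
    -- multiply by 4k(m+1)
    have s2 : 0.95 ≤ kp k * al A w * (4 * k * (k + 1 + 1)) := by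
      have : kp k * al A w * (4 * k * (k + 1 + 1)) = 4 * (kp k * k) * (al A w * (k + 1 + 1)) := by ring
      rw [this, hkm]; linarith
    have s3 : (i + 2.72) * i ^ 4 * (4 * k * (k + 1 + 1)) ≤ 0.36 * 0.95 := by
      have a1 : (4 * k * ((k : ℝ) + 1 + 1)) * i ^ 2 ≤ 4 := by
        have : (i * ((k : ℝ) + 1)) ^ 2 = 1 := by rw [hmul]; norm_num
        nlinarith [sq_nonneg i]
      have a2 : i ^ 2 ≤ 1 / 36 := by nlinarith
      have a3 : (i + 2.72) * i ^ 2 ≤ (1 / 6 + 2.72) * (1 / 36) := mul_le_mul (by linarith) a2 (by positivity) (by norm_num)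
      have a4 := mul_le_mul a3 a1 (by positivity) (by norm_num)
      nlinarith
    have hp : (0 : ℝ) < 4 * k * (k + 1 + 1) := by positivity
    by_contra hcon
    push Not at hcon
    have := mul_lt_mul_of_pos_right hcon hp
    nlinarith
  · -- κ α S ≤ ...
    have h1 : ∀ u, wN k A w u * (kp k * al A w) ≤ wN k A w u * ms (wX A w) (fun x => ¬ A u x) := by
      intro u
      apply mul_le_of_ne (C.Nnn u); intro hu
      have h2 := (wN_ne hu).2
      unfold isB at h2
      push Not at h2
      have h3 := ms_not (wX A w) (fun x => A u x)
      have h4 : al A w = ∑ v, wX A w v := rfl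
      linarith
    have h5 : kp k * al A w * ∑ u, wN k A w u * be A w u ≤ ∑ u, wY A w u * be A w u * ms (wX A w) (fun x => ¬ A u x) := by
      rw [Finset.mul_sum]
      apply Finset.sum_le_sum; intro u _
      have h6 := mul_le_mul_of_nonneg_right (h1 u) (C.be_nn u)
      have h7 : wN k A w u ≤ wY A w u := by have := wNB (k := k) (A := A) (w := w) u; have := C.Bnn u; linarith
      have h8 := mul_le_mul_of_nonneg_right h7 (mul_nonneg (C.be_nn u) (ms_nonneg C.Xnn (fun x => ¬ A u x)))
      linarith
    refine h5.trans ?_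
    have e : ∑ u, wY A w u * be A w u * ms (wX A w) (fun x => ¬ A u x) = ∑ x, wX A w x * (∑ u, pO A (wY A w) x u * be A w u + ∑ u, pN A (wY A w) x u * be A w u) := by
      unfold ms
      simp_rw [Finset.mul_sum]
      rw [Finset.sum_comm]
      refine Finset.sum_congr rfl fun x _ => ?_
      rw [← Finset.sum_add_distrib, Finset.mul_sum]
      refine Finset.sum_congr rfl fun u _ => ?_
      unfold pO pN
      have ho := C.ori u x
      by_cases q1 : A u x
      · have q2 := ho q1
        have q3 : adj A x u := Or.inr q1
        simp [q1, q2, q3]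
      · by_cases q2 : A x u
        · have q3 : adj A x u := Or.inl q2
          simp [q1, q2, q3]; ring
        · have q3 : ¬ adj A x u := fun h => h.elim q2 q1
          simp [q1, q2, q3]; ring
    rw [e]
    apply Finset.sum_le_sum; intro x _
    apply mul_le_mul_of_nonneg_left _ (C.Xnn x)
    have := C.out_sum x
    have := C.nonadj_sum x
    linarith

theorem bh_half (C : Ctx k 1 A w M) (x : V) (hx : wX A w x ≠ 0) : bh k 1 (al A w) (bb A w x) ≤ 1 / 2 := by
  have hk5 := C.k5
  have ha := C.al_pos
  unfold bh
  apply max_le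
  · by_contra hc
    push Not at hc
    have hP := C.Pge x hx
    rw [J_one k C.hk, pow_one] at hP
    have ht := th_ge k C.hk
    have ha0 := C.aa_nn x
    have h1 := C.abd x
    have h2 := C.de_nn x
    have e : aa A w x ^ k = aa A w x ^ (k - 1) * aa A w x := by
      rw [← pow_succ]; congr 1; have := C.hk; omega
    have h3 : aa A w x ^ (k - 1) ≤ (1 / 2) ^ (k - 1) := pow_le_pow_left₀ ha0 (by linarith) _
    have h4 : aa A w x * bb A w x ≤ 1 / 4 := by nlinarith [sq_nonneg (aa A w x - bb A w x)]
    have h5 : aa A w x ^ k * bb A w x ≤ (1 / 2) ^ (k + 1) := by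
      have e2 : ((1 : ℝ) / 2) ^ (k + 1) = (1 / 2) ^ (k - 1) * (1 / 4) := by
        have : k + 1 = (k - 1) + 2 := by have := C.hk; omega
        rw [this, pow_add]; norm_num
      rw [e, e2, mul_assoc]
      have := C.bb_nn x
      exact mul_le_mul h3 h4 (by positivity) (by positivity)
    have h6 := (pow2 (k + 1) C.hm).2
    have h7 : (0 : ℝ) < 2 ^ (k + 1) := by positivity
    have h8 : ((1 : ℝ) / 2) ^ (k + 1) * 2 ^ (k + 1) = 1 := by rw [← mul_pow]; norm_num
    have h9 : 0.36 * (th k / ((k : ℝ) + 1)) ≤ (1 / 2) ^ (k + 1) := hP.trans h5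
    have h10 : 0.36 * th k ≤ (1 / 2) ^ (k + 1) * (k + 1) := by
      have := mul_le_mul_of_nonneg_right h9 (by positivity : (0 : ℝ) ≤ k + 1)
      have e3 : 0.36 * (th k / ((k : ℝ) + 1)) * (k + 1) = 0.36 * th k := by field_simp
      linarith
    push_cast at h6
    have h11 : ((1 : ℝ) / 2) ^ (k + 1) * (64 * ((k : ℝ) + 1)) ≤ (1 / 2) ^ (k + 1) * (6 * 2 ^ (k + 1)) :=
      mul_le_mul_of_nonneg_left h6 (by positivity)
    linarith
  · have : ((1 : ℕ) : ℝ) / ((k : ℝ) + (1 : ℕ)) ≤ 1 / 2 := by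
      push_cast; apply one_div_le_one_div_of_le <;> linarith
    have h1 := C.al_half
    have h0 : 0 ≤ ((1 : ℕ) : ℝ) / ((k : ℝ) + (1 : ℕ)) := by positivity
    nlinarith

/-- final bound in the case `l = 1` -/
theorem final_one (C : Ctx k 1 A w M) (Ω : ℝ)
    (hΩ : ∀ α d : ℝ, 0 ≤ α → α ≤ 1 / 2 → 0 ≤ d → d ≤ (k : ℝ) / ((k : ℝ) + (1 : ℕ)) → Fo k 1 α d ≤ Ω) : M ≤ Ω := by
  have h1 := C.mainone
  have h2 := C.UX_one
  have ha := C.al_half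
  have ha0 := C.al_pos
  have hk5 := C.k5
  have hJp := C.Jp
  have hlp := J_pos (k - 1) 1
  have hstep := J_step k C.hk 1
  have hip := C.im_pos
  have hkp := C.kp_pos
  have hk20 := C.kp_20
  have hkm := C.kp_mul
  set α := al A w with hα
  set lam := J (k - 1) 1 with hlam
  obtain ⟨h, hh⟩ : ∃ h : V → ℝ, ∀ x, h x = bh k 1 α (bb A w x) := ⟨_, fun _ => rfl⟩
  simp_rw [← hh] at h2
  have hlow : ∀ x, 5 / 6 * im k 1 ≤ h x := fun x => by rw [hh]; exact C.bh_low x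
  have hge : ∀ x, bb A w x ≤ h x := fun x => by rw [hh]; exact bh_ge _ _ _ _
  have hle : ∀ x, h x ≤ 1 - α := fun x => by rw [hh]; exact bh_le _ _ C.hk _ _ (by linarith) (C.bb_le x)
  have hhalf : ∀ x, wX A w x ≠ 0 → h x ≤ 1 / 2 := fun x hx => by rw [hh]; exact C.bh_half x hx
  have hh0 : ∀ x, 0 ≤ h x := fun x => le_trans (by positivity) (hlow x)
  obtain ⟨β, hβ⟩ : ∃ β, β = (∑ x, wX A w x * h x) / α := ⟨_, rfl⟩
  have hβs : ∑ x, wX A w x * h x = α * β := by rw [hβ]; field_simp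
  have hsum : ∑ x, wX A w x = α := rfl
  have hβ0 : 0 < β := by
    have : α * (5 / 6 * im k 1) ≤ α * β := by
      rw [← hβs, ← hsum, Finset.sum_mul]
      exact Finset.sum_le_sum fun x _ => mul_le_mul_of_nonneg_left (hlow x) (C.Xnn x)
    have := le_of_mul_le_mul_left this ha0
    have : 0 < 5 / 6 * im k 1 := by positivity
    linarith
  have hβ1 : β ≤ 1 / 2 := by
    have : α * β ≤ α * (1 / 2) := by
      rw [← hβs, ← hsum, Finset.sum_mul]
      exact Finset.sum_le_sum fun x _ => mul_le_of_ne (C.Xnn x) (hhalf x)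
    exact le_of_mul_le_mul_left this ha0
  obtain ⟨B, hB⟩ : ∃ B, B = ∑ v, wB k A w v := ⟨_, rfl⟩
  rw [← hB] at h1
  have hB0 : 0 ≤ B := by rw [hB]; exact Finset.sum_nonneg fun v _ => C.Bnn v
  obtain ⟨Q, hQ⟩ : ∃ Q, Q = ∑ u, wX A w u * ms (wB k A w) (fun c => A c u) := ⟨_, rfl⟩
  have hQ1 : Q = ∑ c, wB k A w c * ms (wX A w) (fun v => A c v) := by
    rw [hQ]
    have := swap_out (A := A) (wB k A w) (wX A w) (fun _ => 1)
    simp only [mul_one] at this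
    rw [← this]
    refine Finset.sum_congr rfl fun c _ => ?_
    unfold ms
    congr 1
  have hQ2 : α * ((1 - kp k) * B) ≤ Q := by
    rw [hQ1, hB, Finset.mul_sum, Finset.mul_sum]
    apply Finset.sum_le_sum; intro c _
    have := mul_le_of_ne (C.Bnn c) (fun hc => (show (1 - kp k) * al A w ≤ ms (wX A w) (fun v => A c v) from (wB_ne hc).2))
    rw [← hα] at this
    linarith
  have hQ3 : Q ≤ α * β := by
    rw [hQ, ← hβs]
    apply Finset.sum_le_sum; intro u _
    apply mul_le_mul_of_nonneg_left _ (C.Xnn u)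
    refine le_trans ?_ (hge u)
    exact ms_mono C.Ynn (fun v => by have := wNB (k := k) (A := A) (w := w) v; have := C.Nnn v; linarith) (fun v h => h)
  have hsB : (1 - kp k) * B ≤ β := le_of_mul_le_mul_left (hQ2.trans hQ3) ha0
  have h3 : ∑ c, w c * Zp A c (fun _ : Lf k 1 => wX A w) ≤ lam * α ^ (k + 1) * β - 0.32 * lam * α ^ (k + 1) * ((1 - kp k) * B) := by
    have e : ∑ u, wX A w u * (lam * α ^ k * h u - 0.32 * lam * α ^ k * ms (wB k A w) (fun c => A c u)) = lam * α ^ k * (α * β) - 0.32 * lam * α ^ k * Q := by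
      rw [← hβs, hQ, Finset.mul_sum, Finset.mul_sum, ← Finset.sum_sub_distrib]
      exact Finset.sum_congr rfl fun u _ => by ring
    rw [e] at h2
    have := mul_le_mul_of_nonneg_left hQ2 (by positivity : 0 ≤ 0.32 * lam * α ^ k)
    rw [pow_succ]
    linarith
  have hM0 : 0 ≤ M := by rw [C.hM]; exact sW_nonneg A w C.nn
  have hM2 : M ≤ 1.011 * α * J k 1 := by
    have t := C.M_le (J k 1) (fun x _ => C.scX_le x)
    have t2 := NE (k + 1) C.hm
    have t3 := C.stepE
    rw [← hα] at t t3
    have t4 : (2 / ((k + 1 : ℕ) : ℝ)) ^ (k + 1) ≤ 0.011 * α := by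
      have hp : (0 : ℝ) < ((k + 1 : ℕ) : ℝ) + 1 := by positivity
      by_contra hcon
      push Not at hcon
      have := mul_lt_mul_of_pos_left hcon hp
      linarith
    have := mul_le_mul_of_nonneg_left t4 hJp.le
    linarith
  have hs2 : 0.65 ≤ (1 - kp k) ^ (k + 1 + 1) := by
    have t := one_add_mul_le_pow (a := -kp k) (by linarith) (k + 1 + 1)
    rw [← sub_eq_add_neg] at t
    refine le_trans ?_ t
    push_cast
    nlinarith
  have hcl := claim (k + 1) C.hm α β B (1 - kp k) M (J k 1) lam ha0 hB0 (by linarith) hsB hβ0 hβ1 hJp hstep hM0 C.stepF hM2 hs2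
  rcases hcl with hcl | hcl
  · refine le_trans ?_ (C.sum_le_Om (fun x => (1 - α - bb A w x) ^ k * bb A w x ^ 1 + lam * α ^ (k + 1 - 1) * h x) Ω
      (fun x _ => by rw [hh]; exact FA k 1 C.hk Ω hΩ α (bb A w x) ha0.le (by linarith) (C.bb_nn x) (C.bb_le x)))
    have e : ∑ x, wX A w x * ((1 - α - bb A w x) ^ k * bb A w x ^ 1 + lam * α ^ (k + 1 - 1) * h x) =
        ∑ x, wX A w x * ((1 - α - bb A w x) ^ k * bb A w x ^ 1) + lam * α ^ (k + 1) * β := by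
      have : lam * α ^ (k + 1) * β = lam * α ^ k * (α * β) := by rw [pow_succ]; ring
      rw [this, ← hβs, Finset.mul_sum, ← Finset.sum_add_distrib, Nat.add_sub_cancel]
      exact Finset.sum_congr rfl fun u _ => by ring
    rw [e]
    linarith
  · refine le_trans ?_ (C.sum_le_Om (fun x => (1 - α - h x) ^ k * h x ^ 1 + lam * h x ^ (k + 1)) Ω
      (fun x hx => ?_))
    · have e : ∑ x, wX A w x * ((1 - α - h x) ^ k * h x ^ 1 + lam * h x ^ (k + 1)) =
          ∑ x, wX A w x * ((1 - α - h x) ^ k * h x ^ 1) + lam * ∑ x, wX A w x * h x ^ (k + 1) := by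
        rw [Finset.mul_sum, ← Finset.sum_add_distrib]
        exact Finset.sum_congr rfl fun u _ => by ring
      rw [e]
      have t1 : ∑ x, wX A w x * ((1 - α - bb A w x) ^ k * bb A w x ^ 1) ≤ ∑ x, wX A w x * ((1 - α - h x) ^ k * h x ^ 1) := by
        apply Finset.sum_le_sum; intro x _
        apply mul_le_mul_of_nonneg_left _ (C.Xnn x)
        rw [hh]
        exact gmono k 1 C.hk α (bb A w x) (by linarith) (C.bb_nn x) (C.bb_le x)
      have t2 : α * β ^ (k + 1) ≤ ∑ x, wX A w x * h x ^ (k + 1) := by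
        have j := Real.pow_arith_mean_le_arith_mean_pow Finset.univ (fun x => wX A w x / α) h
          (fun x _ => div_nonneg (C.Xnn x) ha0.le) (by rw [← Finset.sum_div, hsum]; exact div_self ha0.ne') (fun x _ => hh0 x) (k + 1)
        have e1 : ∑ x, wX A w x / α * h x = β := by
          rw [hβ, Finset.sum_div]; exact Finset.sum_congr rfl fun u _ => by ring
        have e2 : ∑ x, wX A w x / α * h x ^ (k + 1) = (∑ x, wX A w x * h x ^ (k + 1)) / α := by
          rw [Finset.sum_div]; exact Finset.sum_congr rfl fun u _ => by ring
        rw [e1, e2, le_div_iff₀ ha0] at j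
        linarith
      have := mul_le_mul_of_nonneg_left t2 hlp.le
      linarith
    · have f := FA k 1 C.hk Ω hΩ (h x) α (hh0 x) (hhalf x hx) ha0.le (by linarith [hle x])
      refine le_trans ?_ f
      have g1 := bh_ge k 1 (h x) α
      have g2 : h x * (lam * h x ^ (k + 1 - 1) * α) ≤ h x * (lam * h x ^ (k + 1 - 1) * bh k 1 (h x) α) := by
        have := hh0 x
        gcongr
      have e1 : 1 - h x - α = 1 - α - h x := by ring
      rw [e1]
      rw [Nat.add_sub_cancel] at g2 ⊢
      rw [pow_one, pow_one, pow_succ]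
      linarith

end Ctx
end P5d
end OS

namespace OS
section P5e
open Classical

variable {V : Type} [Fintype V] {k l : ℕ} {A : V → V → Prop}

/-- positions of the leaves -/
def pos (j : Lf k l) : Fin (k + l + 1) := Fin.succ (finSumFinEquiv j)

theorem pos_inl (a : Fin k) : (pos (Sum.inl a : Lf k l)).val = a.val + 1 := by
  simp [pos]
theorem pos_inr (b : Fin l) : (pos (Sum.inr b : Lf k l)).val = k + b.val + 1 := by
  simp [pos]
theorem pos_cases (a : Fin (k + l + 1)) : a = 0 ∨ ∃ j : Lf k l, a = pos j := by
  refine Fin.cases (Or.inl rfl) (fun i => Or.inr ?_) a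
  exact ⟨finSumFinEquiv.symm i, by simp [pos]⟩

def Fe : (Fin (k + l + 1) → V) ≃ V × (Lf k l → V) where
  toFun φ := (φ 0, fun j => φ (pos j))
  invFun p := Fin.cons p.1 (fun i => p.2 (finSumFinEquiv.symm i))
  left_inv φ := by
    funext a
    refine Fin.cases ?_ (fun i => ?_) a
    · rfl
    · simp [pos]
  right_inv p := by
    apply Prod.ext
    · rfl
    · funext j; simp [pos]

theorem emb_iff (hA : ∀ u v, A u v → ¬ A v u) (φ : Fin (k + l + 1) → V) :
    IsStarEmb k l A φ ↔ Function.Injective φ ∧ Gd A (φ 0) (fun j : Lf k l => φ (pos j)) := by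
  have hz : ((0 : Fin (k + l + 1)) : ℕ) = 0 := rfl
  have a00 : ¬ StarArc k l 0 0 := by
    unfold StarArc; simp
  have a0l : ∀ a : Fin k, StarArc k l 0 (pos (Sum.inl a)) := by
    intro a; left; rw [pos_inl]; refine ⟨rfl, ?_, ?_⟩ <;> omega
  have a0r : ∀ b : Fin l, ¬ StarArc k l 0 (pos (Sum.inr b)) := by
    intro b; unfold StarArc; rw [pos_inr, hz]; omega
  have al0 : ∀ a : Fin k, ¬ StarArc k l (pos (Sum.inl a)) 0 := by
    intro b; unfold StarArc; rw [pos_inl, hz]; omega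
  have ar0 : ∀ b : Fin l, StarArc k l (pos (Sum.inr b)) 0 := by
    intro b; right; rw [pos_inr]; refine ⟨rfl, ?_⟩; omega
  have aij : ∀ i j : Lf k l, ¬ StarArc k l (pos i) (pos j) := by
    intro i j
    have h1 : (pos i).val ≠ 0 := by simp [pos]
    have h2 : (pos j).val ≠ 0 := by simp [pos]
    unfold StarArc; omega
  constructor
  · rintro ⟨hi, h⟩
    refine ⟨hi, ?_, ?_⟩
    · rintro (a | b)
      · exact (h _ _).1 (a0l a)
      · exact (h _ _).1 (ar0 b)
    · intro i j hc
      exact aij i j ((h _ _).2 hc)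
  · rintro ⟨hi, h1, h2⟩
    refine ⟨hi, ?_⟩
    intro a b
    rcases pos_cases a with rfl | ⟨i, rfl⟩ <;> rcases pos_cases b with rfl | ⟨j, rfl⟩
    · exact ⟨fun h => (a00 h).elim, fun h => (hA _ _ h h).elim⟩
    · rcases j with a | b
      · exact ⟨fun _ => h1 (Sum.inl a), fun _ => a0l a⟩
      · exact ⟨fun h => (a0r b h).elim, fun h => (hA _ _ h (h1 (Sum.inr b))).elim⟩
    · rcases i with a | b
      · exact ⟨fun h => (al0 a h).elim, fun h => (hA _ _ h (h1 (Sum.inl a))).elim⟩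
      · exact ⟨fun _ => h1 (Sum.inr b), fun _ => ar0 b⟩
    · exact ⟨fun h => (aij _ _ h).elim, fun h => (h2 _ _ h).elim⟩

theorem card_Gd : sW k l A (fun _ => 1) =
    (Fintype.card {φ : Fin (k + l + 1) → V // Gd A (φ 0) (fun j : Lf k l => φ (pos j))} : ℝ) := by
  unfold sW Zp
  rw [Fintype.card_subtype, Finset.card_filter]
  push_cast
  rw [← Fintype.sum_equiv (Fe (k := k) (l := l) (V := V)).symm (fun p => if Gd A p.1 p.2 then (1 : ℝ) else 0) _ (fun p => ?_)]
  · rw [Fintype.sum_prod_type]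
    simp
  · have : (Fe (Fe.symm p)) = p := Fe.apply_symm_apply p
    have e1 : (Fe (Fe.symm p)).1 = p.1 := by rw [this]
    have e2 : (Fe (Fe.symm p)).2 = p.2 := by rw [this]
    change (Fe.symm p) 0 = p.1 at e1
    change (fun j : Lf k l => (Fe.symm p) (pos j)) = p.2 at e2
    rw [e1, e2]

theorem starProb_le (hA : ∀ u v, A u v → ¬ A v u) :
    starProb k l V A ≤ sW k l A (fun _ => 1) / (Fintype.card V : ℝ) ^ (k + l + 1) := by
  unfold starProb
  rw [card_Gd, Nat.card_eq_fintype_card]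
  gcongr
  apply Fintype.card_subtype_mono
  intro φ h
  exact ((emb_iff hA φ).1 h).2

theorem J_pred (hk : 1 ≤ k) : ((k : ℝ) - 1) ^ (k - 1) * (l : ℝ) ^ l / ((k : ℝ) + (l : ℝ) - 1) ^ (k + l - 1) = J (k - 1) l := by
  unfold J
  have e : k - 1 + l = k + l - 1 := by omega
  rw [e, Nat.cast_sub hk]
  push_cast
  have : (k : ℝ) - 1 + l = k + l - 1 := by ring
  rw [this]

def OS2 (k l : ℕ) : Set ℝ := {y : ℝ | ∃ a ∈ Set.Icc (0 : ℝ) (1 / 2),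
      ∃ d ∈ Set.Icc (0 : ℝ) ((k : ℝ) / ((k : ℝ) + (l : ℝ))), y = Fo k l a d}

def OS1 (k : ℕ) : Set ℝ := {y : ℝ | ∃ a ∈ Set.Icc (0 : ℝ) 1, y = a * (1 - a) ^ (2 * k) + (1 - a) * a ^ (2 * k)}

theorem OPT_ne (hk : 1 ≤ k) (h : k ≠ l) : OPT k l = sSup (OS2 k l) := by
  unfold OPT OS2 Fo
  rw [if_neg h, J_pred hk]

theorem OPT_eq : OPT k k = (1 / 2 ^ (2 * k)) * sSup (OS1 k) := by
  unfold OPT OS1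
  rw [if_pos rfl]

theorem dk_le (hk : 1 ≤ k) : (k : ℝ) / ((k : ℝ) + (l : ℝ)) ≤ 1 := by
  have : (1 : ℝ) ≤ k := by exact_mod_cast hk
  rw [div_le_one (by positivity)]
  have : (0 : ℝ) ≤ l := by positivity
  linarith

theorem bdd2 (hk : 1 ≤ k) : BddAbove (OS2 k l) := by
  refine ⟨1 + J (k - 1) l, ?_⟩
  rintro y ⟨a, ⟨ha0, ha1⟩, d, ⟨hd0, hd1⟩, rfl⟩
  have hd := hd1.trans (dk_le hk)
  have hJ := (J_pos (k - 1) l).le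
  have p1 : 0 ≤ 1 - a := by linarith
  have p2 : 0 ≤ 1 - d := by linarith
  unfold Fo
  have c1 : (1 - a) ^ (k + l) ≤ 1 := pow_le_one₀ p1 (by linarith)
  have c2 : d ^ k ≤ 1 := pow_le_one₀ hd0 hd
  have c3 : (1 - d) ^ l ≤ 1 := pow_le_one₀ p2 (by linarith)
  have c4 : a ^ (k + l) ≤ 1 := pow_le_one₀ ha0 (by linarith)
  apply add_le_add
  · refine mul_le_one₀ (mul_le_one₀ (mul_le_one₀ (by linarith) (by positivity) c1) (by positivity) c2) (by positivity) c3
  · have : (1 - a) * (a ^ (k + l) * (1 - d)) ≤ 1 := mul_le_one₀ (by linarith) (by positivity) (mul_le_one₀ c4 p2 (by linarith))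
    nlinarith

theorem bdd1 : BddAbove (OS1 k) := by
  refine ⟨2, ?_⟩
  rintro y ⟨a, ⟨ha0, ha1⟩, rfl⟩
  have p1 : 0 ≤ 1 - a := by linarith
  have c1 : (1 - a) ^ (2 * k) ≤ 1 := pow_le_one₀ p1 (by linarith)
  have c4 : a ^ (2 * k) ≤ 1 := pow_le_one₀ ha0 (by linarith)
  have := mul_le_one₀ ha1 (by positivity) c1
  have := mul_le_one₀ (show 1 - a ≤ 1 by linarith) (by positivity) c4
  linarith

theorem J_diag (hk : 1 ≤ k) : J k k = 1 / 2 ^ (2 * k) := by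
  have h := J_val k k hk 1
  rw [one_pow, mul_one, mul_one] at h
  have hk' : (0 : ℝ) < k := by exact_mod_cast hk
  have : (k : ℝ) / ((k : ℝ) + k) = 1 / 2 := by field_simp; ring
  rw [← h, this, ← pow_add, one_div_pow]
  congr 2; ring

theorem th_alpha (m : ℕ) : th m = (1 - 1 / ((m : ℝ) + 1)) ^ m := by
  unfold th
  congr 1
  field_simp
  ring

theorem Fo_V0 (hk : 1 ≤ k) : J k l * th (k + l) / ((k : ℝ) + l + 1) ≤ Fo k l (1 / ((k : ℝ) + l + 1)) (k / ((k : ℝ) + l)) := by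
  have hk' : (1 : ℝ) ≤ k := by exact_mod_cast hk
  have hs : (1 : ℝ) - k / ((k : ℝ) + l) = l / ((k : ℝ) + l) := by
    have : (0 : ℝ) < (k : ℝ) + l := by positivity
    field_simp; ring
  unfold Fo
  have hv := J_val k l hk 1
  rw [one_pow, mul_one, mul_one, mul_one] at hv
  rw [hs, mul_assoc (1 / ((k : ℝ) + l + 1) * _), hv, th_alpha]
  have h1 : (1 : ℝ) / ((k : ℝ) + l + 1) ≤ 1 := by
    rw [div_le_one (by positivity)]; have : (0 : ℝ) ≤ l := by positivity
    linarith
  have h2 : 0 ≤ J (k - 1) l * (1 - 1 / ((k : ℝ) + l + 1)) * (1 / ((k : ℝ) + l + 1)) ^ (k + l) * (l / ((k : ℝ) + l)) := by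
    have := (J_pos (k - 1) l).le
    have : (0 : ℝ) ≤ 1 - 1 / ((k : ℝ) + l + 1) := by linarith
    positivity
  push_cast
  have e : J k l * (1 - 1 / ((k : ℝ) + l + 1)) ^ (k + l) / ((k : ℝ) + l + 1) = 1 / ((k : ℝ) + l + 1) * (1 - 1 / ((k : ℝ) + l + 1)) ^ (k + l) * J k l := by ring
  rw [e]
  linarith

theorem alpha_half (hm : 6 ≤ k + l) : (1 : ℝ) / ((k : ℝ) + l + 1) ≤ 1 / 2 := by
  have : (6 : ℝ) ≤ (k : ℝ) + l := by exact_mod_cast hm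
  apply one_div_le_one_div_of_le <;> linarith

theorem OPT_V0 (hl : 1 ≤ l) (hlk : l ≤ k) (hm : 6 ≤ k + l) : J k l * th (k + l) ≤ ((k : ℝ) + l + 1) * OPT k l := by
  have hk : 1 ≤ k := by omega
  have hk' : (1 : ℝ) ≤ k := by exact_mod_cast hk
  have hp : (0 : ℝ) < (k : ℝ) + l + 1 := by positivity
  have hα := alpha_half hm
  rw [mul_comm, ← div_le_iff₀' hp, mul_comm]
  by_cases h : k = l
  · subst h
    rw [OPT_eq, J_diag hk, mul_div_assoc]
    apply mul_le_mul_of_nonneg_left _ (by positivity)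
    refine le_trans ?_ (le_csSup bdd1 ⟨1 / ((k : ℝ) + k + 1), ⟨by positivity, by linarith⟩, rfl⟩)
    have e : k + k = 2 * k := by ring
    rw [th_alpha, e]
    push_cast
    have e2 : (2 : ℝ) * k + 1 = k + k + 1 := by ring
    rw [e2]
    have : 0 ≤ (1 - 1 / ((k : ℝ) + k + 1)) * (1 / ((k : ℝ) + k + 1)) ^ (2 * k) := by
      have : (0 : ℝ) ≤ 1 - 1 / ((k : ℝ) + k + 1) := by linarith
      positivity
    have e3 : (1 - 1 / ((k : ℝ) + k + 1)) ^ (2 * k) / ((k : ℝ) + k + 1) = 1 / ((k : ℝ) + k + 1) * (1 - 1 / ((k : ℝ) + k + 1)) ^ (2 * k) := by ring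
    rw [e3]; linarith
  · rw [OPT_ne hk h]
    exact (Fo_V0 hk).trans (le_csSup (bdd2 hk) ⟨_, ⟨by positivity, hα⟩, _, ⟨by positivity, le_rfl⟩, rfl⟩)

theorem upper (hl : 1 ≤ l) (hlk : l ≤ k) (hm : 6 ≤ k + l) (A : V → V → Prop) (hA : ∀ u v, A u v → ¬ A v u)
    (hV : 1 ≤ Fintype.card V) : starProb k l V A ≤ OPT k l := by
  have : Nonempty V := Fintype.card_pos_iff.1 (by omega)
  have hk : 1 ≤ k := by omega
  obtain ⟨w, M, O⟩ := exists_opt k l (by omega) A hA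
  have h1 : starProb k l V A ≤ M := by
    refine (starProb_le hA).trans ?_
    have hn : (0 : ℝ) < Fintype.card V := by exact_mod_cast hV
    rw [div_le_iff₀ (by positivity)]
    have := O.hom (fun _ => 1) (fun _ => zero_le_one)
    simpa using this
  refine h1.trans ?_
  by_contra hc
  push Not at hc
  have hp : (0 : ℝ) < (k : ℝ) + l + 1 := by positivity
  have C : Ctx k l A w M := { O with
    hm := hm, hl := hl, hlk := hlk
    hS := (OPT_V0 hl hlk hm).trans (mul_le_mul_of_nonneg_left hc.le hp.le) }
  refine absurd hc (not_lt.2 ?_)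
  by_cases h : k = l
  · subst h
    apply C.final_eq
    intro α h0 h1
    rw [OPT_eq]
    apply mul_le_mul_of_nonneg_left _ (by positivity)
    exact le_csSup bdd1 ⟨α, ⟨h0, h1⟩, rfl⟩
  · have hΩ : ∀ α d : ℝ, 0 ≤ α → α ≤ 1 / 2 → 0 ≤ d → d ≤ (k : ℝ) / ((k : ℝ) + l) → Fo k l α d ≤ OPT k l := by
      intro α d h0 h1 h2 h3
      rw [OPT_ne hk h]
      exact le_csSup (bdd2 hk) ⟨α, ⟨h0, h1⟩, d, ⟨h2, h3⟩, rfl⟩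
    by_cases hl2 : 2 ≤ l
    · exact C.final_gt2 hl2 _ hΩ
    · have : l = 1 := by omega
      subst this
      exact C.final_one _ hΩ

end P5e
end OS

namespace OS
section P6
open Classical

variable {V : Type} [Fintype V] {k l : ℕ} {A : V → V → Prop}

theorem inj_count (n N : ℕ) (hn : 1 ≤ n) (hN : N ≤ n) (hN1 : 1 ≤ N) :
    (n : ℝ) ^ N - (N : ℝ) * ((N : ℝ) - 1) * (n : ℝ) ^ (N - 1) ≤ (n.descFactorial N : ℝ) := by
  have h1 : ((n + 1 - N : ℕ) : ℝ) ^ N ≤ (n.descFactorial N : ℝ) := by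
    exact_mod_cast Nat.pow_sub_le_descFactorial n N
  refine le_trans ?_ h1
  have hn' : (0 : ℝ) < n := by exact_mod_cast hn
  have hNn : (N : ℝ) ≤ n := by exact_mod_cast hN
  have hN1' : (1 : ℝ) ≤ N := by exact_mod_cast hN1
  have hc : ((n + 1 - N : ℕ) : ℝ) = n * (1 + (-(((N : ℝ) - 1) / n))) := by
    rw [Nat.cast_sub (by omega)]; push_cast; field_simp; ring
  rw [hc, mul_pow]
  have hle : ((N : ℝ) - 1) / n ≤ 1 := by rw [div_le_one hn']; linarith
  have hb := one_add_mul_le_pow (a := -(((N : ℝ) - 1) / n)) (by linarith) N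
  have := mul_le_mul_of_nonneg_left hb (by positivity : 0 ≤ (n : ℝ) ^ N)
  refine le_trans (le_of_eq ?_) this
  have e : (n : ℝ) ^ N = n ^ (N - 1) * n := by rw [← pow_succ]; congr 1; omega
  rw [e]; field_simp; ring

theorem starProb_ge (hA : ∀ u v, A u v → ¬ A v u) (hV : k + l + 1 ≤ Fintype.card V) :
    sW k l A (fun _ => 1) / (Fintype.card V : ℝ) ^ (k + l + 1) - ((k : ℝ) + l + 1) * (k + l) / (Fintype.card V : ℝ) ≤ starProb k l V A := by
  have hn : (0 : ℝ) < Fintype.card V := by exact_mod_cast (by omega : 0 < Fintype.card V)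
  have h1 : Fintype.card {φ : Fin (k + l + 1) → V // Gd A (φ 0) (fun j : Lf k l => φ (pos j))} ≤
      Fintype.card {φ : Fin (k + l + 1) → V // IsStarEmb k l A φ} + Fintype.card {φ : Fin (k + l + 1) → V // ¬ Function.Injective φ} := by
    rw [Fintype.card_subtype, Fintype.card_subtype, Fintype.card_subtype]
    refine le_trans (Finset.card_le_card ?_) (Finset.card_union_le _ _)
    intro φ hφ
    simp only [Finset.mem_filter, Finset.mem_univ, true_and, Finset.mem_union] at hφ ⊢
    by_cases hi : Function.Injective φ
    · exact Or.inl ((emb_iff hA φ).2 ⟨hi, hφ⟩)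
    · exact Or.inr hi
  have h2 : Fintype.card {φ : Fin (k + l + 1) → V // Function.Injective φ} = (Fintype.card V).descFactorial (k + l + 1) := by
    have e : Fintype.card {φ : Fin (k + l + 1) → V // Function.Injective φ} = Fintype.card (Fin (k + l + 1) ↪ V) :=
      Fintype.card_congr (Equiv.subtypeInjectiveEquivEmbedding _ _)
    rw [e, Fintype.card_embedding_eq, Fintype.card_fin]
  have h3 := Fintype.card_subtype_compl (fun φ : Fin (k + l + 1) → V => Function.Injective φ)
  have h4 : Fintype.card {φ : Fin (k + l + 1) → V // Function.Injective φ} ≤ Fintype.card (Fin (k + l + 1) → V) := Fintype.card_subtype_le _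
  have h5 : (Fintype.card {φ : Fin (k + l + 1) → V // ¬ Function.Injective φ} : ℝ) = (Fintype.card V : ℝ) ^ (k + l + 1) - ((Fintype.card V).descFactorial (k + l + 1) : ℝ) := by
    rw [h3, Nat.cast_sub h4, h2, Fintype.card_fun, Fintype.card_fin]; push_cast; ring
  have h6 := inj_count (Fintype.card V) (k + l + 1) (by omega) hV (by omega)
  have h7 : (Fintype.card {φ : Fin (k + l + 1) → V // Gd A (φ 0) (fun j : Lf k l => φ (pos j))} : ℝ) ≤
      Fintype.card {φ : Fin (k + l + 1) → V // IsStarEmb k l A φ} + Fintype.card {φ : Fin (k + l + 1) → V // ¬ Function.Injective φ} := by exact_mod_cast h1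
  unfold starProb
  rw [card_Gd, Nat.card_eq_fintype_card]
  have hp : (0 : ℝ) < (Fintype.card V : ℝ) ^ (k + l + 1) := by positivity
  have e : ((k : ℝ) + l + 1) * (k + l) / (Fintype.card V : ℝ) = ((k : ℝ) + l + 1) * (k + l) * (Fintype.card V : ℝ) ^ (k + l) / (Fintype.card V : ℝ) ^ (k + l + 1) := by
    rw [pow_succ]; field_simp
  rw [e, ← sub_div]
  gcongr
  push_cast at h6
  have e2 : ((k : ℝ) + l + 1) * ((k : ℝ) + l + 1 - 1) = ((k : ℝ) + l + 1) * (k + l) := by ring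
  rw [e2] at h6
  linarith

/-- maps into a sigma type -/
def sigE {ι U : Type} (n : U → ℕ) : (ι → Σ u, Fin (n u)) ≃ Σ L : ι → U, (∀ j, Fin (n (L j))) where
  toFun L := ⟨fun j => (L j).1, fun j => (L j).2⟩
  invFun p := fun j => ⟨p.1 j, p.2 j⟩
  left_inv _ := rfl
  right_inv _ := rfl

theorem blow_sW {U : Type} [Fintype U] (H : U → U → Prop) (n : U → ℕ) :
    sW k l (fun x y : Σ u, Fin (n u) => H x.1 y.1) (fun _ => 1) = sW k l H (fun u => (n u : ℝ)) := by
  unfold sW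
  rw [Fintype.sum_sigma]
  refine Finset.sum_congr rfl fun c _ => ?_
  have hz : ∀ i : Fin (n c), Zp (fun x y : Σ u, Fin (n u) => H x.1 y.1) ⟨c, i⟩ (fun _ : Lf k l => fun _ => (1 : ℝ)) = Zp H c (fun _ : Lf k l => fun u => (n u : ℝ)) := by
    intro i
    unfold Zp
    rw [Fintype.sum_equiv (sigE n) _ (fun p : Σ L : Lf k l → U, (∀ j, Fin (n (L j))) => if Gd H c p.1 then (1 : ℝ) else 0) (fun L => ?_)]
    · rw [Fintype.sum_sigma]
      refine Finset.sum_congr rfl fun L _ => ?_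
      split_ifs
      · simp
      · simp
    · have : Gd (fun x y : Σ u, Fin (n u) => H x.1 y.1) ⟨c, i⟩ L ↔ Gd H c (sigE n L).1 := by
        unfold Gd
        apply and_congr _ Iff.rfl
        apply forall_congr'
        rintro (a | b) <;> exact Iff.rfl
      simp [this]
  simp only [one_mul, hz]
  simp

theorem starProb_equiv {W : Type} [Fintype W] (e : V ≃ W) (A : W → W → Prop) :
    starProb k l V (fun x y => A (e x) (e y)) = starProb k l W A := by
  unfold starProb
  rw [Fintype.card_congr e]
  congr 2
  apply Nat.card_congr
  refine Equiv.subtypeEquiv (Equiv.arrowCongr (Equiv.refl _) e) ?_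
  intro φ
  unfold IsStarEmb
  apply and_congr _ Iff.rfl
  exact (e.comp_injective φ).symm

theorem blow {U : Type} [Fintype U] (H : U → U → Prop) (hH : ∀ u v, H u v → ¬ H v u) (wt : U → ℝ)
    (hw : ∀ u, 0 ≤ wt u) (hs : ∑ u, wt u = 1) (ε : ℝ) (hε : 0 < ε) :
    ∃ (n : ℕ) (A : Fin n → Fin n → Prop), Irreflexive A ∧ (∀ u v, A u v → ¬ A v u) ∧ 1 ≤ n ∧
      sW k l H wt - ε < starProb k l (Fin n) A := by
  have hc : Continuous (fun g : U → ℝ => sW k l H g) := by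
    unfold sW Zp
    apply continuous_finset_sum; intro c _
    apply Continuous.mul (continuous_apply c)
    apply continuous_finset_sum; intro L _
    split_ifs
    · apply continuous_finset_prod; intro j _; exact continuous_apply (L j)
    · exact continuous_const
  have ht1 : Filter.Tendsto (fun T : ℝ => (fun u => (⌊wt u * T⌋₊ : ℝ) / T)) Filter.atTop (nhds wt) := by
    rw [tendsto_pi_nhds]
    intro u
    exact tendsto_nat_floor_mul_div_atTop (hw u)
  have ht2 : Filter.Tendsto (fun T : ℝ => sW k l H (fun u => (⌊wt u * T⌋₊ : ℝ) / T)) Filter.atTop (nhds (sW k l H wt)) :=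
    (hc.tendsto wt).comp ht1
  have hev1 := ht2.eventually (lt_mem_nhds (show sW k l H wt - ε / 2 < sW k l H wt by linarith))
  set Q : ℝ := ((k : ℝ) + l + 1) * (k + l) with hQ
  have hQ0 : 0 ≤ Q := by positivity
  have hev2 := Filter.eventually_ge_atTop ((Fintype.card U : ℝ) + (k + l + 1) + 4 * Q / ε)
  obtain ⟨T, hT1, hT2⟩ := (hev1.and hev2).exists
  have hq : 0 ≤ 4 * Q / ε := by positivity
  have hU : (0 : ℝ) ≤ Fintype.card U := by positivity
  have hT0 : 0 < T := by
    have : (0 : ℝ) ≤ (k : ℝ) + l := by positivity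
    linarith
  obtain ⟨nn, hnn⟩ : ∃ nn : U → ℕ, ∀ u, nn u = ⌊wt u * T⌋₊ := ⟨_, fun _ => rfl⟩
  simp only [← hnn] at hT1
  have hcard : Fintype.card (Σ u, Fin (nn u)) = ∑ u, nn u := by simp
  have hcle : (∑ u, (nn u : ℝ)) ≤ T := by
    calc (∑ u, (nn u : ℝ)) ≤ ∑ u, wt u * T := Finset.sum_le_sum fun u _ => by
          rw [hnn]; exact Nat.floor_le (mul_nonneg (hw u) hT0.le)
      _ = T := by rw [← Finset.sum_mul, hs, one_mul]
  have hcge : T - Fintype.card U ≤ ∑ u, (nn u : ℝ) := by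
    calc T - Fintype.card U = ∑ u, (wt u * T - 1) := by
          rw [Finset.sum_sub_distrib, ← Finset.sum_mul, hs, one_mul]; simp
      _ ≤ _ := Finset.sum_le_sum fun u _ => by
          rw [hnn]; have := Nat.lt_floor_add_one (wt u * T); linarith
  set n := Fintype.card (Σ u, Fin (nn u)) with hn
  have hnc : (n : ℝ) = ∑ u, (nn u : ℝ) := by rw [hcard]; push_cast; rfl
  have hn1 : (k : ℝ) + l + 1 ≤ n := by rw [hnc]; linarith
  have hn1' : k + l + 1 ≤ n := by exact_mod_cast hn1
  have hn2 : 4 * Q / ε ≤ n := by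
    have : (0 : ℝ) ≤ (k : ℝ) + l := by positivity
    rw [hnc]; linarith
  have hn0 : (0 : ℝ) < n := by
    have : (0 : ℝ) ≤ (k : ℝ) + l := by positivity
    linarith
  have hB : ∀ u v : Σ u, Fin (nn u), H u.1 v.1 → ¬ H v.1 u.1 := fun u v => hH _ _
  have hge := starProb_ge (k := k) (l := l) (A := fun x y : Σ u, Fin (nn u) => H x.1 y.1) hB hn1'
  rw [blow_sW] at hge
  have e := (Fintype.equivFin (Σ u, Fin (nn u))).symm
  refine ⟨n, fun x y => H (e x).1 (e y).1, fun x h => hH _ _ h h, fun x y => hH _ _, by omega, ?_⟩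
  have heq := starProb_equiv (k := k) (l := l) e (fun x y => H x.1 y.1)
  have heq' : starProb k l (Fin n) (fun x y => H (e x).1 (e y).1) = starProb k l (Σ u, Fin (nn u)) (fun x y => H x.1 y.1) := heq
  rw [heq']
  refine lt_of_lt_of_le ?_ hge
  have hsc : sW k l H (fun u => (nn u : ℝ) / T) = sW k l H (fun u => (nn u : ℝ)) / T ^ (k + l + 1) := by
    have := sW_scale (k := k) (l := l) H T⁻¹ (fun u => (nn u : ℝ))
    have e1 : (fun u => T⁻¹ * (nn u : ℝ)) = fun u => (nn u : ℝ) / T := by funext u; ring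
    rw [e1] at this
    rw [this, inv_pow]; ring
  rw [hsc] at hT1
  have h8 : sW k l H (fun u => (nn u : ℝ)) / T ^ (k + l + 1) ≤ sW k l H (fun u => (nn u : ℝ)) / (n : ℝ) ^ (k + l + 1) := by
    apply div_le_div_of_nonneg_left
    · exact sW_nonneg H _ (fun u => by positivity)
    · positivity
    · exact pow_le_pow_left₀ hn0.le (by rw [hnc]; exact hcle) _
  have h9 : Q / n ≤ ε / 4 := by
    rw [div_le_iff₀ hε] at hn2
    rw [div_le_iff₀ hn0]; linarith
  linarith

end P6
end OS

namespace OS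
section P6b
open Classical
variable {V : Type} [Fintype V] {k l : ℕ}

theorem Zp_ge (A : V → V → Prop) (c : V) (g : V → ℝ) (hg : ∀ v, 0 ≤ g v) (P : V → Prop)
    (hP : ∀ u v, P u → P v → ¬ A u v) :
    (ms g (fun v => A c v ∧ P v)) ^ k * (ms g (fun v => A v c ∧ P v)) ^ l
      ≤ Zp A c (fun _ : Lf k l => g) := by
  have e : ∏ j : Lf k l, ∑ v, (if ty A c j v ∧ P v then g v else 0)
      = ∑ L : Lf k l → V, ∏ j, (if ty A c j (L j) ∧ P (L j) then g (L j) else 0) := by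
    rw [Finset.prod_univ_sum]
    simp
  have e2 : ∏ j : Lf k l, ∑ v, (if ty A c j v ∧ P v then g v else 0)
      = (ms g (fun v => A c v ∧ P v)) ^ k * (ms g (fun v => A v c ∧ P v)) ^ l := by
    apply prod_ty
    · intro a; simp only [ms, ty]; apply Finset.sum_congr rfl; intro v _; by_cases hh : A c v ∧ P v <;> simp [hh]
    · intro a; simp only [ms, ty]; apply Finset.sum_congr rfl; intro v _; by_cases hh : A v c ∧ P v <;> simp [hh]
  rw [← e2, e]
  unfold Zp
  apply Finset.sum_le_sum
  intro L _
  by_cases h : ∀ j, ty A c j (L j) ∧ P (L j)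
  · have hG : Gd A c L := ⟨fun i => (h i).1, fun i j => hP _ _ (h i).2 (h j).2⟩
    rw [if_pos hG]
    apply le_of_eq
    apply Finset.prod_congr rfl
    intro j _
    rw [if_pos (h j)]
  · push Not at h
    obtain ⟨j, hj⟩ := h
    rw [Finset.prod_eq_zero (Finset.mem_univ j)]
    · split_ifs
      · exact Finset.prod_nonneg (fun j _ => hg _)
      · exact le_rfl
    · rw [if_neg]
      intro h; exact hj h.1 h.2

/-- the extremal pattern -/
def Hx (n r : ℕ) : (Fin (n + 1) ⊕ (Fin (n + 1) ⊕ Unit)) → (Fin (n + 1) ⊕ (Fin (n + 1) ⊕ Unit)) → Prop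
  | Sum.inl i, Sum.inr (Sum.inl j) => ¬ (i + j).val < r
  | Sum.inr (Sum.inl j), Sum.inl i => (i + j).val < r
  | Sum.inl _, Sum.inr (Sum.inr _) => True
  | _, _ => False

/-- weights of the extremal pattern -/
def wx (n : ℕ) (x b y : ℝ) : (Fin (n + 1) ⊕ (Fin (n + 1) ⊕ Unit)) → ℝ
  | Sum.inl _ => x
  | Sum.inr (Sum.inl _) => b
  | Sum.inr (Sum.inr _) => y

theorem Hx_asym (n r : ℕ) : ∀ u v, Hx n r u v → ¬ Hx n r v u := by
  rintro (i | j | _) (i' | j' | _) <;> simp [Hx]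

theorem cnt0 (n r : ℕ) (hr : r ≤ n + 1) (b : ℝ) :
    (∑ j : Fin (n + 1), if j.val < r then b else 0) = r * b := by
  rw [Fin.sum_univ_eq_sum_range (fun j => if j < r then b else 0) (n + 1), Finset.sum_ite]
  have : (Finset.range (n + 1)).filter (fun j => j < r) = Finset.range r := by
    ext j; simp; omega
  rw [this]; simp

theorem cnt (n r : ℕ) (hr : r ≤ n + 1) (b : ℝ) (i : Fin (n + 1)) :
    (∑ j : Fin (n + 1), if (i + j).val < r then b else 0) = r * b := by
  rw [← cnt0 n r hr b]
  exact Equiv.sum_comp (Equiv.addLeft i) (fun j : Fin (n + 1) => if j.val < r then b else 0)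

theorem cnt' (n r : ℕ) (hr : r ≤ n + 1) (b : ℝ) (i : Fin (n + 1)) :
    (∑ j : Fin (n + 1), if ¬ (i + j).val < r then b else 0) = ((n : ℝ) + 1 - r) * b := by
  have h := cnt n r hr b i
  have : (∑ j : Fin (n + 1), if ¬ (i + j).val < r then b else 0)
      + (∑ j : Fin (n + 1), if (i + j).val < r then b else 0) = ((n : ℝ) + 1) * b := by
    rw [← Finset.sum_add_distrib]
    rw [Finset.sum_congr rfl (g := fun _ => b)]
    · simp
    · intro j _; by_cases h : (i + j).val < r <;> simp only [h, not_true, not_false_iff, if_true, if_false, zero_add, add_zero]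
  linarith

theorem exA (n r : ℕ) (hr : r ≤ n + 1) (x b y : ℝ) (hx : 0 ≤ x) (hb : 0 ≤ b) (hy : 0 ≤ y) :
    ((n : ℝ) + 1) * (x * ((((n : ℝ) + 1 - r) * b + y) ^ k * (r * b) ^ l))
      + ((n : ℝ) + 1) * (b * ((r * x) ^ k * (((n : ℝ) + 1 - r) * x) ^ l))
      ≤ sW k l (Hx n r) (wx n x b y) := by
  have hw : ∀ v, 0 ≤ wx n x b y v := by
    rintro (i | j | _) <;> simpa [wx]
  unfold sW
  rw [Fintype.sum_sum_type, Fintype.sum_sum_type]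
  have h1 : ∀ i : Fin (n + 1), x * ((((n : ℝ) + 1 - r) * b + y) ^ k * (r * b) ^ l)
      ≤ wx n x b y (Sum.inl i) * Zp (Hx n r) (Sum.inl i) (fun _ : Lf k l => wx n x b y) := by
    intro i
    have h := Zp_ge (k := k) (l := l) (Hx n r) (Sum.inl i) (wx n x b y) hw (fun v => v.isRight = true)
      (by rintro (i | j | _) (i' | j' | _) <;> simp [Hx])
    have e1 : ms (wx n x b y) (fun v => Hx n r (Sum.inl i) v ∧ v.isRight = true) = ((n : ℝ) + 1 - r) * b + y := by
      rw [← cnt' n r hr b i]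
      simp [ms, Fintype.sum_sum_type, Hx, wx]
    have e2 : ms (wx n x b y) (fun v => Hx n r v (Sum.inl i) ∧ v.isRight = true) = r * b := by
      rw [← cnt n r hr b i]
      simp [ms, Fintype.sum_sum_type, Hx, wx]
    rw [e1, e2] at h
    exact mul_le_mul_of_nonneg_left h hx
  have h2 : ∀ j : Fin (n + 1), b * ((r * x) ^ k * (((n : ℝ) + 1 - r) * x) ^ l)
      ≤ wx n x b y (Sum.inr (Sum.inl j)) * Zp (Hx n r) (Sum.inr (Sum.inl j)) (fun _ : Lf k l => wx n x b y) := by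
    intro j
    have h := Zp_ge (k := k) (l := l) (Hx n r) (Sum.inr (Sum.inl j)) (wx n x b y) hw (fun v => v.isLeft = true)
      (by rintro (i | j | _) (i' | j' | _) <;> simp [Hx])
    have e1 : ms (wx n x b y) (fun v => Hx n r (Sum.inr (Sum.inl j)) v ∧ v.isLeft = true) = r * x := by
      rw [← cnt n r hr x j]
      simp [ms, Fintype.sum_sum_type, Hx, wx, add_comm]
    have e2 : ms (wx n x b y) (fun v => Hx n r v (Sum.inr (Sum.inl j)) ∧ v.isLeft = true) = ((n : ℝ) + 1 - r) * x := by
      rw [← cnt' n r hr x j]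
      simp [ms, Fintype.sum_sum_type, Hx, wx, add_comm]
    rw [e1, e2] at h
    exact mul_le_mul_of_nonneg_left h hb
  have s1 := Finset.sum_le_sum (s := Finset.univ) (fun i _ => h1 i)
  have s2 := Finset.sum_le_sum (s := Finset.univ) (fun i _ => h2 i)
  have s3 : 0 ≤ ∑ u : Unit, wx n x b y (Sum.inr (Sum.inr u)) * Zp (Hx n r) (Sum.inr (Sum.inr u)) (fun _ : Lf k l => wx n x b y) :=
    Finset.sum_nonneg (fun u _ => mul_nonneg (hw _) (Zp_nonneg _ _ _ (fun _ v => hw v)))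
  rw [Finset.sum_const, Finset.card_univ, Fintype.card_fin, nsmul_eq_mul] at s1 s2
  push_cast at s1 s2
  linarith

theorem wx_sum (n : ℕ) (x b y : ℝ) : ∑ u, wx n x b y u = (n + 1) * x + ((n + 1) * b + y) := by
  simp [Fintype.sum_sum_type, wx]

theorem exE (a : ℝ) (h0 : 0 ≤ a) (h1 : a ≤ 1) (ε : ℝ) (hε : 0 < ε) :
    ∃ (n : ℕ) (A : Fin n → Fin n → Prop), Irreflexive A ∧ (∀ u v, A u v → ¬ A v u) ∧ 1 ≤ n ∧
      (1 / 2 ^ (2 * k)) * (a * (1 - a) ^ (2 * k) + (1 - a) * a ^ (2 * k)) - ε < starProb k k (Fin n) A := by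
  have hx : 0 ≤ a / 2 := by linarith
  have hb : 0 ≤ (1 - a) / 2 := by linarith
  obtain ⟨n, A, i1, i2, i3, i4⟩ := blow (k := k) (l := k) (Hx 1 1) (Hx_asym 1 1) (wx 1 (a / 2) ((1 - a) / 2) 0)
    (by rintro (i | j | _) <;> simp [wx] <;> linarith) (by rw [wx_sum]; push_cast; ring) ε hε
  refine ⟨n, A, i1, i2, i3, ?_⟩
  have h := exA (k := k) (l := k) 1 1 (by norm_num) (a / 2) ((1 - a) / 2) 0 hx hb le_rfl
  have e : ∀ t : ℝ, (t / 2) ^ k * (t / 2) ^ k = (1 / 2 ^ (2 * k)) * t ^ (2 * k) := by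
    intro t
    rw [← pow_add, ← two_mul, div_pow]; ring
  have e1 := e a
  have e2 := e (1 - a)
  push_cast at h
  simp only [add_sub_cancel_right, one_mul, add_zero] at h
  rw [e1, e2] at h
  linarith

theorem exF (hlk : l < k) (hl : 1 ≤ l) (α d : ℝ) (h0 : 0 ≤ α) (h1 : α ≤ 1)
    (hd0 : (l : ℝ) / ((k : ℝ) + l - 1) ≤ d) (hd1 : d ≤ 1) (ε : ℝ) (hε : 0 < ε) :
    ∃ (n : ℕ) (A : Fin n → Fin n → Prop), Irreflexive A ∧ (∀ u v, A u v → ¬ A v u) ∧ 1 ≤ n ∧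
      Fo k l α d - ε < starProb k l (Fin n) A := by
  obtain ⟨r, rfl⟩ : ∃ r, k = r + 1 := ⟨k - 1, by omega⟩
  obtain ⟨n, hn⟩ : ∃ n, r + l = n + 1 := ⟨r + l - 1, by omega⟩
  have hnr : (r : ℝ) + l = n + 1 := by exact_mod_cast hn
  have hr : (1 : ℝ) ≤ r := by have : 1 ≤ r := by omega
                              exact_mod_cast this
  have hr0 : (r : ℝ) ≠ 0 := by positivity
  have hn0 : (0 : ℝ) < (n : ℝ) + 1 := by positivity
  have hN : (((r + 1 : ℕ) : ℝ) + l - 1) = n + 1 := by push_cast; linarith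
  rw [hN, div_le_iff₀ hn0] at hd0
  set x := α / ((n : ℝ) + 1) with hxd
  set b := (1 - α) * (1 - d) / r with hbd
  set y := (1 - α) * (1 - (1 - d) * ((n : ℝ) + 1) / r) with hyd
  have hx : 0 ≤ x := by positivity
  have hb : 0 ≤ b := div_nonneg (mul_nonneg (by linarith) (by linarith)) (by linarith)
  have hy : 0 ≤ y := by
    apply mul_nonneg (by linarith)
    rw [sub_nonneg, div_le_one (by linarith)]
    nlinarith
  have hyb : y = 1 - α - ((n : ℝ) + 1) * b := by rw [hyd, hbd]; field_simp
  have hxn : ((n : ℝ) + 1) * x = α := by rw [hxd]; field_simp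
  have hrb : (r : ℝ) * b = (1 - α) * (1 - d) := by rw [hbd]; field_simp
  obtain ⟨N, A, i1, i2, i3, i4⟩ := blow (k := r + 1) (l := l) (Hx n r) (Hx_asym n r) (wx n x b y)
    (by rintro (i | j | _) <;> simpa [wx]) (by rw [wx_sum]; linarith) ε hε
  refine ⟨N, A, i1, i2, i3, ?_⟩
  have h := exA (k := r + 1) (l := l) n r (by omega) x b y hx hb hy
  have e1 : ((n : ℝ) + 1 - r) * b + y = (1 - α) * d := by rw [hyb]; linarith
  have e2 : ((n : ℝ) + 1 - r) = l := by linarith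
  have hJ := J_val r l (by omega) α
  have e3 : (r : ℝ) / (r + l) * α = r * x := by rw [hnr, hxd]; ring
  have e4 : (l : ℝ) / (r + l) * α = l * x := by rw [hnr, hxd]; ring
  rw [e3, e4] at hJ
  rw [e1, e2, hrb] at h
  have e5 : ((n : ℝ) + 1) * (x * (((1 - α) * d) ^ (r + 1) * ((1 - α) * (1 - d)) ^ l)) =
      α * (1 - α) ^ (r + 1 + l) * d ^ (r + 1) * (1 - d) ^ l := by
    rw [← mul_assoc, hxn, mul_pow, mul_pow]; ring
  have e6 : ((n : ℝ) + 1) * (b * ((r * x) ^ (r + 1) * (l * x) ^ l)) =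
      J r l * (1 - α) * α ^ (r + 1 + l) * (1 - d) := by
    calc ((n : ℝ) + 1) * (b * ((r * x) ^ (r + 1) * (l * x) ^ l))
        = (((n : ℝ) + 1) * x) * (r * b) * ((r * x) ^ r * (l * x) ^ l) := by ring
      _ = _ := by rw [hxn, hrb, hJ]; ring
  rw [e5, e6] at h
  unfold Fo
  rw [Nat.add_sub_cancel]
  linarith

theorem J_nonneg' (i j : ℕ) : 0 ≤ J i j := by unfold J; positivity

theorem Fo_zero (hlk : l < k) (hl : 1 ≤ l) (hm : 6 ≤ k + l) (α : ℝ) (h0 : 0 ≤ α) (h1 : α ≤ 1 / 2) :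
    J (k - 1) l * (1 - α) * α ^ (k + l) ≤ Fo k l (1 / ((k : ℝ) + l + 1)) (k / ((k : ℝ) + l)) := by
  refine le_trans ?_ (Fo_V0 (by omega))
  have hk : (1 : ℝ) ≤ k := by have : 1 ≤ k := by omega
                              exact_mod_cast this
  have hlk' : (l : ℝ) ≤ k := by exact_mod_cast hlk.le
  have hl0 : (0 : ℝ) ≤ l := by positivity
  have hm' : (6 : ℝ) ≤ (k : ℝ) + l := by exact_mod_cast hm
  -- compare the two constants
  have hJ := J_val (k - 1) l (by omega) 1
  rw [one_pow, mul_one, mul_one, mul_one] at hJ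
  have hkl : (0 : ℝ) < ((k - 1 : ℕ) : ℝ) + l := by positivity
  have hL := lam1_out k l (by omega) (((k - 1 : ℕ) : ℝ) / (((k - 1 : ℕ) : ℝ) + l)) (l / (((k - 1 : ℕ) : ℝ) + l)) 1
    (by positivity) (by positivity) (by rw [← add_div, div_self hkl.ne'])
  rw [hJ, one_pow, mul_one] at hL
  have hL2 := Lam1_le k l (by omega)
  have hJ0 := J_nonneg' k l
  have hJ1 := J_nonneg' (k - 1) l
  have hJJ : J (k - 1) l ≤ 5.44 * J k l := by
    have : (k : ℝ) * J (k - 1) l ≤ k * (5.44 * J k l) := by nlinarith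
    exact le_of_mul_le_mul_left this (by linarith)
  have hth := th_ge (k + l) (by omega)
  obtain ⟨p1, p2⟩ := pow2 (k + l) hm
  -- the polynomial bound
  have hα : (1 - α) * α ^ (k + l) ≤ (1 / 2) * (1 / 2) ^ (k + l) := by
    obtain ⟨m, hm2⟩ : ∃ m, k + l = m + 1 := ⟨k + l - 1, by omega⟩
    rw [hm2, pow_succ, pow_succ]
    have q1 : α ^ m ≤ (1 / 2) ^ m := pow_le_pow_left₀ h0 h1 m
    have q2 : (1 - α) * α ≤ 1 / 4 := by nlinarith [sq_nonneg (α - 1 / 2)]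
    have q3 : 0 ≤ (1 - α) * α := mul_nonneg (by linarith) h0
    have q4 : (0 : ℝ) ≤ (1 / 2) ^ m := by positivity
    nlinarith
  have h2 : (1 / 2 : ℝ) ^ (k + l) * ((k : ℝ) + l + 1) * 2.72 ≤ 0.3678 := by
    rw [one_div, inv_pow, mul_assoc, inv_mul_le_iff₀ (by positivity)]
    push_cast at p2
    nlinarith
  rw [le_div_iff₀ (by linarith)]
  have hz : 0 ≤ (1 / 2 : ℝ) ^ (k + l) := by positivity
  calc J (k - 1) l * (1 - α) * α ^ (k + l) * ((k : ℝ) + l + 1)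
      = J (k - 1) l * ((1 - α) * α ^ (k + l)) * ((k : ℝ) + l + 1) := by ring
    _ ≤ (5.44 * J k l) * ((1 / 2) * (1 / 2) ^ (k + l)) * ((k : ℝ) + l + 1) := by
        have : 0 ≤ (1 - α) * α ^ (k + l) := mul_nonneg (by linarith) (by positivity)
        gcongr
    _ = J k l * ((1 / 2 : ℝ) ^ (k + l) * ((k : ℝ) + l + 1) * 2.72) := by ring
    _ ≤ J k l * th (k + l) := by
        apply mul_le_mul_of_nonneg_left _ hJ0
        linarith

theorem Fo_mono (hlk : l < k) (hl : 1 ≤ l) (α d e : ℝ) (h0 : 0 ≤ α) (h1 : α ≤ 1) (hd : 0 ≤ d) (hde : d ≤ e)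
    (he : e ≤ 1 / 2) : Fo k l α d ≤ max (J (k - 1) l * (1 - α) * α ^ (k + l)) (Fo k l α e) := by
  obtain ⟨r, rfl⟩ : ∃ r, k = l + r + 1 := ⟨k - l - 1, by omega⟩
  set c1 := α * (1 - α) ^ (l + r + 1 + l) with hc1
  set c2 := J (l + r + 1 - 1) l * (1 - α) * α ^ (l + r + 1 + l) with hc2
  have c1n : 0 ≤ c1 := mul_nonneg h0 (pow_nonneg (by linarith) _)
  have ef : ∀ t, Fo (l + r + 1) l α t = c2 + t * (c1 * (t ^ r * (t * (1 - t)) ^ l) - c2) := by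
    intro t
    unfold Fo
    rw [← hc1, ← hc2, mul_pow]; ring
  rw [ef d, ef e]
  have hm : d ^ r * (d * (1 - d)) ^ l ≤ e ^ r * (e * (1 - e)) ^ l := by
    have a1 : d ^ r ≤ e ^ r := pow_le_pow_left₀ hd hde r
    have a2 : 0 ≤ d * (1 - d) := mul_nonneg hd (by linarith)
    have a3 : d * (1 - d) ≤ e * (1 - e) := by nlinarith
    have a4 := pow_le_pow_left₀ a2 a3 l
    exact mul_le_mul a1 a4 (by positivity) (pow_nonneg (hd.trans hde) _)
  have hm2 := mul_le_mul_of_nonneg_left hm c1n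
  by_cases hb : c1 * (d ^ r * (d * (1 - d)) ^ l) - c2 ≤ 0
  · apply le_max_of_le_left
    nlinarith
  · apply le_max_of_le_right
    push Not at hb
    have := mul_le_mul hde (show c1 * (d ^ r * (d * (1 - d)) ^ l) - c2 ≤ c1 * (e ^ r * (e * (1 - e)) ^ l) - c2 by linarith) hb.le (hd.trans hde)
    linarith

theorem lower (hl : 1 ≤ l) (hlk : l ≤ k) (hm : 6 ≤ k + l) (ε : ℝ) (hε : 0 < ε) :
    ∃ (n : ℕ) (A : Fin n → Fin n → Prop), Irreflexive A ∧ (∀ u v, A u v → ¬ A v u) ∧ 1 ≤ n ∧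
      OPT k l - ε < starProb k l (Fin n) A := by
  rcases hlk.eq_or_lt with rfl | hlt
  · rw [OPT_eq]
    have hp : (0 : ℝ) < 2 ^ (2 * l) := by positivity
    have hne : (OS1 l).Nonempty := ⟨_, 0, ⟨le_rfl, by norm_num⟩, rfl⟩
    obtain ⟨z, ⟨a, ha, rfl⟩, hz⟩ := exists_lt_of_lt_csSup hne
      (show sSup (OS1 l) - 2 ^ (2 * l) * (ε / 2) < sSup (OS1 l) by
        have : 0 < 2 ^ (2 * l) * (ε / 2) := by positivity
        linarith)
    obtain ⟨n, A, i1, i2, i3, i4⟩ := exE (k := l) a ha.1 ha.2 (ε / 2) (by linarith)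
    refine ⟨n, A, i1, i2, i3, ?_⟩
    have h := mul_lt_mul_of_pos_left hz (show (0 : ℝ) < 1 / 2 ^ (2 * l) by positivity)
    have e : 1 / 2 ^ (2 * l) * (sSup (OS1 l) - 2 ^ (2 * l) * (ε / 2)) = 1 / 2 ^ (2 * l) * sSup (OS1 l) - ε / 2 := by
      field_simp
    rw [e] at h
    linarith
  · have hk1 : 1 ≤ k := by omega
    have hk : (1 : ℝ) ≤ k := by exact_mod_cast hk1
    have hlk' : (l : ℝ) + 1 ≤ k := by exact_mod_cast hlt
    have hl' : (1 : ℝ) ≤ l := by exact_mod_cast hl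
    rw [OPT_ne hk1 hlt.ne']
    have hne : (OS2 k l).Nonempty := ⟨_, 0, ⟨le_rfl, by norm_num⟩, 0, ⟨le_rfl, by positivity⟩, rfl⟩
    obtain ⟨z, ⟨a, ha, d, hd, rfl⟩, hz⟩ := exists_lt_of_lt_csSup hne
      (show sSup (OS2 k l) - ε / 2 < sSup (OS2 k l) by linarith)
    set d0 := (l : ℝ) / ((k : ℝ) + l - 1) with hd0
    have hd0h : d0 ≤ 1 / 2 := by rw [hd0, div_le_div_iff₀ (by linarith) (by norm_num)]; linarith
    have hkh : (1 : ℝ) / 2 ≤ k / ((k : ℝ) + l) := by rw [div_le_div_iff₀ (by norm_num) (by linarith)]; linarith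
    have hk1' : (k : ℝ) / ((k : ℝ) + l) ≤ 1 := by rw [div_le_one (by linarith)]; linarith
    have key : ∃ a' d', 0 ≤ a' ∧ a' ≤ 1 ∧ d0 ≤ d' ∧ d' ≤ 1 ∧ Fo k l a d ≤ Fo k l a' d' := by
      have ha2 : a ≤ 1 := by linarith [ha.2]
      by_cases hc : d0 ≤ d
      · exact ⟨a, d, ha.1, ha2, hc, hd.2.trans hk1', le_rfl⟩
      · push Not at hc
        have h := Fo_mono hlt hl a d d0 ha.1 ha2 hd.1 hc.le hd0h
        rcases le_max_iff.1 h with h | h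
        · refine ⟨1 / ((k : ℝ) + l + 1), k / ((k : ℝ) + l), by positivity, ?_, hd0h.trans hkh, hk1',
            h.trans (Fo_zero hlt hl hm a ha.1 ha.2)⟩
          rw [div_le_one (by linarith)]; linarith
        · exact ⟨a, d0, ha.1, ha2, le_rfl, by linarith, h⟩
    obtain ⟨a', d', b1, b2, b3, b4, b5⟩ := key
    obtain ⟨n, A, i1, i2, i3, i4⟩ := exF hlt hl a' d' b1 b2 b3 b4 (ε / 2) (by linarith)
    exact ⟨n, A, i1, i2, i3, by linarith⟩

end P6b
end OS

theorem stmt1 (k l : ℕ) (hl : 1 ≤ l) (hlk : l ≤ k) (hm : 6 ≤ k + l) :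
    (∀ (V : Type) [Fintype V] (A : V → V → Prop), Irreflexive A → (∀ u v, A u v → ¬ A v u) →
      1 ≤ Fintype.card V → starProb k l V A ≤ OPT k l) ∧
    (∀ ε : ℝ, 0 < ε → ∃ (n : ℕ) (A : Fin n → Fin n → Prop), Irreflexive A ∧
      (∀ u v, A u v → ¬ A v u) ∧ 1 ≤ n ∧ OPT k l - ε < starProb k l (Fin n) A) := by
  exact ⟨fun V _ A _ hA hV => OS.upper hl hlk hm A hA hV, fun ε hε => OS.lower hl hlk hm ε hε⟩
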